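/- arXiv:1503.00955 — 2 statements merged into one kernel-verified Lean document; each statement's English description precedes it below -/
import Mathlib

section
/- Assume the Riemann hypothesis. There is an absolute constant C such that for all Δ ≥ 1 and all t ≥ 10, S(t) ≥ -(log t)/(4πΔ) - C·e^{πΔ}. -/
open Complex Real Filter MeasureTheory


lemma sb_term (p y : ℝ) (v0 : ℝ) (hv0 : 1/8 ≤ v0) (hy : |y| ≤ v0) (hp : 0 < p) (hv : v0 ≤ p + |y|) :
    Real.log (p + |y| + 1) - Real.log (p + |y|) - 18 * (v0 / (p + |y|) - v0 / (p + |y| + 1))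
      ≤ p / (p^2 + y^2) := by
  have hY : 0 ≤ |y| := abs_nonneg y
  rw [← sq_abs y]
  generalize |y| = Y at *
  have hvp : 0 < p + Y := by linarith
  have h1 : Real.log (p + Y + 1) - Real.log (p + Y) ≤ 1 / (p + Y) := by
    rw [← Real.log_div (by linarith) hvp.ne']
    have := Real.log_le_sub_one_of_pos (x := (p + Y + 1) / (p + Y)) (by positivity)
    have h2 : (p + Y + 1) / (p + Y) - 1 = 1 / (p + Y) := by field_simp; ring
    linarith
  have h2 : 1 / (p + Y) - p / (p^2 + Y^2) ≤ 2 * Y^2 / (p + Y)^3 := by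
    rw [div_sub_div _ _ hvp.ne' (by positivity), div_le_div_iff₀ (by positivity) (by positivity)]
    nlinarith [sq_nonneg (p - Y), mul_nonneg hp.le hY, mul_nonneg (mul_nonneg hp.le hY) (sq_nonneg (p-Y)),
      mul_nonneg (mul_nonneg hp.le hp.le) hY, pow_pos hp 3, pow_nonneg hY 3, pow_pos hp 4, pow_nonneg hY 4,
      mul_nonneg (pow_pos hp 3).le hY, mul_nonneg (pow_nonneg hY 3) hp.le, pow_nonneg hY 5, mul_nonneg (pow_nonneg hY 4) hp.le, mul_nonneg (pow_pos hp 4).le hY, mul_nonneg (pow_pos hp 3).le (pow_nonneg hY 2), mul_nonneg (pow_pos hp 2).le (pow_nonneg hY 3)]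
  have h3 : 2 * Y^2 / (p + Y)^3 ≤ 18 * (v0 / (p + Y) - v0 / (p + Y + 1)) := by
    generalize p + Y = v at *
    have : 18 * (v0 / v - v0 / (v + 1)) = 18 * v0 / (v * (v + 1)) := by field_simp; ring
    rw [this, div_le_div_iff₀ (by positivity) (by positivity)]
    have a1 : Y^2 ≤ v0^2 := by gcongr
    have a2 : v0 * (v+1) ≤ 9 * v^2 := by nlinarith
    have a3 : Y^2 * (v+1) ≤ 9 * v0 * v^2 := by
      calc Y^2 * (v+1) ≤ v0^2 * (v+1) := by gcongr
        _ = v0 * (v0 * (v+1)) := by ring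
        _ ≤ v0 * (9 * v^2) := by gcongr
        _ = _ := by ring
    calc 2 * Y^2 * (v * (v+1)) = 2 * v * (Y^2 * (v+1)) := by ring
      _ ≤ 2 * v * (9 * v0 * v^2) := by gcongr
      _ = _ := by ring
  linarith

lemma sb_sum (a y : ℝ) (ha : 1/8 ≤ a) (m : ℕ) :
    Real.log (a + |y| + m) - Real.log (a + |y|) - 18 + 18 * ((a + |y|) / (a + |y| + m)) ≤
      ∑ j ∈ Finset.range m, (a + j) / ((a + j)^2 + y^2) := by
  have hY : 0 ≤ |y| := abs_nonneg y
  induction m with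
  | zero => simp; rw [div_self (by linarith)]
  | succ m ih =>
    rw [Finset.sum_range_succ]
    have hm : (0:ℝ) ≤ m := Nat.cast_nonneg m
    have := sb_term (a + m) y (a + |y|) (by linarith) (by linarith) (by linarith) (by linarith)
    push_cast
    have e1 : a + (m:ℝ) + |y| = a + |y| + m := by ring
    rw [e1] at this
    rw [← add_assoc (a+|y|)]
    linarith

lemma sb_prod (u : ℂ) (h : ℝ) (hu : 1/8 ≤ u.re) (h0 : 0 ≤ h) (h1 : h ≤ 1) (n : ℕ) (hn : 1 ≤ n) :
    h * (Real.log n - (Real.log (1 + ‖u‖) + 19)) ≤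
      ∑ j ∈ Finset.range (n+1), Real.log ((u.re + h + j)^2 + u.im^2) / 2
      - ∑ j ∈ Finset.range (n+1), Real.log ((u.re + j)^2 + u.im^2) / 2 := by
  set G : ℝ → ℝ := fun x => ∑ j ∈ Finset.range (n+1), Real.log ((u.re + x + j)^2 + u.im^2) / 2 with hG
  have hpos : ∀ x : ℝ, 0 ≤ x → ∀ j : ℕ, 0 < (u.re + x + j)^2 + u.im^2 := by
    intro x hx j
    have : 0 < u.re + x + j := by positivity
    positivity
  have hder : ∀ x : ℝ, 0 ≤ x → HasDerivAt G (∑ j ∈ Finset.range (n+1), (u.re + x + j) / ((u.re + x + j)^2 + u.im^2)) x := by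
    intro x hx
    apply HasDerivAt.fun_sum
    intro j _
    have := (((((hasDerivAt_id x).const_add u.re).add_const (j:ℝ)).pow 2).add_const (u.im^2)).log (hpos x hx j).ne'
    refine (this.div_const 2).congr_deriv ?_
    simp only [Pi.pow_apply, id_eq]
    norm_num; ring
  have key : ∀ x ∈ Set.Icc (0:ℝ) h, Real.log n - (Real.log (1 + ‖u‖) + 19) ≤ ∑ j ∈ Finset.range (n+1), (u.re + x + j) / ((u.re + x + j)^2 + u.im^2) := by
    intro x hx
    have := sb_sum (u.re + x) u.im (by linarith [hx.1]) (n+1)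
    have hv : 0 < u.re + x + |u.im| := by have := abs_nonneg u.im; linarith [hx.1]
    have l1 : Real.log n ≤ Real.log (u.re + x + |u.im| + ((n+1 : ℕ):ℝ)) := by
      apply Real.log_le_log (by exact_mod_cast hn)
      push_cast; linarith
    have l2 : Real.log (u.re + x + |u.im|) ≤ Real.log (1 + ‖u‖) + 1 := by
      have : u.re + x + |u.im| ≤ 2 * (1 + ‖u‖) := by
        have := Complex.abs_re_le_norm u
        have := Complex.abs_im_le_norm u
        have := le_abs_self u.re
        linarith [hx.2]
      calc _ ≤ Real.log (2 * (1 + ‖u‖)) := Real.log_le_log hv this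
        _ = Real.log 2 + Real.log (1 + ‖u‖) := Real.log_mul (by norm_num) (by positivity)
        _ ≤ _ := by have := Real.log_two_lt_d9; linarith
    have l3 : 0 ≤ 18 * ((u.re + x + |u.im|) / (u.re + x + |u.im| + ((n+1 : ℕ):ℝ))) := by positivity
    linarith
  have hmv := Convex.mul_sub_le_image_sub_of_le_deriv (convex_Icc (0:ℝ) h) (f := G)
    (fun x hx => (hder x hx.1).continuousAt.continuousWithinAt)
    (fun x hx => (hder x (interior_subset hx).1).differentiableAt.differentiableWithinAt)
    (C := Real.log n - (Real.log (1 + ‖u‖) + 19))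
    (fun x hx => by rw [(hder x (interior_subset hx).1).deriv]; exact key x (interior_subset hx))
    0 ⟨le_rfl, h0⟩ h ⟨h0, le_rfl⟩ h0
  simp only [hG, add_zero, sub_zero] at hmv
  linarith

lemma sb_gamma_ratio (u : ℂ) (h : ℝ) (hu : 1/8 ≤ u.re) (h0 : 0 ≤ h) (h1 : h ≤ 1) :
    ‖Complex.Gamma (u + h)‖ ≤ ‖Complex.Gamma u‖ * Real.exp (h * (Real.log (1 + ‖u‖) + 19)) := by
  have t1 := (Complex.GammaSeq_tendsto_Gamma (u + h)).norm
  have t2 := ((Complex.GammaSeq_tendsto_Gamma u).norm).mul_const (Real.exp (h * (Real.log (1 + ‖u‖) + 19)))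
  refine le_of_tendsto_of_tendsto t1 t2 ?_
  filter_upwards [eventually_ge_atTop 1] with n hn
  have hn0 : (0:ℝ) < n := by exact_mod_cast hn
  have hP := sb_prod u h hu h0 h1 n hn
  have hnorm : ∀ s : ℂ, 0 < s.re → ∏ j ∈ Finset.range (n+1), ‖s + j‖ =
      Real.exp (∑ j ∈ Finset.range (n+1), Real.log ((s.re + j)^2 + s.im^2) / 2) := by
    intro s hs
    rw [Real.exp_sum]
    refine Finset.prod_congr rfl fun j _ => ?_
    have hp : 0 < (s.re + j)^2 + s.im^2 := by
      have : 0 < s.re + j := by positivity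
      positivity
    rw [Complex.norm_eq_sqrt_sq_add_sq, Real.sqrt_eq_rpow, Real.rpow_def_of_pos (by simpa using hp)]
    simp
    ring
  have g : ∀ s : ℂ, 0 < s.re → ‖Complex.GammaSeq s n‖ = (n:ℝ)^s.re * (n.factorial : ℝ) / Real.exp (∑ j ∈ Finset.range (n+1), Real.log ((s.re + j)^2 + s.im^2) / 2) := by
    intro s hs
    rw [Complex.GammaSeq, norm_div, norm_mul, norm_prod, hnorm s hs]
    congr 2
    · rw [Complex.norm_natCast_cpow_of_pos hn]
    · simp
  rw [g _ (by simp; linarith), g u (by linarith)]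
  simp only [add_re, ofReal_re, add_im, ofReal_im, add_zero]
  rw [Real.rpow_add hn0, div_mul_eq_mul_div, div_le_div_iff₀ (Real.exp_pos _) (Real.exp_pos _), Real.rpow_def_of_pos hn0 h]
  have : Real.exp (Real.log n * h) * Real.exp (∑ j ∈ Finset.range (n+1), Real.log ((u.re + j)^2 + u.im^2) / 2) ≤ Real.exp (h * (Real.log (1 + ‖u‖) + 19)) * Real.exp (∑ j ∈ Finset.range (n+1), Real.log ((u.re + h + j)^2 + u.im^2) / 2) := by
    rw [← Real.exp_add, ← Real.exp_add]
    apply Real.exp_le_exp.2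
    linarith
  have hf : (0:ℝ) ≤ (n:ℝ)^u.re * n.factorial := by positivity
  calc _ = ((n:ℝ)^u.re * n.factorial) * (Real.exp (Real.log n * h) * Real.exp (∑ j ∈ Finset.range (n+1), Real.log ((u.re + j)^2 + u.im^2) / 2)) := by ring
    _ ≤ ((n:ℝ)^u.re * n.factorial) * _ := mul_le_mul_of_nonneg_left this hf
    _ = _ := by ring


noncomputable def sbF (t : ℝ) : ℂ := Set.indicator (Set.Ioi (1:ℝ)) (fun t => ((Int.fract t : ℝ) : ℂ)) t

noncomputable def sbJ (s : ℂ) : ℂ := ∫ t in Set.Ioi (1:ℝ), ((Int.fract t : ℝ) : ℂ) * (t:ℂ) ^ (-(s+1))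

lemma sbJ_mellin (s : ℂ) : sbJ s = mellin sbF (-s) := by
  rw [mellin, sbJ]
  have : ∀ t : ℝ, (t:ℂ)^(-s-1) • sbF t = Set.indicator (Set.Ioi (1:ℝ)) (fun t => ((Int.fract t : ℝ) : ℂ) * (t:ℂ) ^ (-(s+1))) t := by
    intro t
    by_cases h : t ∈ Set.Ioi (1:ℝ)
    · simp [sbF, Set.indicator_of_mem h]; rw [mul_comm]; congr 2; ring
    · simp [sbF, Set.indicator_of_notMem h]
  simp_rw [this]
  rw [MeasureTheory.setIntegral_indicator measurableSet_Ioi]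
  congr 2
  ext x; simp

lemma sbF_norm (t : ℝ) : ‖sbF t‖ ≤ 1 := by
  unfold sbF
  by_cases h : t ∈ Set.Ioi (1:ℝ)
  · rw [Set.indicator_of_mem h, Complex.norm_real, Real.norm_eq_abs, abs_of_nonneg (Int.fract_nonneg t)]
    exact (Int.fract_lt_one t).le
  · rw [Set.indicator_of_notMem h]; simp

lemma sbF_meas : Measurable sbF := by
  unfold sbF
  exact (Complex.measurable_ofReal.comp measurable_fract).indicator measurableSet_Ioi

lemma sbJ_diff (s : ℂ) (hs : 0 < s.re) : DifferentiableAt ℂ sbJ s := by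
  have : sbJ = fun s => mellin sbF (-s) := funext sbJ_mellin
  rw [this]
  have hd : DifferentiableAt ℂ (mellin sbF) (-s) := by
    apply mellin_differentiableAt_of_isBigO_rpow (a := 0) (b := (-s).re - 1)
    · apply LocallyIntegrable.locallyIntegrableOn
      have : LocallyIntegrable (fun _ : ℝ => (1:ℝ)) := (continuous_const).locallyIntegrable
      refine this.mono sbF_meas.aestronglyMeasurable ?_
      filter_upwards with t
      simpa using sbF_norm t
    · apply Asymptotics.IsBigO.of_bound 1
      filter_upwards with t
      simpa using sbF_norm t
    · simpa using hs
    · apply Asymptotics.IsBigO.of_bound 1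
      have : ∀ᶠ t in nhdsWithin (0:ℝ) (Set.Ioi 0), t < 1 := mem_nhdsWithin_of_mem_nhds (Iio_mem_nhds one_pos)
      filter_upwards [this] with t ht
      have : sbF t = 0 := by
        unfold sbF; rw [Set.indicator_of_notMem]; simp; linarith
      rw [this]; simp; 
    · linarith
  exact hd.comp s (differentiableAt_id.neg)

lemma sbJ_norm (s : ℂ) (hs : 0 < s.re) : ‖sbJ s‖ ≤ 1 / s.re := by
  unfold sbJ
  calc _ ≤ ∫ t in Set.Ioi (1:ℝ), t ^ (-(s.re+1)) := by
        apply norm_integral_le_of_norm_le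
        · apply integrableOn_Ioi_rpow_of_lt <;> linarith
        · filter_upwards [ae_restrict_mem measurableSet_Ioi] with t ht
          have ht0 : 0 < t := lt_trans one_pos ht
          rw [norm_mul, Complex.norm_real, Real.norm_eq_abs, abs_of_nonneg (Int.fract_nonneg t), Complex.norm_cpow_eq_rpow_re_of_pos ht0]
          have := (Int.fract_lt_one t).le
          have h2 : 0 ≤ t ^ (-(s.re+1)) := by positivity
          simp only [neg_re, add_re, one_re]
          nlinarith
    _ = 1 / s.re := by
        rw [integral_Ioi_rpow_of_lt (by linarith) one_pos]
        simp

lemma sb_zeta_J (s : ℂ) (hs : 1 < s.re) : riemannZeta s = s / (s - 1) - s * sbJ s := by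
  rw [← LSeries_one_eq_riemannZeta hs, LSeries_eq_mul_integral' (r := 1) _ zero_le_one hs]
  · have hc : ∀ t ∈ Set.Ioi (1:ℝ), (∑ k ∈ Finset.Icc 1 ⌊t⌋₊, (1 : ℕ → ℂ) k) * (t:ℂ) ^ (-(s+1)) = (t:ℂ)^(-s) - ((Int.fract t : ℝ) : ℂ) * (t:ℂ) ^ (-(s+1)) := by
      intro t ht
      have ht0 : 0 < t := lt_trans one_pos ht
      have : (t:ℂ)^(-s) = t * (t:ℂ) ^ (-(s+1)) := by
        rw [show -s = 1 + (-(s+1)) by ring, Complex.cpow_add _ _ (by exact_mod_cast ht0.ne'), Complex.cpow_one]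
        
      rw [this, ← sub_mul]
      congr 1
      simp
      have h2 := Int.floor_add_fract t
      have h3 : (⌊t⌋₊ : ℝ) = (⌊t⌋ : ℝ) := by
        exact natCast_floor_eq_intCast_floor ht0.le
      have h4 : (⌊t⌋₊ : ℝ) = t - Int.fract t := by linarith
      rw [← Complex.ofReal_sub, ← h4]; simp
    rw [setIntegral_congr_fun measurableSet_Ioi hc, integral_sub, integral_Ioi_cpow_of_lt (by simpa using hs) one_pos]
    · have : s - 1 ≠ 0 := by intro h; rw [sub_eq_zero.1 h] at hs; simp at hs
      have h2 : -s + 1 ≠ 0 := by intro h; apply this; linear_combination -h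
      unfold sbJ
      rw [mul_sub]
      congr 1
      simp
      field_simp
      ring
    · exact integrableOn_Ioi_cpow_of_lt (by simpa using hs) one_pos
    · have := integrableOn_Ioi_rpow_of_lt (a := -(s.re+1)) (by linarith) one_pos
      refine Integrable.mono' this ?_ ?_
      · apply Measurable.aestronglyMeasurable
        exact (Complex.measurable_ofReal.comp measurable_fract).mul (Complex.measurable_ofReal.pow_const _)
      · filter_upwards [ae_restrict_mem measurableSet_Ioi] with t ht
        have ht0 : 0 < t := lt_trans one_pos ht
        rw [norm_mul, Complex.norm_real, Real.norm_eq_abs, abs_of_nonneg (Int.fract_nonneg t), Complex.norm_cpow_eq_rpow_re_of_pos ht0]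
        have := (Int.fract_lt_one t).le
        have h2 : 0 ≤ t ^ (-(s.re+1)) := by positivity
        simp only [neg_re, add_re, one_re]
        nlinarith
  · simp
    exact Asymptotics.isBigO_refl _ _

lemma sb_Z_J (s : ℂ) (hs : 0 < s.re) : riemannZeta₁ s = s - s * (s - 1) * sbJ s := by
  have hopen : IsOpen {s : ℂ | 0 < s.re} := isOpen_lt continuous_const Complex.continuous_re
  have hpre : IsPreconnected {s : ℂ | 0 < s.re} := (convex_halfSpace_re_gt 0).isPreconnected
  have h1 : AnalyticOnNhd ℂ riemannZeta₁ {s : ℂ | 0 < s.re} := (differentiable_riemannZeta₁.differentiableOn).analyticOnNhd hopen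
  have h2 : AnalyticOnNhd ℂ (fun s => s - s * (s - 1) * sbJ s) {s : ℂ | 0 < s.re} := by
    apply DifferentiableOn.analyticOnNhd _ hopen
    intro s hs
    have := sbJ_diff s hs
    exact DifferentiableAt.differentiableWithinAt (by fun_prop)
  refine h1.eqOn_of_preconnected_of_eventuallyEq h2 hpre (z₀ := 2) (by simp) ?_ hs
  have : {s : ℂ | 1 < s.re} ∈ nhds (2:ℂ) := (isOpen_lt continuous_const Complex.continuous_re).mem_nhds (by simp)
  filter_upwards [this] with z hz
  have hz1 : z ≠ 1 := by rintro rfl; simp at hz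
  have h3 := sb_zeta_J z hz
  rw [riemannZeta_eq_inv_sub_mul hz1] at h3
  have : z - 1 ≠ 0 := sub_ne_zero.2 hz1
  field_simp at h3
  rw [h3]; ring

lemma sb_growth (s : ℂ) (hs : 1/8 ≤ s.re) : ‖riemannZeta₁ s‖ ≤ 9 * (1 + ‖s‖)^2 := by
  rw [sb_Z_J s (by linarith)]
  have hJ : ‖sbJ s‖ ≤ 8 := by
    refine (sbJ_norm s (by linarith)).trans ?_
    rw [div_le_iff₀ (by linarith)]; linarith
  calc _ ≤ ‖s‖ + ‖s‖ * ‖s - 1‖ * ‖sbJ s‖ := by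
        refine (norm_sub_le _ _).trans ?_
        rw [norm_mul, norm_mul]
    _ ≤ ‖s‖ + ‖s‖ * (‖s‖ + 1) * 8 := by
        gcongr
        refine (norm_sub_le _ _).trans ?_
        simp
    _ ≤ _ := by nlinarith [norm_nonneg s]


lemma sb_bc (G : ℂ → ℂ) (R M : ℝ) (hR : 0 < R) (hM : 0 < M) (hG : Differentiable ℂ G)
    (h0 : ∀ z ∈ Metric.ball (0:ℂ) R, G z ≠ 0) (h1 : G 0 = 1)
    (hb : ∀ z ∈ Metric.ball (0:ℂ) R, ‖G z‖ ≤ Real.exp M) (r : ℝ) (hr : r < R) :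
    (∀ z : ℂ, ‖z‖ ≤ r → ‖G z‖⁻¹ ≤ Real.exp (2 * M * r / (R - r))) ∧
    (∀ (z : ℂ) (ρ : ℝ), 0 < ρ → ‖z‖ + ρ ≤ r → ‖deriv G z / G z‖ ≤ (2 * M * r / (R - r)) / ρ) := by
  have hdG : Differentiable ℂ (deriv G) := hG.contDiff.differentiable_deriv_two
  have hq : DifferentiableOn ℂ (fun z => deriv G z / G z) (Metric.ball 0 R) := by
    intro z hz
    exact ((hdG z).div (hG z) (h0 z hz)).differentiableWithinAt
  obtain ⟨g, hg0, hg⟩ := hq.isExactOn_ball.with_val_at 0 0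
  have hexp : ∀ z ∈ Metric.ball (0:ℂ) R, G z = Complex.exp (g z) := by
    have hc : ∀ z ∈ Metric.ball (0:ℂ) R, HasDerivAt (fun z => G z * Complex.exp (-g z)) 0 z := by
      intro z hz
      have := (hG z).hasDerivAt.mul ((hg z hz).neg.cexp)
      refine this.congr_deriv ?_
      have := h0 z hz
      simp only [Pi.neg_apply]
      field_simp
      ring
    intro z hz
    have := (convex_ball (0:ℂ) R).is_const_of_fderivWithin_eq_zero (𝕜 := ℂ) (f := fun z => G z * Complex.exp (-g z))
      (fun z hz => (hc z hz).differentiableAt.differentiableWithinAt)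
      (fun z hz => by
        rw [fderivWithin_of_isOpen Metric.isOpen_ball hz]
        ext
        simpa using (hc z hz).deriv) hz (Metric.mem_ball_self hR)
    simp only [hg0, h1, neg_zero, Complex.exp_zero, mul_one] at this
    rw [Complex.exp_neg] at this
    field_simp at this
    exact this
  have hmap : Set.MapsTo g (Metric.ball 0 R) {z | z.re ≤ M} := by
    intro z hz
    have := hb z hz
    rw [hexp z hz, Complex.norm_exp] at this
    exact Real.exp_le_exp.1 this
  have hgd : DifferentiableOn ℂ g (Metric.ball 0 R) := fun z hz => (hg z hz).differentiableAt.differentiableWithinAt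
  have hbound : ∀ z : ℂ, ‖z‖ ≤ r → ‖g z‖ ≤ 2 * M * r / (R - r) := by
    intro z hz
    have hz' : z ∈ Metric.ball (0:ℂ) R := by rw [mem_ball_zero_iff]; linarith
    have := Complex.borelCaratheodory_zero hM hgd hmap hR hz' hg0
    refine this.trans ?_
    have := norm_nonneg z
    have h2 : 0 < R - r := by linarith
    have h3 : 0 ≤ r := by linarith
    gcongr
  constructor
  · intro z hz
    have hz' : z ∈ Metric.ball (0:ℂ) R := by rw [mem_ball_zero_iff]; linarith
    rw [hexp z hz', Complex.norm_exp, ← Real.exp_neg]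
    apply Real.exp_le_exp.2
    have := hbound z hz
    have h2 := Complex.abs_re_le_norm (g z)
    have h3 := neg_abs_le (g z).re
    linarith
  · intro z ρ hρ hz
    have hz' : z ∈ Metric.ball (0:ℂ) R := by rw [mem_ball_zero_iff]; linarith
    rw [← (hg z hz').deriv]
    apply Complex.norm_deriv_le_of_forall_mem_sphere_norm_le hρ
    · apply DifferentiableOn.diffContOnCl
      refine hgd.mono ?_
      rw [closure_ball _ hρ.ne']
      intro w hw
      rw [mem_ball_zero_iff]
      rw [mem_closedBall_iff_norm] at hw
      have := norm_add_le z (w - z)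
      rw [add_sub_cancel] at this
      linarith
    · intro w hw
      apply hbound
      rw [mem_sphere_iff_norm] at hw
      have := norm_add_le z (w - z)
      rw [add_sub_cancel] at this
      linarith

lemma sb_ne (RH : ∀ ρ : ℂ, riemannZeta ρ = 0 → 0 ≤ ρ.re → ρ.re ≤ 1 → ρ.re = 1 / 2) (s : ℂ) (hs : 1/2 < s.re) :
    riemannZeta₁ s ≠ 0 := by
  by_cases h1 : s = 1
  · rw [h1, riemannZeta₁_one]; exact one_ne_zero
  · intro h
    have hz := riemannZeta_eq_inv_sub_mul h1
    rw [h, mul_zero] at hz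
    by_cases h2 : 1 ≤ s.re
    · exact riemannZeta_ne_zero_of_one_le_re h2 hz
    · have := RH s hz (by linarith) (by linarith)
      linarith

lemma sb_LS (f : ℕ → ℂ) (x : ℝ) (hf : LSeriesSummable f x) (s : ℂ) (hs : x ≤ s.re) :
    ‖LSeries f s‖ ≤ ∑' n, ‖LSeries.term f x n‖ := by
  have hle : ∀ n, ‖LSeries.term f s n‖ ≤ ‖LSeries.term f x n‖ :=
    fun n => LSeries.norm_term_le_of_re_le_re f (by simpa using hs) n
  have hsum : Summable fun n => ‖LSeries.term f x n‖ := hf.norm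
  unfold LSeries
  exact tsum_of_norm_bounded hsum.hasSum hle

lemma sb_ge2 : ∃ K : ℝ, 1 ≤ K ∧ ∀ s : ℂ, 2 ≤ s.re → ‖riemannZeta s‖ ≤ K ∧ ‖riemannZeta s‖⁻¹ ≤ K ∧
    ‖deriv riemannZeta s / riemannZeta s‖ ≤ K := by
  have e : ∀ f : ℕ → ℂ, 0 ≤ ∑' n, ‖LSeries.term f (2:ℝ) n‖ := fun f => tsum_nonneg fun n => norm_nonneg _
  refine ⟨1 + (∑' n, ‖LSeries.term 1 (2:ℝ) n‖) + (∑' n, ‖LSeries.term (fun n => ((ArithmeticFunction.moebius n : ℤ) : ℂ)) (2:ℝ) n‖) + ∑' n, ‖LSeries.term (fun n => ((ArithmeticFunction.vonMangoldt n : ℝ) : ℂ)) (2:ℝ) n‖, ?_, ?_⟩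
  · linarith [e 1, e (fun n => ((ArithmeticFunction.moebius n : ℤ) : ℂ)), e (fun n => ((ArithmeticFunction.vonMangoldt n : ℝ) : ℂ))]
  · intro s hs
    have hs1 : 1 < s.re := by linarith
    have a1 := sb_LS 1 2 (LSeriesSummable_one_iff.2 (by simp)) s hs
    have a2 := sb_LS (fun n => ((ArithmeticFunction.moebius n : ℤ) : ℂ)) 2 (ArithmeticFunction.LSeriesSummable_moebius_iff.2 (by simp)) s hs
    have a3 := sb_LS (fun n => ((ArithmeticFunction.vonMangoldt n : ℝ) : ℂ)) 2 (ArithmeticFunction.LSeriesSummable_vonMangoldt (by simp)) s hs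
    have h1 := e 1
    have h2 := e (fun n => ((ArithmeticFunction.moebius n : ℤ) : ℂ))
    have h3 := e (fun n => ((ArithmeticFunction.vonMangoldt n : ℝ) : ℂ))
    refine ⟨?_, ?_, ?_⟩
    · rw [← LSeries_one_eq_riemannZeta hs1]; linarith
    · have := LSeries_one_mul_Lseries_moebius hs1
      rw [LSeries_one_eq_riemannZeta hs1] at this
      rw [← norm_inv, ← eq_inv_of_mul_eq_one_right this]; linarith
    · have := ArithmeticFunction.LSeries_vonMangoldt_eq_deriv_riemannZeta_div hs1
      rw [neg_div] at this
      rw [← norm_neg, ← this]; linarith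

lemma sb_L3 (RH : ∀ ρ : ℂ, riemannZeta ρ = 0 → 0 ≤ ρ.re → ρ.re ≤ 1 → ρ.re = 1 / 2) (a : ℝ) (ha : 1/2 < a) (ha1 : a < 1) :
    ∃ C : ℝ, 0 ≤ C ∧ ∀ s : ℂ, a ≤ s.re → ‖riemannZeta₁ s‖⁻¹ ≤ Real.exp (C * Real.log (2 + ‖s‖)) ∧
      (s.re ≤ 2 → ‖deriv riemannZeta₁ s / riemannZeta₁ s‖ ≤ C * Real.log (2 + ‖s‖)) := by
  obtain ⟨K, hK1, hK⟩ := sb_ge2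
  have hl2 : 0 < Real.log 2 := Real.log_pos (by norm_num)
  have hlog : ∀ s : ℂ, Real.log 2 ≤ Real.log (2 + ‖s‖) := fun s => Real.log_le_log (by norm_num) (by linarith [norm_nonneg s])
  have hZK : ∀ s : ℂ, 2 ≤ s.re → ‖riemannZeta₁ s‖⁻¹ ≤ K := by
    intro s hs
    have h1 : s ≠ 1 := by rintro rfl; norm_num at hs
    have := riemannZeta_eq_inv_sub_mul h1
    have h2 : s - 1 ≠ 0 := sub_ne_zero.2 h1
    have h3 : riemannZeta₁ s = (s - 1) * riemannZeta s := by rw [this]; field_simp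
    rw [h3, norm_mul, mul_inv]
    have h4 : 1 ≤ ‖s - 1‖ := by
      have := Complex.abs_re_le_norm (s-1)
      have h5 := le_abs_self (s-1).re
      simp at this h5
      linarith
    have h5 : ‖s - 1‖⁻¹ ≤ 1 := inv_le_one_of_one_le₀ h4
    have h6 := (hK s hs).2.1
    have h7 : 0 ≤ ‖riemannZeta s‖⁻¹ := by positivity
    nlinarith
  set B := Real.log (81 * K) / Real.log 2 + 2 with hB
  have hB0 : 0 ≤ B := by
    have : 0 ≤ Real.log (81 * K) := Real.log_nonneg (by linarith)
    positivity
  have hBK : Real.log K ≤ B * Real.log 2 := by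
    rw [hB, add_mul, div_mul_cancel₀ _ hl2.ne']
    have : Real.log K ≤ Real.log (81 * K) := Real.log_le_log (by linarith) (by linarith)
    linarith
  set δ := (a - 1/2)/2 with hδ
  have hδ0 : 0 < δ := by rw [hδ]; linarith
  set D := 2 * (2 - a + δ) / (3/2 - (2 - a + δ)) with hD
  have hden : 0 < 3/2 - (2 - a + δ) := by rw [hδ]; linarith
  have hnum : 0 < 2 - a + δ := by linarith
  have hD0 : 0 ≤ D := by positivity
  refine ⟨B + B * D + B * D / δ, by positivity, ?_⟩
  intro s hs
  have hlogs := hlog s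
  set l := Real.log (2 + ‖s‖) with hl
  have hl0 : 0 < l := by linarith
  by_cases h2 : 2 < s.re
  · refine ⟨?_, fun h => absurd h (by linarith)⟩
    refine (hZK s h2.le).trans ?_
    rw [← Real.exp_log (show 0 < K by linarith)]
    apply Real.exp_le_exp.2
    have : B * Real.log 2 ≤ B * l := by gcongr
    have h3 : 0 ≤ B * D := by positivity
    have h4 : 0 ≤ B * D / δ := by positivity
    nlinarith
  · set z0 : ℂ := 2 + s.im * Complex.I with hz0
    have hz0re : z0.re = 2 := by simp [hz0]
    have hz0n : ‖z0‖ ≤ ‖s‖ + 2 := by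
      calc ‖z0‖ ≤ ‖(2:ℂ)‖ + ‖(s.im:ℂ) * Complex.I‖ := norm_add_le _ _
        _ ≤ _ := by
          have := Complex.abs_im_le_norm s
          simp; linarith
    have hzz : ‖s - z0‖ ≤ 2 - a := by
      have : s - z0 = ((s.re - 2 : ℝ) : ℂ) := by
        apply Complex.ext <;> simp [hz0]
      rw [this, Complex.norm_real, Real.norm_eq_abs, abs_le]
      constructor <;> linarith
    have hn0 : riemannZeta₁ z0 ≠ 0 := sb_ne RH z0 (by rw [hz0re]; norm_num)
    have hinv := hZK z0 hz0re.ge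
    have hbc := sb_bc (fun z => riemannZeta₁ (z0 + z) / riemannZeta₁ z0) (3/2) (B * l) (by norm_num)
      (by
        have : 0 < B := by
          have : 0 ≤ Real.log (81 * K) := Real.log_nonneg (by linarith)
          positivity
        positivity)
      ((differentiable_riemannZeta₁.comp (differentiable_const z0 |>.add differentiable_id)).div_const _)
      (by
        intro z hz
        apply div_ne_zero _ hn0
        apply sb_ne RH
        rw [mem_ball_zero_iff] at hz
        have := Complex.abs_re_le_norm z
        have := neg_abs_le z.re
        rw [add_re, hz0re]; linarith)
      (by simp [div_self hn0])
      (by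
        intro z hz
        rw [mem_ball_zero_iff] at hz
        have h3 := Complex.abs_re_le_norm z
        have h4 := neg_abs_le z.re
        have h5 := sb_growth (z0 + z) (by rw [add_re, hz0re]; linarith)
        have h6 : ‖z0 + z‖ ≤ ‖s‖ + 2 + 3/2 := (norm_add_le _ _).trans (by linarith)
        have h7 : (1 + ‖z0 + z‖) ≤ 3 * (2 + ‖s‖) := by linarith [norm_nonneg s]
        rw [norm_div, div_eq_mul_inv]
        have h8 : Real.exp (B * l) ≥ 81 * K * (2 + ‖s‖)^2 := by
          have : Real.log (81 * K * (2 + ‖s‖)^2) ≤ B * l := by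
            rw [Real.log_mul (by positivity) (by positivity), Real.log_pow, hB, add_mul]
            have : Real.log (81 * K) ≤ Real.log (81 * K) / Real.log 2 * l := by
              rw [div_mul_eq_mul_div, le_div_iff₀ hl2]
              have : 0 ≤ Real.log (81 * K) := Real.log_nonneg (by linarith)
              gcongr
            push_cast
            linarith
          rw [ge_iff_le, ← Real.log_le_iff_le_exp (by positivity)]
          exact this
        calc _ ≤ (9 * (1 + ‖z0 + z‖)^2) * K := by gcongr
          _ ≤ (9 * (3 * (2 + ‖s‖))^2) * K := by gcongr
          _ = 81 * K * (2 + ‖s‖)^2 := by ring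
          _ ≤ _ := h8)
      (2 - a + δ) (by linarith)
    have hDD : 2 * (B * l) * (2 - a + δ) / (3/2 - (2 - a + δ)) = B * D * l := by rw [hD]; ring
    rw [hDD] at hbc
    obtain ⟨b1, b2⟩ := hbc
    have c1 := b1 (s - z0) (by linarith)
    have c2 := b2 (s - z0) δ hδ0 (by linarith)
    simp only [add_sub_cancel] at c1 c2
    have hder : deriv (fun z => riemannZeta₁ (z0 + z) / riemannZeta₁ z0) (s - z0) = deriv riemannZeta₁ s / riemannZeta₁ z0 := by
      rw [deriv_div_const, deriv_comp_const_add, add_sub_cancel]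
    rw [hder, div_div_div_cancel_right₀ hn0] at c2
    have h3 : 0 ≤ B * l := by positivity
    have h4 : 0 ≤ B * D / δ * l := by positivity
    have h5 : 0 ≤ B * D * l := by positivity
    constructor
    · have e : ‖riemannZeta₁ s‖⁻¹ = ‖riemannZeta₁ s / riemannZeta₁ z0‖⁻¹ * ‖riemannZeta₁ z0‖⁻¹ := by
        rw [norm_div, inv_div, div_mul_eq_mul_div, mul_inv_cancel₀ (norm_ne_zero_iff.2 hn0), one_div]
      rw [e]
      calc _ ≤ Real.exp (B * D * l) * K := by gcongr
        _ = Real.exp (B * D * l + Real.log K) := by rw [Real.exp_add, Real.exp_log (by linarith)]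
        _ ≤ _ := by
          apply Real.exp_le_exp.2
          have : B * Real.log 2 ≤ B * l := by gcongr
          linarith
    · intro _
      have : B * D * l / δ = B * D / δ * l := by ring
      linarith


noncomputable def sbX (s : ℂ) : ℂ := s * ((π:ℂ) ^ (-s/2) * Complex.Gamma (s/2)) * riemannZeta₁ s

lemma sbX_norm (s : ℂ) : ‖sbX s‖ = ‖s‖ * (π ^ (-s.re/2) * ‖Complex.Gamma (s/2)‖) * ‖riemannZeta₁ s‖ := by
  rw [sbX, norm_mul, norm_mul, norm_mul, Complex.norm_cpow_eq_rpow_re_of_pos Real.pi_pos]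
  congr 4
  simp

lemma sbX_diff (s : ℂ) (hs : 0 < s.re) : DifferentiableAt ℂ sbX s := by
  unfold sbX
  have h1 : DifferentiableAt ℂ (fun s : ℂ => Complex.Gamma (s/2)) s := by
    apply DifferentiableAt.comp (g := Complex.Gamma) s _ (by fun_prop)
    apply Complex.differentiableAt_Gamma
    intro m h
    have := congrArg Complex.re h
    simp at this
    have h2 : (0:ℝ) ≤ m := Nat.cast_nonneg m
    linarith
  have h2 : DifferentiableAt ℂ (fun s : ℂ => (π:ℂ) ^ (-s/2)) s := by
    apply DifferentiableAt.const_cpow (by fun_prop)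
    left; exact_mod_cast Real.pi_pos.ne'
  have h3 := differentiable_riemannZeta₁ s
  fun_prop

lemma sbX_completed (s : ℂ) (hs : 0 < s.re) (h1 : s ≠ 1) : sbX s = s * (s - 1) * completedRiemannZeta s := by
  have h0 : s ≠ 0 := by rintro rfl; simp at hs
  have h2 := riemannZeta_def_of_ne_zero h0
  have hG := Complex.Gammaℝ_ne_zero_of_re_pos hs
  rw [riemannZeta_eq_inv_sub_mul h1] at h2
  have h3 : s - 1 ≠ 0 := sub_ne_zero.2 h1
  field_simp at h2
  rw [sbX, ← Complex.Gammaℝ_def, mul_assoc, mul_comm (Complex.Gammaℝ s), h2]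
  ring

lemma sbX_fe (s : ℂ) (hs : 0 < s.re) (hs1 : s.re < 1) : sbX (1 - s) = sbX s := by
  rw [sbX_completed s hs (by rintro rfl; simp at hs1), sbX_completed (1-s) (by simpa using hs1), completedRiemannZeta_one_sub]
  · ring
  · intro h
    have : s = 0 := by linear_combination -h
    rw [this] at hs; simp at hs

lemma sbX_conj (s : ℂ) : ‖sbX ((starRingEnd ℂ) s)‖ = ‖sbX s‖ := by
  rw [sbX_norm, sbX_norm]
  congr 1
  · congr 1
    · simp
    · congr 1
      rw [show (starRingEnd ℂ) s / 2 = (starRingEnd ℂ) (s/2) by rw [map_div₀, map_ofNat], Complex.Gamma_conj, Complex.norm_conj]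
  · by_cases h : s = 1
    · rw [h]; simp
    · have e : ∀ s : ℂ, s ≠ 1 → riemannZeta₁ s = (s - 1) * riemannZeta s := by
        intro s h
        rw [riemannZeta_eq_inv_sub_mul h]
        have h3 : s - 1 ≠ 0 := sub_ne_zero.2 h
        field_simp
      have h' : (starRingEnd ℂ) s ≠ 1 := (map_ne_one_iff _ (starRingEnd ℂ).injective).mpr h
      have h2 : (starRingEnd ℂ) s - 1 = (starRingEnd ℂ) (s - 1) := by simp
      rw [e s h, e _ h', riemannZeta_conj, h2, norm_mul, norm_mul, Complex.norm_conj, Complex.norm_conj]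

lemma sb_beta (v : ℝ) (hv : 0 < v) : ∃ K : ℝ, 0 ≤ K ∧ ∀ u : ℂ, 1/8 ≤ u.re → ‖Complex.Gamma u‖ ≤ K * ‖Complex.Gamma (u + v)‖ := by
  have hv' : 0 < ‖Complex.Gamma v‖ := norm_pos_iff.2 (Complex.Gamma_ne_zero_of_re_pos (by simpa using hv))
  have hIntg := (Complex.betaIntegral_convergent (u := ((1/8:ℝ):ℂ)) (v := v) (by simp) (by simpa using hv)).norm
  set B := ∫ x : ℝ in (0:ℝ)..1, ‖(x:ℂ) ^ (((1/8:ℝ):ℂ) - 1) * (1 - (x:ℂ)) ^ ((v:ℂ) - 1)‖ with hB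
  have hB0 : 0 ≤ B := intervalIntegral.integral_nonneg zero_le_one (fun x _ => norm_nonneg _)
  refine ⟨B / ‖Complex.Gamma v‖, by positivity, fun u hu => ?_⟩
  have h := Complex.Gamma_mul_Gamma_eq_betaIntegral (s := u) (t := v) (by linarith) (by simpa using hv)
  have hb : ‖Complex.betaIntegral u v‖ ≤ B := by
    unfold Complex.betaIntegral
    apply intervalIntegral.norm_integral_le_of_norm_le zero_le_one _ hIntg
    filter_upwards with x hx
    rw [norm_mul, norm_mul]
    gcongr 1
    rw [Complex.norm_cpow_eq_rpow_re_of_pos hx.1, Complex.norm_cpow_eq_rpow_re_of_pos hx.1]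
    apply Real.rpow_le_rpow_of_exponent_ge hx.1 hx.2
    simp; simpa using hu
  have h2 := congrArg norm h
  rw [norm_mul, norm_mul] at h2
  rw [div_mul_eq_mul_div, le_div_iff₀ hv', h2, mul_comm]
  gcongr

lemma sb_mono (RH : ∀ ρ : ℂ, riemannZeta ρ = 0 → 0 ≤ ρ.re → ρ.re ≤ 1 → ρ.re = 1 / 2) (d : ℝ) (hd : 0 < d) (hd1 : d ≤ 1/2)
    (s : ℂ) (hs : (1 - d)/2 ≤ s.re) : ‖sbX s‖ ≤ ‖sbX (s + d)‖ := by
  have hne : ∀ s : ℂ, 1/2 < s.re → sbX s ≠ 0 := by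
    intro s hs
    rw [sbX]
    refine mul_ne_zero (mul_ne_zero ?_ (mul_ne_zero ?_ ?_)) (sb_ne RH s hs)
    · rintro rfl; norm_num at hs
    · rw [Complex.cpow_def_of_ne_zero (by exact_mod_cast Real.pi_pos.ne')]; exact Complex.exp_ne_zero _
    · apply Complex.Gamma_ne_zero_of_re_pos; simp; linarith
  obtain ⟨e0, he0⟩ : ∃ e0 : ℝ, e0 = (1-d)/2 := ⟨_, rfl⟩
  obtain ⟨Kb, hKb0, hKb⟩ := sb_beta (d/2) (by linarith)
  obtain ⟨C, hC0, hC⟩ := sb_L3 RH ((1+d)/2) (by linarith) (by linarith)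
  obtain ⟨K, hK1, hK⟩ := sb_ge2
  set f : ℂ → ℂ := fun w => sbX (w + (e0 : ℝ)) / sbX (w + (e0 : ℝ) + d) with hf
  -- the ratio bound
  set A := π ^ (d/2) * Kb with hA
  have hA0 : 0 ≤ A := by positivity
  have hratio : ∀ s : ℂ, 1/4 ≤ s.re → 1/2 < s.re + d → ‖sbX s / sbX (s + d)‖ ≤ A * (‖riemannZeta₁ s‖ * ‖riemannZeta₁ (s + d)‖⁻¹) := by
    intro s hs hs2
    have hp : 0 < ‖sbX (s + d)‖ := norm_pos_iff.2 (hne _ (by simpa using hs2))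
    have hz : 0 < ‖riemannZeta₁ (s + d)‖ := norm_pos_iff.2 (sb_ne RH _ (by simpa using hs2))
    rw [norm_div, div_le_iff₀ hp, sbX_norm, sbX_norm]
    have h1 : ‖s‖ ≤ ‖s + d‖ := by
      rw [Complex.norm_eq_sqrt_sq_add_sq, Complex.norm_eq_sqrt_sq_add_sq]
      apply Real.sqrt_le_sqrt
      simp
      nlinarith
    have h2 := hKb (s/2) (by simp; linarith)
    rw [show s/2 + ((d/2 : ℝ) : ℂ) = (s + d)/2 by push_cast; ring] at h2
    have h3 : π ^ (-s.re/2) = π ^ (d/2) * π ^ (-(s+d).re/2) := by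
      rw [← Real.rpow_add Real.pi_pos]; congr 1; simp; ring
    rw [h3]
    have e : A * (‖riemannZeta₁ s‖ * ‖riemannZeta₁ (s + d)‖⁻¹) * (‖s + d‖ * (π ^ (-(s+d).re/2) * ‖Complex.Gamma ((s+d)/2)‖) * ‖riemannZeta₁ (s + d)‖)
       = ‖s + d‖ * (π ^ (d/2) * π ^ (-(s+d).re/2) * (Kb * ‖Complex.Gamma ((s+d)/2)‖)) * ‖riemannZeta₁ s‖ := by
      rw [hA]; field_simp
    rw [e]
    gcongr
  have key : ∀ w : ℂ, 0 ≤ w.re → ‖f w‖ ≤ 1 := by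
    intro w hw
    apply PhragmenLindelof.right_half_plane_of_bounded_on_real (f := f) _ _ _ _ hw
    · apply DifferentiableOn.diffContOnCl
      rw [Complex.closure_setOfPred_lt_re]
      intro z hz
      have hz' : 0 ≤ z.re := hz
      apply DifferentiableAt.differentiableWithinAt
      apply DifferentiableAt.div
      · exact DifferentiableAt.comp (g := sbX) (f := fun w : ℂ => w + (e0:ℂ)) z (sbX_diff _ (by simp; linarith)) (by fun_prop)
      · exact DifferentiableAt.comp (g := sbX) (f := fun w : ℂ => w + (e0:ℂ) + (d:ℂ)) z (sbX_diff _ (by simp; linarith)) (by fun_prop)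
      · apply hne; simp; linarith
    · refine ⟨1, by norm_num, C + 2, ?_⟩
      apply Asymptotics.IsBigO.of_bound (A * (9 * Real.exp 4 * Real.exp (3 * C)))
      have : {z : ℂ | 0 < z.re} ∈ Bornology.cobounded ℂ ⊓ Filter.principal {z : ℂ | 0 < z.re} := mem_inf_of_right (mem_principal_self _)
      filter_upwards [this] with z hz
      have hz' : 0 < z.re := hz
      refine (hratio _ (by simp; linarith) (by simp; linarith)).trans ?_
      rw [Real.rpow_one, Real.norm_eq_abs, abs_of_pos (Real.exp_pos _), mul_assoc A]
      apply mul_le_mul_of_nonneg_left _ hA0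
      set s1 : ℂ := z + (e0 : ℝ) with hs1
      have n1 : ‖s1‖ ≤ ‖z‖ + 1 := by
        refine (norm_add_le _ _).trans ?_
        rw [Complex.norm_real, Real.norm_eq_abs, abs_of_pos (by linarith)]; linarith
      have n2 : ‖s1 + d‖ ≤ ‖z‖ + 2 := by
        refine (norm_add_le _ _).trans ?_
        rw [Complex.norm_real, Real.norm_eq_abs, abs_of_pos (by linarith)]; linarith
      have g1 := sb_growth s1 (by simp [hs1]; linarith)
      have g2 := (hC (s1 + d) (by simp [hs1]; linarith)).1
      have e1 : (1 + ‖s1‖) ≤ Real.exp (‖z‖ + 2) := by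
        have := Real.add_one_le_exp (‖z‖ + 2); linarith
      have e2 : Real.log (2 + ‖s1 + d‖) ≤ ‖z‖ + 3 := by
        have := Real.log_le_sub_one_of_pos (x := 2 + ‖s1 + d‖) (by positivity)
        linarith
      calc _ ≤ (9 * (1 + ‖s1‖)^2) * Real.exp (C * Real.log (2 + ‖s1 + d‖)) := by gcongr
        _ ≤ (9 * (Real.exp (‖z‖ + 2))^2) * Real.exp (C * (‖z‖ + 3)) := by gcongr
        _ = 9 * Real.exp 4 * Real.exp (3 * C) * Real.exp ((C + 2) * ‖z‖) := by
          rw [← Real.exp_nat_mul, mul_assoc, mul_assoc, mul_assoc, ← Real.exp_add, ← Real.exp_add, ← Real.exp_add]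
          congr 2
          push_cast; ring
    · refine ⟨A * K^2, ?_⟩
      rw [eventually_map]
      filter_upwards [eventually_ge_atTop 2] with x hx
      refine (hratio _ (by simp; linarith) (by simp; linarith)).trans ?_
      apply mul_le_mul_of_nonneg_left _ hA0
      set s1 : ℂ := x + (e0 : ℝ) with hs1
      have hs1re : s1.re = x + e0 := by simp [hs1]
      have hre2 : (s1 + d).re = x + e0 + d := by simp [hs1re]
      have a1 := (hK s1 (by rw [hs1re]; linarith)).1
      have a2 := (hK (s1 + d) (by rw [hre2]; linarith)).2.1
      have ne1 : s1 ≠ 1 := by intro h; rw [h] at hs1re; simp at hs1re; linarith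
      have ne2 : s1 + d ≠ 1 := by intro h; rw [h] at hre2; simp at hre2; linarith
      have e : ∀ s : ℂ, s ≠ 1 → riemannZeta₁ s = (s - 1) * riemannZeta s := by
        intro s h
        rw [riemannZeta_eq_inv_sub_mul h]
        have h3 : s - 1 ≠ 0 := sub_ne_zero.2 h
        field_simp
      rw [e _ ne1, e _ ne2, norm_mul, norm_mul, mul_inv]
      have hle : ‖s1 - 1‖ ≤ ‖s1 + d - 1‖ := by
        rw [Complex.norm_eq_sqrt_sq_add_sq, Complex.norm_eq_sqrt_sq_add_sq]
        apply Real.sqrt_le_sqrt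
        simp [hs1re]
        nlinarith
      have hp : 0 < ‖s1 + d - 1‖ := norm_pos_iff.2 (sub_ne_zero.2 ne2)
      calc _ = (‖s1 - 1‖ * ‖s1 + d - 1‖⁻¹) * (‖riemannZeta s1‖ * ‖riemannZeta (s1 + d)‖⁻¹) := by ring
        _ ≤ 1 * (K * K) := by
          gcongr
          rw [← div_eq_mul_inv, div_le_one hp]; exact hle
        _ = K^2 := by ring
    · intro x
      have hx : 1 - (starRingEnd ℂ) ((x:ℂ) * Complex.I + (e0 : ℝ) + d) = (x:ℂ) * Complex.I + (e0 : ℝ) := by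
        apply Complex.ext
        · simp; linarith
        · simp
      have h1 := sbX_fe ((starRingEnd ℂ) ((x:ℂ) * Complex.I + (e0 : ℝ) + d)) (by simp; linarith) (by simp; linarith)
      rw [hx] at h1
      rw [hf]; simp only
      rw [h1, norm_div, sbX_conj]
      exact div_self_le_one _
  have := key (s - (e0 : ℝ)) (by simp; linarith)
  rw [hf] at this; simp only [sub_add_cancel] at this
  have hp : 0 < ‖sbX (s + d)‖ := norm_pos_iff.2 (hne _ (by simp; linarith))
  rw [norm_div, div_le_one hp] at this
  exact this

lemma sb_Zmono (RH : ∀ ρ : ℂ, riemannZeta ρ = 0 → 0 ≤ ρ.re → ρ.re ≤ 1 → ρ.re = 1 / 2) (s : ℂ) (hs : 1/2 < s.re) (h : ℝ) (h0 : 0 < h) (h1 : h ≤ 1/4) :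
    ‖riemannZeta₁ (s - h)‖ ≤ ‖riemannZeta₁ (s + h)‖ * Real.exp (h * (Real.log (1 + ‖s‖) + 27)) := by
  have hm := sb_mono RH (2*h) (by linarith) (by linarith) (s - h) (by simp; linarith)
  rw [show s - h + ((2*h : ℝ) : ℂ) = s + h by push_cast; ring, sbX_norm, sbX_norm] at hm
  have hsn : 1/2 ≤ ‖s‖ := by
    have := Complex.abs_re_le_norm s
    have := le_abs_self s.re
    linarith
  have hsn2 : 1/4 ≤ ‖s - h‖ := by
    have := Complex.abs_re_le_norm (s - h)
    have := le_abs_self (s - h).re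
    simp at this
    simp at *
    linarith
  have hg := sb_gamma_ratio ((s - h)/2) h (by simp; linarith) h0.le (by linarith)
  rw [show (s - h)/2 + (h:ℂ) = (s + h)/2 by ring] at hg
  have hu : ‖(s - h)/2‖ ≤ ‖s‖ := by
    rw [norm_div]
    have := norm_sub_le s (h:ℂ)
    rw [Complex.norm_real, Real.norm_eq_abs, abs_of_pos h0] at this
    simp; linarith
  have hlog : Real.log (1 + ‖(s - h)/2‖) ≤ Real.log (1 + ‖s‖) := Real.log_le_log (by positivity) (by linarith)
  have hs8 : ‖s + h‖ ≤ ‖s - h‖ * Real.exp (h * 8) := by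
    have a : ‖s + h‖ ≤ ‖s - h‖ + 2 * h := by
      have := norm_add_le (s - h) ((2 * h : ℝ) : ℂ)
      rw [show s - h + ((2*h : ℝ) : ℂ) = s + h by push_cast; ring, Complex.norm_real, Real.norm_eq_abs, abs_of_pos (by linarith)] at this
      exact this
    have := Real.add_one_le_exp (h * 8)
    nlinarith
  have hpi : π ^ (-(s+h).re/2) ≤ π ^ (-(s-h).re/2) := by
    apply Real.rpow_le_rpow_of_exponent_le (by linarith [Real.pi_gt_three])
    simp; linarith
  have hG : 0 < ‖Complex.Gamma ((s - h)/2)‖ := norm_pos_iff.2 (Complex.Gamma_ne_zero_of_re_pos (by simp; linarith))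
  set P := ‖s - h‖ * (π ^ (-(s-h).re/2) * ‖Complex.Gamma ((s - h)/2)‖) with hP
  have hP0 : 0 < P := by positivity
  have : P * ‖riemannZeta₁ (s - h)‖ ≤ P * (‖riemannZeta₁ (s + h)‖ * Real.exp (h * (Real.log (1 + ‖s‖) + 27))) := by
    calc _ ≤ _ := hm
      _ ≤ (‖s - h‖ * Real.exp (h * 8)) * (π ^ (-(s-h).re/2) * (‖Complex.Gamma ((s - h)/2)‖ * Real.exp (h * (Real.log (1 + ‖s‖) + 19)))) * ‖riemannZeta₁ (s + h)‖ := by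
        gcongr
        refine hg.trans ?_
        gcongr
      _ = P * (‖riemannZeta₁ (s + h)‖ * (Real.exp (h * 8) * Real.exp (h * (Real.log (1 + ‖s‖) + 19)))) := by
        rw [hP]; ring
      _ = _ := by
        rw [← Real.exp_add]; congr 3; ring
  exact le_of_mul_le_mul_left this hP0

lemma sb_pos (RH : ∀ ρ : ℂ, riemannZeta ρ = 0 → 0 ≤ ρ.re → ρ.re ≤ 1 → ρ.re = 1 / 2) (s : ℂ) (hs : 1/2 < s.re) :
    -(1/2) * Real.log (1 + ‖s‖) - 27/2 ≤ (deriv riemannZeta₁ s / riemannZeta₁ s).re := by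
  have hZ := sb_ne RH s hs
  have hg : HasDerivAt (fun x : ℝ => Real.log ‖riemannZeta₁ (s + x) / riemannZeta₁ s‖) (deriv riemannZeta₁ s / riemannZeta₁ s).re 0 := by
    have h1 : HasDerivAt (fun x : ℂ => Complex.log (riemannZeta₁ (s + x) / riemannZeta₁ s)) (deriv riemannZeta₁ s / riemannZeta₁ s) 0 := by
      have a : HasDerivAt (fun x : ℂ => riemannZeta₁ (s + x)) (deriv riemannZeta₁ s) 0 := by
        have := (differentiable_riemannZeta₁ (s + 0)).hasDerivAt.comp_const_add s 0
        simpa using this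
      have b := (a.div_const (riemannZeta₁ s)).clog (by simp [div_self hZ])
      refine b.congr_deriv ?_
      simp [div_self hZ]
    have h2 := HasDerivAt.real_of_complex (e := fun x : ℂ => Complex.log (riemannZeta₁ (s + x) / riemannZeta₁ s)) (z := 0) (by simpa using h1)
    simpa [Complex.log_re] using h2
  set A := Real.log (1 + ‖s‖) + 27 with hA
  set W := (deriv riemannZeta₁ s / riemannZeta₁ s).re with hW
  have hφ : HasDerivAt (fun x : ℝ => Real.log ‖riemannZeta₁ (s + x) / riemannZeta₁ s‖ - Real.log ‖riemannZeta₁ (s - x) / riemannZeta₁ s‖ + x * A) (2 * W + A) 0 := by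
    have h2 : HasDerivAt (fun x : ℝ => Real.log ‖riemannZeta₁ (s - x) / riemannZeta₁ s‖) (-W) 0 := by
      have := HasDerivAt.comp (0:ℝ) (h₂ := fun x : ℝ => Real.log ‖riemannZeta₁ (s + x) / riemannZeta₁ s‖) (h := fun x => -x) (by simpa using hg) (hasDerivAt_neg 0)
      refine (this.congr_deriv (by simp)).congr_of_eventuallyEq ?_
      filter_upwards with x
      simp [sub_eq_add_neg]
    refine ((hg.sub h2).add ((hasDerivAt_id (0:ℝ)).mul_const A)).congr_deriv ?_
    ring
  rw [hasDerivAt_iff_tendsto_slope] at hφ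
  have hφ' := hφ.mono_left (nhdsWithin_mono 0 (show Set.Ioi (0:ℝ) ⊆ {0}ᶜ from fun x hx => by simpa using (ne_of_gt hx)))
  have : 0 ≤ 2 * W + A := by
    refine ge_of_tendsto hφ' ?_
    filter_upwards [Ioo_mem_nhdsGT (show (0:ℝ) < 1/4 by norm_num), Ioo_mem_nhdsGT (show (0:ℝ) < s.re - 1/2 by linarith)] with h hh hh2
    have hm := sb_Zmono RH s hs h hh.1 hh.2.le
    have hz0 : 0 < ‖riemannZeta₁ s‖ := norm_pos_iff.2 hZ
    have hz1 : 0 < ‖riemannZeta₁ (s + h)‖ := norm_pos_iff.2 (sb_ne RH _ (by simp; linarith [hh.1]))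
    simp only [slope, vsub_eq_sub, sub_zero, smul_eq_mul]
    simp only [ofReal_zero, add_zero, sub_zero, div_self hZ, norm_one, Real.log_one, zero_mul, sub_self]
    apply mul_nonneg (inv_nonneg.2 hh.1.le)
    rw [norm_div, norm_div, Real.log_div hz1.ne' hz0.ne']
    have hzz : 0 < ‖riemannZeta₁ (s - h)‖ := norm_pos_iff.2 (sb_ne RH _ (by simp; linarith [hh2.2]))
    rw [Real.log_div hzz.ne' hz0.ne']
    have := Real.log_le_log hzz hm
    rw [Real.log_mul hz1.ne' (Real.exp_pos _).ne', Real.log_exp] at this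
    linarith
  rw [hA] at this
  linarith


noncomputable def sbSc (z : ℂ) : ℂ := dslope (fun z : ℂ => Complex.sin (π * z) / π) 0 z

lemma sbSc_diff : Differentiable ℂ sbSc := by
  have h : DifferentiableOn ℂ (dslope (fun z : ℂ => Complex.sin (π * z) / π) 0) Set.univ := by
    rw [Complex.differentiableOn_dslope (by simp)]
    apply Differentiable.differentiableOn
    fun_prop
  exact differentiableOn_univ.1 h

lemma sbSc_mul (z : ℂ) : z * sbSc z = Complex.sin (π * z) / π := by
  have := sub_smul_dslope (fun z : ℂ => Complex.sin (π * z) / π) 0 z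
  simpa [sbSc] using this

lemma sbSc_ofReal (x : ℝ) : sbSc x = ((Real.sinc (π * x) : ℝ) : ℂ) := by
  by_cases hx : x = 0
  · subst hx
    simp only [sbSc, ofReal_zero, dslope_same, mul_zero, Real.sinc_zero, ofReal_one]
    have : HasDerivAt (fun z : ℂ => Complex.sin (π * z) / π) 1 0 := by
      have h := (((hasDerivAt_id (0:ℂ)).const_mul (π:ℂ)).csin).div_const (π:ℂ)
      refine h.congr_deriv ?_
      simp
    exact this.deriv
  · have h := sbSc_mul x
    have hx' : (x:ℂ) ≠ 0 := by exact_mod_cast hx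
    have hpi : (π:ℂ) ≠ 0 := by exact_mod_cast Real.pi_pos.ne'
    rw [Real.sinc_of_ne_zero (mul_ne_zero Real.pi_pos.ne' hx)]
    push_cast
    apply mul_left_cancel₀ hx'
    rw [h]
    field_simp

lemma sb_norm_sin (w : ℂ) : ‖Complex.sin w‖ ≤ Real.exp |w.im| := by
  rw [Complex.sin, norm_div, norm_mul]
  have h1 : ‖Complex.exp (-w * I)‖ ≤ Real.exp |w.im| := by
    rw [Complex.norm_exp]; apply Real.exp_le_exp.2; simp; exact le_abs_self _
  have h2 : ‖Complex.exp (w * I)‖ ≤ Real.exp |w.im| := by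
    rw [Complex.norm_exp]; apply Real.exp_le_exp.2; simp; exact neg_le_abs _
  have h3 := norm_sub_le (Complex.exp (-w * I)) (Complex.exp (w * I))
  rw [Complex.norm_I, mul_one, Complex.norm_ofNat]
  linarith

lemma sbSc_bound : ∃ C : ℝ, 0 ≤ C ∧ ∀ z : ℂ, ‖sbSc z‖ ≤ C * Real.exp (π * |z.im|) / (1 + ‖z‖) := by
  obtain ⟨C, hC⟩ := (isCompact_closedBall (0:ℂ) 1).exists_bound_of_continuousOn sbSc_diff.continuous.continuousOn
  have hC0 : 0 ≤ C := (norm_nonneg _).trans (hC 0 (by simp))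
  refine ⟨2 * C + 1, by linarith, fun z => ?_⟩
  rw [le_div_iff₀ (by positivity)]
  have he : 1 ≤ Real.exp (π * |z.im|) := Real.one_le_exp (by positivity)
  by_cases hz : ‖z‖ ≤ 1
  · have h1 := hC z (by simpa using hz)
    have : ‖sbSc z‖ * (1 + ‖z‖) ≤ C * 2 := by gcongr; linarith
    nlinarith
  · push Not at hz
    have h1 := congrArg norm (sbSc_mul z)
    rw [norm_mul, norm_div, Complex.norm_real, Real.norm_eq_abs, abs_of_pos Real.pi_pos] at h1
    have h2 := sb_norm_sin (π * z)
    rw [show ((π:ℂ) * z).im = π * z.im by simp, abs_mul, abs_of_pos Real.pi_pos] at h2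
    have h3 : ‖z‖ * ‖sbSc z‖ ≤ Real.exp (π * |z.im|) / 2 := by
      rw [h1, div_le_div_iff₀ Real.pi_pos (by norm_num)]
      nlinarith [Real.pi_gt_three]
    have := norm_nonneg (sbSc z)
    nlinarith

noncomputable def sbT (w : ℂ) : ℂ := ∑' n : ℕ, 1 / (w + n + 1)^2
noncomputable def sbR (w : ℂ) : ℂ := w - w^2 * sbT w

lemma sb_tele (y : ℝ) (hy : 0 < y) : HasSum (fun n : ℕ => 1 / ((y + n) * (y + n + 1))) (1 / y) := by
  have h0 : Tendsto (fun n : ℕ => (1 : ℝ) / (y + n)) atTop (nhds 0) := by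
    apply Tendsto.div_atTop tendsto_const_nhds
    exact tendsto_atTop_add_const_left _ _ tendsto_natCast_atTop_atTop
  rw [hasSum_iff_tendsto_nat_of_nonneg (fun n => by positivity)]
  have : ∀ N : ℕ, ∑ n ∈ Finset.range N, 1 / ((y + n) * (y + n + 1)) = 1 / y - 1 / (y + N) := by
    intro N
    induction N with
    | zero => simp
    | succ k ih =>
      rw [Finset.sum_range_succ, ih]
      push_cast
      field_simp
      ring
  simp_rw [this]
  simpa using tendsto_const_nhds.sub h0

lemma sb_Tsummable (y : ℝ) (hy : 0 < y) : Summable (fun n : ℕ => 1 / (y + n + 1)^2) := by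
  apply Summable.of_nonneg_of_le (fun n => by positivity) _ (sb_tele y hy).summable
  intro n
  apply one_div_le_one_div_of_le (by positivity)
  have : (0:ℝ) ≤ n := Nat.cast_nonneg n
  nlinarith

lemma sb_T_bounds (y : ℝ) (hy : 0 < y) : 1 / (y + 1) ≤ ∑' n : ℕ, 1 / (y + n + 1)^2 ∧ ∑' n : ℕ, 1 / (y + n + 1)^2 ≤ 1 / y := by
  constructor
  · rw [← (sb_tele (y+1) (by linarith)).tsum_eq]
    apply Summable.tsum_le_tsum _ (sb_tele (y+1) (by linarith)).summable (sb_Tsummable y hy)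
    intro n
    apply one_div_le_one_div_of_le (by positivity)
    have : (0:ℝ) ≤ n := Nat.cast_nonneg n
    nlinarith
  · rw [← (sb_tele y hy).tsum_eq]
    apply Summable.tsum_le_tsum _ (sb_Tsummable y hy) (sb_tele y hy).summable
    intro n
    apply one_div_le_one_div_of_le (by positivity)
    have : (0:ℝ) ≤ n := Nat.cast_nonneg n
    nlinarith

noncomputable def sbRr (y : ℝ) : ℝ := y - y^2 * ∑' n : ℕ, 1 / (y + n + 1)^2

lemma sbR_ofReal (y : ℝ) : sbR y = (sbRr y : ℝ) := by
  simp only [sbR, sbT, sbRr]; push_cast; rfl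

lemma sbRr_mem (y : ℝ) (hy : 0 ≤ y) : 0 ≤ sbRr y ∧ sbRr y ≤ 1 := by
  rcases hy.eq_or_lt with rfl | hy
  · simp [sbRr]
  · obtain ⟨h1, h2⟩ := sb_T_bounds y hy
    rw [sbRr]
    set T := ∑' n : ℕ, 1 / (y + n + 1)^2
    rw [div_le_iff₀ (by linarith)] at h1
    rw [le_div_iff₀ hy] at h2
    constructor
    · nlinarith
    · have : T * (y + 1) * y^2 ≥ y^2 := by nlinarith [sq_nonneg y]
      have h3 : 0 ≤ (1 + y^2*T - y) * (y + 1) := by nlinarith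
      by_contra h
      push Not at h
      nlinarith

lemma sb_norm_add (w : ℂ) (hw : 0 ≤ w.re) (n : ℝ) (hn : 0 ≤ n) : (‖w‖ + n) ≤ Real.sqrt 2 * ‖w + n‖ := by
  have h : ‖w + n‖^2 = (w.re + n)^2 + w.im^2 := by
    rw [← Complex.normSq_eq_norm_sq, Complex.normSq_apply]; simp; ring
  have h2 : ‖w‖^2 = w.re^2 + w.im^2 := by
    rw [← Complex.normSq_eq_norm_sq, Complex.normSq_apply]; ring
  apply le_of_sq_le_sq _ (by positivity)
  rw [mul_pow, Real.sq_sqrt (by norm_num), h]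
  nlinarith [sq_nonneg (‖w‖ - n), mul_nonneg hw hn]
  
lemma sbT_diff (w : ℂ) (hw : -(1/2) < w.re) : DifferentiableAt ℂ sbT w := by
  have hopen : IsOpen {w : ℂ | -(1/2) < w.re} := isOpen_lt continuous_const Complex.continuous_re
  have : DifferentiableOn ℂ sbT {w : ℂ | -(1/2) < w.re} := by
    apply differentiableOn_tsum_of_summable_norm (u := fun n : ℕ => 1 / ((1/2:ℝ) + n)^2) _ _ hopen
    · intro n z hz
      have hz' : -(1/2) < z.re := hz
      have hre : (1/2:ℝ) + n ≤ ‖z + n + 1‖ := by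
        have := Complex.re_le_norm (z + n + 1)
        simp at this; simp; linarith
      rw [norm_div, norm_one, norm_pow]
      gcongr
    · rw [← summable_nat_add_iff 1]
      refine (sb_Tsummable (1/2) (by norm_num)).congr fun n => ?_
      push_cast; ring_nf
    · intro n z hz
      have hz' : -(1/2) < z.re := hz
      have hne : z + n + 1 ≠ 0 := by
        intro h
        have := congrArg Complex.re h
        simp at this
        have h0 : (0:ℝ) ≤ n := Nat.cast_nonneg n
        linarith
      apply DifferentiableAt.differentiableWithinAt
      apply DifferentiableAt.div (by fun_prop) (by fun_prop)
      exact pow_ne_zero _ hne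
  exact (this w hw).differentiableAt (hopen.mem_nhds hw)

lemma sbR_bound (w : ℂ) (hw : 0 ≤ w.re) : ‖sbR w‖ ≤ 3 := by
  by_cases h0 : w = 0
  · simp [sbR, h0]
  have hr : 0 < ‖w‖ := norm_pos_iff.2 h0
  have hne : ∀ n : ℕ, w + n ≠ 0 := by
    intro n h
    have := sb_norm_add w hw n (Nat.cast_nonneg n)
    rw [show w + ((n:ℝ):ℂ) = 0 by exact_mod_cast h, norm_zero, mul_zero] at this
    have : (0:ℝ) ≤ n := Nat.cast_nonneg n
    linarith
  have hne1 : ∀ n : ℕ, w + n + 1 ≠ 0 := by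
    intro n h
    apply hne (n+1); push_cast; linear_combination h
  have hb : ∀ n : ℕ, ‖w + n‖⁻¹ ≤ Real.sqrt 2 * (‖w‖ + n)⁻¹ := by
    intro n
    have := sb_norm_add w hw n (Nat.cast_nonneg n)
    have hp : 0 < ‖w + n‖ := norm_pos_iff.2 (hne n)
    rw [← div_eq_mul_inv, inv_le_comm₀ hp (by positivity), inv_div, div_le_iff₀ (by positivity), mul_comm]
    simpa using this
  have hb1 : ∀ n : ℕ, ‖w + n + 1‖⁻¹ ≤ Real.sqrt 2 * (‖w‖ + n + 1)⁻¹ := by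
    intro n
    have := hb (n+1)
    push_cast at this
    simpa [add_assoc] using this
  -- the telescoped series
  have hreal : HasSum (fun n : ℕ => 1 / ((‖w‖ + n) * (‖w‖ + n + 1)) - 1 / (‖w‖ + n + 1)^2) (1 / ‖w‖ - ∑' n : ℕ, 1 / (‖w‖ + n + 1)^2) :=
    (sb_tele _ hr).sub (sb_Tsummable _ hr).hasSum
  have hterm : ∀ n : ℕ, ‖1 / ((w + n) * (w + n + 1)) - 1 / (w + n + 1)^2‖ ≤ 2 * Real.sqrt 2 * (1 / ((‖w‖ + n) * (‖w‖ + n + 1)) - 1 / (‖w‖ + n + 1)^2) := by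
    intro n
    have e1 : 1 / ((w + n) * (w + n + 1)) - 1 / (w + n + 1)^2 = (w+n)⁻¹ * ((w + n + 1)⁻¹)^2 := by
      have := hne n; have := hne1 n
      field_simp
      ring
    have e2 : 1 / ((‖w‖ + n) * (‖w‖ + n + 1)) - 1 / (‖w‖ + n + 1)^2 = (‖w‖+n)⁻¹ * ((‖w‖ + n + 1)⁻¹)^2 := by
      field_simp
      ring
    rw [e1, e2, norm_mul, norm_pow, norm_inv, norm_inv]
    calc _ ≤ (Real.sqrt 2 * (‖w‖ + n)⁻¹) * (Real.sqrt 2 * (‖w‖ + n + 1)⁻¹)^2 := by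
          gcongr
          · exact hb n
          · exact hb1 n
      _ = (Real.sqrt 2)^2 * Real.sqrt 2 * ((‖w‖+n)⁻¹ * ((‖w‖ + n + 1)⁻¹)^2) := by ring
      _ = _ := by rw [Real.sq_sqrt (by norm_num)]
  have hsT : Summable (fun n : ℕ => 1 / (w + n + 1)^2) := by
    apply Summable.of_norm_bounded (g := fun n : ℕ => 2 * (1 / (‖w‖ + n + 1)^2)) ((sb_Tsummable _ hr).mul_left 2)
    intro n
    rw [norm_div, norm_one, norm_pow, one_div, ← inv_pow]
    calc _ ≤ (Real.sqrt 2 * (‖w‖ + n + 1)⁻¹)^2 := by gcongr; exact hb1 n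
      _ = _ := by rw [mul_pow, Real.sq_sqrt (by norm_num)]; simp
  have hdiff : Summable (fun n : ℕ => 1 / ((w + n) * (w + n + 1)) - 1 / (w + n + 1)^2) :=
    Summable.of_norm_bounded (hreal.summable.mul_left _) hterm
  have htele : ∑' n : ℕ, 1 / ((w + n) * (w + n + 1)) = 1 / w := by
    have hs : Summable (fun n : ℕ => 1 / ((w + n) * (w + n + 1))) := by
      refine (hdiff.add hsT).congr fun n => by ring
    have h1 := hs.hasSum.tendsto_sum_nat
    have : ∀ N : ℕ, ∑ n ∈ Finset.range N, 1 / ((w + n) * (w + n + 1)) = 1 / w - (w + N)⁻¹ := by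
      intro N
      induction N with
      | zero => simp
      | succ k ih =>
        rw [Finset.sum_range_succ, ih]
        have := hne k; have := hne1 k
        have h3 : w + ((k+1 : ℕ) : ℂ) = w + k + 1 := by push_cast; ring
        rw [h3]
        field_simp
        ring
    simp_rw [this] at h1
    have h0' : Tendsto (fun n : ℕ => (w + n)⁻¹) atTop (nhds 0) := by
      apply squeeze_zero_norm (a := fun n : ℕ => Real.sqrt 2 * (‖w‖ + n)⁻¹)
      · intro n; rw [norm_inv]; exact hb n
      · have : Tendsto (fun n : ℕ => (‖w‖ + n)⁻¹) atTop (nhds 0) :=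
          tendsto_inv_atTop_zero.comp (tendsto_atTop_add_const_left _ _ tendsto_natCast_atTop_atTop)
        simpa using this.const_mul (Real.sqrt 2)
    have h2 : Tendsto (fun N : ℕ => 1 / w - (w + N)⁻¹) atTop (nhds (1 / w - 0)) := tendsto_const_nhds.sub h0'
    rw [sub_zero] at h2
    exact tendsto_nhds_unique h1 h2
  have hval : 1 / w - sbT w = ∑' n : ℕ, (1 / ((w + n) * (w + n + 1)) - 1 / (w + n + 1)^2) := by
    have hs : Summable (fun n : ℕ => 1 / ((w + n) * (w + n + 1))) := by
      refine (hdiff.add hsT).congr fun n => by ring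
    rw [hs.tsum_sub hsT, htele, sbT]
  have hnorm : ‖1 / w - sbT w‖ ≤ 2 * Real.sqrt 2 * (1 / ‖w‖ - ∑' n : ℕ, 1 / (‖w‖ + n + 1)^2) := by
    rw [hval]
    exact tsum_of_norm_bounded (hreal.mul_left _) hterm
  have e : sbR w = w^2 * (1 / w - sbT w) := by rw [sbR]; field_simp
  have e' : ‖w‖^2 * (1 / ‖w‖ - ∑' n : ℕ, 1 / (‖w‖ + n + 1)^2) = sbRr ‖w‖ := by
    rw [sbRr, mul_sub]; congr 1; field_simp
  rw [e, norm_mul, norm_pow]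
  have hs2 : Real.sqrt 2 ≤ 1.5 := by
    rw [Real.sqrt_le_left (by norm_num)]; norm_num
  calc _ ≤ ‖w‖^2 * (2 * Real.sqrt 2 * (1 / ‖w‖ - ∑' n : ℕ, 1 / (‖w‖ + n + 1)^2)) := by gcongr
    _ = 2 * Real.sqrt 2 * sbRr ‖w‖ := by rw [← e']; ring
    _ ≤ 2 * 1.5 * 1 := by
      gcongr
      · exact (sbRr_mem _ hr.le).1
      · exact (sbRr_mem _ hr.le).2
    _ = 3 := by norm_num


lemma sb_jump (v : ℝ) (hv : 0 < v) : sbSc (v * I)^2 * (1 - sbR (v * I) - sbR (-(v * I))) = 1 := by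
  set z : UpperHalfPlane := ⟨v * I, by simpa using hv⟩ with hz
  have hzc : (z : ℂ) = v * I := rfl
  have hz0 : (v * I : ℂ) ≠ 0 := by simp [hv.ne']
  have hq := EisensteinSeries.qExpansion_identity (k := 1) le_rfl z
  rw [hzc] at hq
  set q := Complex.exp (2 * π * I * (v * I)) with hqd
  have hqn : ‖q‖ < 1 := by
    rw [hqd, Complex.norm_exp]
    rw [Real.exp_lt_one_iff]
    have : (2 * π * I * (v * I) : ℂ) = ((-(2 * π * v) : ℝ) : ℂ) := by
      push_cast; linear_combination (2 * π * v : ℂ) * I_mul_I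
    rw [this, ofReal_re]
    have := Real.pi_pos
    nlinarith [mul_pos Real.pi_pos hv]
  have hg := tsum_coe_mul_geometric_of_norm_lt_one hqn
  simp only [pow_one, Nat.factorial_one, Nat.cast_one, div_one] at hq
  rw [hg] at hq
  have hsum : ∑' n : ℤ, 1 / ((v * I : ℂ) + n)^(1+1) = 1 / (v*I)^2 + sbT (v * I) + sbT (-(v * I)) := by
    have hS : ∀ w : ℂ, w.re = 0 → Summable (fun n : ℕ => 1 / (w + n + 1)^2) := by
      intro w hw
      have hr : Summable (fun n : ℕ => 1 / ((n:ℝ) + 1)^2) := by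
        have := (summable_nat_add_iff 1).2 (Real.summable_one_div_nat_pow.2 (show 1 < 2 by norm_num))
        refine this.congr fun n => by push_cast; rfl
      apply Summable.of_norm_bounded hr
      intro n
      rw [norm_div, norm_one, norm_pow]
      have hre : (n:ℝ) + 1 ≤ ‖w + n + 1‖ := by
        have := Complex.re_le_norm (w + n + 1)
        simp only [add_re, natCast_re, one_re, hw] at this; linarith
      gcongr
    rw [tsum_of_nat_of_neg_add_one (f := fun n : ℤ => 1 / ((v * I : ℂ) + n)^(1+1))]
    · rw [Summable.tsum_eq_zero_add]
      · simp only [sbT]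
        push_cast
        rw [add_zero]
        congr 1
        · congr 1
          apply tsum_congr; intro n; rw [add_assoc]
        · apply tsum_congr; intro n; rw [show ((v * I : ℂ) + -(n + 1))^2 = (-(v*I) + n + 1)^2 by ring]
      · rw [← summable_nat_add_iff 1]
        refine (hS (v * I) (by simp)).congr fun n => by push_cast; rw [add_assoc]
    · rw [← summable_nat_add_iff 1]
      refine (hS (v * I) (by simp)).congr fun n => by push_cast; rw [add_assoc]
    · refine (hS (-(v * I)) (by simp)).congr fun n => ?_
      push_cast; rw [show ((v * I : ℂ) + -(n + 1))^2 = (-(v*I) + n + 1)^2 by ring]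
  rw [hsum] at hq
  have hm := sbSc_mul (v * I)
  have hpi : (π:ℂ) ≠ 0 := by exact_mod_cast Real.pi_pos.ne'
  have hq1 : 1 - q ≠ 0 := by
    intro h
    have : q = 1 := by linear_combination -h
    rw [this] at hqn; simp at hqn
  have e1 : 1 - sbR (v * I) - sbR (-(v * I)) = (v*I)^2 * (1 / (v*I)^2 + sbT (v * I) + sbT (-(v * I))) := by
    rw [mul_add, mul_add, mul_one_div_cancel (pow_ne_zero 2 hz0), sbR, sbR]; ring
  have hs : (Complex.sin (π * (v * I)))^2 * (4 * q) = -(1-q)^2 := by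
    rw [Complex.sin]
    have a : Complex.exp (π * (v * I) * I) * Complex.exp (-(π * (v * I)) * I) = 1 := by
      rw [← Complex.exp_add]; simp
    have b : q = Complex.exp (π * (v * I) * I) * Complex.exp (π * (v * I) * I) := by
      rw [← Complex.exp_add, hqd]; congr 1; ring
    set x := Complex.exp (π * (v * I) * I)
    set y := Complex.exp (-(π * (v * I)) * I)
    rw [b, div_pow, mul_pow, I_sq]
    linear_combination (- x*y - 1 + 2 * x^2) * a
  rw [e1, hq, show sbSc (v * I)^2 * ((v*I)^2 * ((-2 * π * I)^(1+1) * (q / (1-q)^2))) = (v * I * sbSc (v * I))^2 * ((-2 * π * I)^2 * (q / (1-q)^2)) by ring, hm, mul_pow, I_sq]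
  generalize Complex.sin (π * (v * I)) = s at hs
  field_simp
  linear_combination -hs

/-- the Beurling-type kernel -/
noncomputable def sbG (w : ℂ) : ℂ := sbSc w ^ 2 * sbR w
noncomputable def sbPhi (w : ℂ) : ℂ := sbSc w ^ 2
noncomputable def sbphi (x : ℝ) : ℝ := Real.sinc (π * x) ^ 2

lemma sbPhi_diff (w : ℂ) : DifferentiableAt ℂ sbPhi w := (sbSc_diff w).pow 2

lemma sbG_diff (w : ℂ) (hw : -(1/2) < w.re) : DifferentiableAt ℂ sbG w := by
  have h1 := sbT_diff w hw
  have h2 := sbSc_diff w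
  have h3 : DifferentiableAt ℂ sbR w := by unfold sbR; fun_prop
  unfold sbG
  fun_prop

lemma sbPhi_ofReal (x : ℝ) : sbPhi x = (sbphi x : ℝ) := by
  rw [sbPhi, sbphi, sbSc_ofReal]; push_cast; rfl

lemma sbG_ofReal (x : ℝ) : sbG x = ((sbphi x * sbRr x : ℝ) : ℂ) := by
  rw [sbG, sbphi, sbSc_ofReal, sbR_ofReal]; push_cast; rfl

lemma sbphi_nonneg (x : ℝ) : 0 ≤ sbphi x := sq_nonneg _

lemma sb_jump' (v : ℝ) (hv : 0 < v) : sbPhi (v * I) - sbG (v * I) - sbG (-(v * I)) = 1 := by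
  have h := sb_jump v hv
  have he : sbSc (-(v * I)) = sbSc (v * I) := by
    have hz0 : (v * I : ℂ) ≠ 0 := by simp [hv.ne']
    have h1 := sbSc_mul (v * I)
    have h2 := sbSc_mul (-(v * I))
    rw [mul_neg, Complex.sin_neg] at h2
    apply mul_left_cancel₀ hz0
    rw [h1]
    linear_combination -h2
  rw [sbPhi, sbG, sbG, he, ← h]
  ring

lemma sb_kernel_bound : ∃ C : ℝ, 0 ≤ C ∧ ∀ w : ℂ, 0 ≤ w.re →
    ‖sbG w‖ ≤ C * Real.exp (2 * π * |w.im|) / (1 + ‖w‖)^2 ∧ ‖sbPhi w‖ ≤ C * Real.exp (2 * π * |w.im|) / (1 + ‖w‖)^2 := by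
  obtain ⟨C, hC0, hC⟩ := sbSc_bound
  have hb : ∀ w : ℂ, ‖sbPhi w‖ ≤ C^2 * Real.exp (2 * π * |w.im|) / (1 + ‖w‖)^2 := by
    intro w
    rw [sbPhi, norm_pow]
    calc _ ≤ (C * Real.exp (π * |w.im|) / (1 + ‖w‖))^2 := by gcongr; exact hC w
      _ = _ := by
        rw [div_pow, mul_pow, ← Real.exp_nat_mul]; congr 3; push_cast; ring_nf
  refine ⟨3 * C^2, by positivity, fun w hw => ⟨?_, ?_⟩⟩
  · have : sbG w = sbPhi w * sbR w := rfl
    rw [this, norm_mul]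
    calc _ ≤ (C^2 * Real.exp (2 * π * |w.im|) / (1 + ‖w‖)^2) * 3 := by
          gcongr
          · exact hb w
          · exact sbR_bound w hw
      _ = _ := by ring
  · refine (hb w).trans ?_
    gcongr
    nlinarith [sq_nonneg C]

lemma sbphi_cont : Continuous sbphi := by
  unfold sbphi
  exact (Real.continuous_sinc.comp (by fun_prop)).pow 2

lemma sbphi_le (x : ℝ) (hx : 0 ≤ x) : sbphi x ≤ 2 / (1 + x^2) := by
  rw [le_div_iff₀ (by positivity), sbphi]
  have h1 : Real.sinc (π * x)^2 ≤ 1 := by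
    rw [sq_le_one_iff_abs_le_one]; exact Real.abs_sinc_le_one _
  have h2 : Real.sinc (π * x)^2 * x^2 ≤ 1 := by
    rcases hx.eq_or_lt with rfl | hx
    · simp
    · rw [Real.sinc_of_ne_zero (by positivity), div_pow, mul_pow]
      have : Real.sin (π * x)^2 / (π^2 * x^2) * x^2 = Real.sin (π*x)^2 / π^2 := by field_simp
      rw [this, div_le_one (by positivity)]
      have := Real.sin_sq_le_one (π * x)
      nlinarith [Real.pi_gt_three]
  nlinarith

lemma sb_fejer (N : ℕ) (x : ℝ) : Real.sin x ^ 2 * ((∑ j ∈ Finset.range N, Real.cos (2 * j * x))^2 + (∑ j ∈ Finset.range N, Real.sin (2 * j * x))^2) = Real.sin (N * x)^2 := by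
  have hc : ∀ N : ℕ, Real.sin x * ∑ j ∈ Finset.range N, Real.cos (2 * j * x) = (Real.sin ((2 * N - 1) * x) + Real.sin x) / 2 := by
    intro N
    induction N with
    | zero => simp
    | succ k ih =>
      rw [Finset.sum_range_succ, mul_add, ih]
      push_cast
      rw [show (2 * ((k:ℝ) + 1) - 1) * x = 2 * k * x + x by ring, show (2 * (k:ℝ) - 1) * x = 2 * k * x - x by ring, Real.sin_add, Real.sin_sub]
      ring
  have hs : ∀ N : ℕ, Real.sin x * ∑ j ∈ Finset.range N, Real.sin (2 * j * x) = (Real.cos x - Real.cos ((2 * N - 1) * x)) / 2 := by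
    intro N
    induction N with
    | zero => simp
    | succ k ih =>
      rw [Finset.sum_range_succ, mul_add, ih]
      push_cast
      rw [show (2 * ((k:ℝ) + 1) - 1) * x = 2 * k * x + x by ring, show (2 * (k:ℝ) - 1) * x = 2 * k * x - x by ring, Real.cos_add, Real.cos_sub]
      ring
  rw [mul_add, ← mul_pow, ← mul_pow, hc, hs, show (2 * (N:ℝ) - 1) * x = 2 * (N * x) - x by ring, Real.sin_sub, Real.cos_sub, Real.sin_two_mul, Real.cos_two_mul]
  have h1 := Real.sin_sq_add_cos_sq x
  have h2 := Real.sin_sq_add_cos_sq (N * x)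
  set s := Real.sin x
  set c := Real.cos x
  set S := Real.sin (N * x)
  set D := Real.cos (N * x)
  have hs2 : s^2 = 1 - c^2 := by linarith
  have hS2 : S^2 = 1 - D^2 := by linarith
  ring_nf
  simp only [hs2, hS2]
  ring_nf

lemma sb_int_cos (m : ℤ) : ∫ y in (0:ℝ)..(1/2), Real.cos (2 * m * (π * y)) = if m = 0 then 1/2 else 0 := by
  split_ifs with h
  · simp [h]
  · have hc : (2 * m * π : ℝ) ≠ 0 := by
      have : (m:ℝ) ≠ 0 := by exact_mod_cast h
      positivity
    have := intervalIntegral.integral_comp_mul_left (a := 0) (b := 1/2) Real.cos hc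
    simp_rw [← mul_assoc]
    rw [this, integral_cos]
    rw [show 2 * (m:ℝ) * π * (1/2) = m * π by ring, Real.sin_int_mul_pi]
    simp

lemma sb_fejer_int (N : ℕ) : ∫ y in (0:ℝ)..(1/2), ((∑ j ∈ Finset.range N, Real.cos (2 * j * (π * y)))^2 + (∑ j ∈ Finset.range N, Real.sin (2 * j * (π * y)))^2) = N / 2 := by
  have h : ∀ y : ℝ, ((∑ j ∈ Finset.range N, Real.cos (2 * j * (π * y)))^2 + (∑ j ∈ Finset.range N, Real.sin (2 * j * (π * y)))^2) = ∑ j ∈ Finset.range N, ∑ k ∈ Finset.range N, Real.cos (2 * ((j - k : ℤ) : ℝ) * (π * y)) := by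
    intro y
    rw [sq, sq, Finset.sum_mul_sum, Finset.sum_mul_sum, ← Finset.sum_add_distrib]
    apply Finset.sum_congr rfl; intro j _
    rw [← Finset.sum_add_distrib]
    apply Finset.sum_congr rfl; intro k _
    push_cast
    rw [← Real.cos_sub]; congr 1; ring
  simp_rw [h]
  rw [intervalIntegral.integral_finsetSum]
  · have : ∀ j ∈ Finset.range N, ∫ y in (0:ℝ)..(1/2), ∑ k ∈ Finset.range N, Real.cos (2 * ((j - k : ℤ) : ℝ) * (π * y)) = 1/2 := by
      intro j hj
      rw [intervalIntegral.integral_finsetSum]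
      · simp_rw [sb_int_cos, sub_eq_zero, Nat.cast_inj]
        rw [Finset.sum_ite_eq, if_pos hj]
      · intro k _
        apply Continuous.intervalIntegrable; fun_prop
    rw [Finset.sum_congr rfl this]
    simp; ring
  · intro k _
    apply Continuous.intervalIntegrable; fun_prop

lemma sbphi_int : IntegrableOn sbphi (Set.Ioi 0) ∧ ∫ x in Set.Ioi (0:ℝ), sbphi x ≤ 1/2 := by
  have hIntg : IntegrableOn sbphi (Set.Ioi 0) := by
    have h1 : IntegrableOn (fun x : ℝ => 2 * (1 + x^2)⁻¹) (Set.Ioi 0) := (integrable_inv_one_add_sq.const_mul 2).integrableOn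
    refine Integrable.mono' h1 sbphi_cont.aestronglyMeasurable ?_
    rw [ae_restrict_iff' measurableSet_Ioi]
    filter_upwards with x hx
    rw [Real.norm_eq_abs, abs_of_nonneg (sbphi_nonneg x), ← div_eq_mul_inv]
    exact sbphi_le x (le_of_lt hx)
  refine ⟨hIntg, ?_⟩
  have hN : Tendsto (fun N : ℕ => ((N + 1 : ℕ) : ℝ) * (1/2)) atTop atTop := by
    apply Tendsto.atTop_mul_const (by norm_num)
    exact tendsto_natCast_atTop_atTop.comp (tendsto_add_atTop_nat 1)
  refine le_of_tendsto' (intervalIntegral_tendsto_integral_Ioi 0 hIntg hN) fun N => ?_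
  set M := N + 1
  have hM : (0:ℝ) < (M:ℝ) := by positivity
  have h1 := intervalIntegral.integral_comp_mul_left (a := 0) (b := 1/2) sbphi hM.ne'
  rw [mul_zero, smul_eq_mul, eq_inv_mul_iff_mul_eq₀ hM.ne'] at h1
  rw [← h1]
  have h2 : ∫ y in (0:ℝ)..(1/2), sbphi (M * y) ≤ ∫ y in (0:ℝ)..(1/2), ((M:ℝ)^2)⁻¹ * ((∑ j ∈ Finset.range M, Real.cos (2 * j * (π * y)))^2 + (∑ j ∈ Finset.range M, Real.sin (2 * j * (π * y)))^2) := by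
    apply intervalIntegral.integral_mono_on_of_le_Ioo (by norm_num)
    · apply Continuous.intervalIntegrable; exact sbphi_cont.comp (by fun_prop)
    · apply Continuous.intervalIntegrable; fun_prop
    · intro y hy
      have hy0 : 0 < y := hy.1
      have hf := sb_fejer M (π * y)
      set Q := ((∑ j ∈ Finset.range M, Real.cos (2 * j * (π * y)))^2 + (∑ j ∈ Finset.range M, Real.sin (2 * j * (π * y)))^2)
      have hQ : 0 ≤ Q := by positivity
      have hs : Real.sin (π * y)^2 ≤ (π * y)^2 := by
        rw [sq_le_sq]; exact Real.abs_sin_le_abs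
      rw [sbphi, Real.sinc_of_ne_zero (by positivity), show π * (M * y) = M * (π * y) by ring, div_pow, ← hf, div_le_iff₀ (by positivity)]
      calc _ ≤ (π * y)^2 * Q := by gcongr
        _ = _ := by field_simp
  rw [intervalIntegral.integral_const_mul, sb_fejer_int] at h2
  calc _ ≤ (M:ℝ) * (((M:ℝ)^2)⁻¹ * (M/2)) := by gcongr
    _ = 1/2 := by field_simp


lemma sb_contour (f : ℂ → ℂ) (η B : ℝ) (hf : ∀ z : ℂ, 0 ≤ z.re → z.im ∈ Set.uIcc 0 η → DifferentiableAt ℂ f z)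
    (hB : ∀ z : ℂ, 0 ≤ z.re → z.im ∈ Set.uIcc 0 η → ‖f z‖ ≤ B * (z.re + 1) ^ (-(3/2) : ℝ)) :
    IntegrableOn (fun x : ℝ => f x) (Set.Ioi 0) ∧ IntegrableOn (fun x : ℝ => f (x + η * I)) (Set.Ioi 0) ∧
    (∫ x in Set.Ioi (0:ℝ), f x) - (∫ x in Set.Ioi (0:ℝ), f (x + η * I)) = I * ∫ v in (0:ℝ)..η, f (v * I) := by
  have hI : IntegrableOn (fun x : ℝ => B * (x + 1) ^ (-(3/2) : ℝ)) (Set.Ioi 0) :=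
    (integrableOn_add_rpow_Ioi_of_lt (by norm_num) (by norm_num)).const_mul B
  have hIntg : ∀ y : ℝ, y ∈ Set.uIcc 0 η → IntegrableOn (fun x : ℝ => f (x + y * I)) (Set.Ioi 0) := by
    intro y hy
    refine Integrable.mono' hI ?_ ?_
    · apply ContinuousOn.aestronglyMeasurable _ measurableSet_Ioi
      intro x hx
      have hx' : 0 < x := hx
      apply ContinuousAt.continuousWithinAt
      apply ContinuousAt.comp (g := f) (f := fun x : ℝ => (x + y * I : ℂ)) _ (by fun_prop)
      exact (hf _ (by simpa using hx'.le) (by simpa using hy)).continuousAt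
    · rw [ae_restrict_iff' measurableSet_Ioi]
      filter_upwards with x hx
      have hx' : 0 < x := hx
      have := hB (x + y * I) (by simpa using hx'.le) (by simpa using hy)
      simpa using this
  have h0 := hIntg 0 Set.left_mem_uIcc
  have h1 := hIntg η Set.right_mem_uIcc
  simp only [ofReal_zero, zero_mul, add_zero] at h0
  refine ⟨h0, h1, ?_⟩
  have hrect : ∀ T : ℝ, 0 ≤ T → (∫ x in (0:ℝ)..T, f x) - (∫ x in (0:ℝ)..T, f (x + η * I)) + I * (∫ y in (0:ℝ)..η, f (T + y * I)) = I * ∫ v in (0:ℝ)..η, f (v * I) := by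
    intro T hT
    have := Complex.integral_boundary_rect_eq_zero_of_differentiableOn f 0 (T + η * I) ?_
    · simp only [zero_re, zero_im, add_re, ofReal_re, mul_re, I_re, mul_zero, ofReal_im, I_im, mul_one, sub_self, add_zero, add_im, mul_im, zero_add, ofReal_zero, zero_mul, smul_eq_mul] at this
      linear_combination this
    · intro z hz
      simp only [zero_re, zero_im, add_re, ofReal_re, mul_re, I_re, mul_zero, ofReal_im, I_im, mul_one, sub_self, add_zero, add_im, mul_im, zero_add] at hz
      rw [Complex.mem_reProdIm, Set.uIcc_of_le hT] at hz
      exact (hf z hz.1.1 hz.2).differentiableWithinAt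
  have t0 := intervalIntegral_tendsto_integral_Ioi 0 h0 tendsto_id
  have t1 := intervalIntegral_tendsto_integral_Ioi 0 h1 tendsto_id
  have t2 : Tendsto (fun T : ℝ => ∫ y in (0:ℝ)..η, f (T + y * I)) atTop (nhds 0) := by
    have h3 : Tendsto (fun T : ℝ => B * (T + 1) ^ (-(3/2) : ℝ) * |η - 0|) atTop (nhds 0) := by
      have : Tendsto (fun T : ℝ => (T + 1) ^ (-(3/2) : ℝ)) atTop (nhds 0) :=
        (tendsto_rpow_neg_atTop (by norm_num)).comp (tendsto_atTop_add_const_right _ _ tendsto_id)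
      simpa using (this.const_mul B).mul_const |η - 0|
    apply squeeze_zero_norm' _ h3
    filter_upwards [eventually_ge_atTop 0] with T hT
    apply intervalIntegral.norm_integral_le_of_norm_le_const
    intro y hy
    have := hB (T + y * I) (by simpa using hT) (by simpa using Set.uIoc_subset_uIcc hy)
    simpa using this
  have t3 := (t0.sub t1).add (t2.const_mul I)
  rw [mul_zero, add_zero] at t3
  refine tendsto_nhds_unique t3 ?_
  apply tendsto_const_nhds.congr'
  filter_upwards [eventually_ge_atTop 0] with T hT
  exact (hrect T hT).symm


noncomputable def sbW (s : ℂ) : ℂ := deriv riemannZeta₁ s / riemannZeta₁ s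

lemma sbW_diff (RH : ∀ ρ : ℂ, riemannZeta ρ = 0 → 0 ≤ ρ.re → ρ.re ≤ 1 → ρ.re = 1 / 2) (s : ℂ) (hs : 1/2 < s.re) : DifferentiableAt ℂ sbW s := by
  have h1 : DifferentiableAt ℂ (deriv riemannZeta₁) s := by
    exact (differentiable_riemannZeta₁.differentiableOn (s := Set.univ)).analyticAt (by simp) |>.deriv.differentiableAt
  exact h1.div (differentiable_riemannZeta₁ s) (sb_ne RH s hs)

lemma sbW_eq (s : ℂ) (h1 : s ≠ 1) (hz : riemannZeta₁ s ≠ 0) : deriv riemannZeta s / riemannZeta s = sbW s - (s - 1)⁻¹ := by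
  have h := sub_ne_zero.2 h1
  rw [deriv_riemannZeta_eq_neg_inv_sub_sq_mul_add h1, riemannZeta_eq_inv_sub_mul h1, sbW]
  field_simp
  ring

lemma sb_tail (RH : ∀ ρ : ℂ, riemannZeta ρ = 0 → 0 ≤ ρ.re → ρ.re ≤ 1 → ρ.re = 1 / 2) :
    ∃ K : ℝ, 0 ≤ K ∧ ∀ Δ : ℝ, 1 ≤ Δ → ∀ s : ℂ, 1 + 1/Δ ≤ s.re →
      ‖deriv riemannZeta s / riemannZeta s‖ ≤ K * Δ * Real.exp (-(Real.log 2) * (s.re - (1 + 1/Δ))) := by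
  have hcont : ContinuousOn (fun x : ℝ => sbW x) (Set.Icc 1 2) := by
    intro x hx
    apply ContinuousAt.continuousWithinAt
    apply ContinuousAt.comp (g := sbW) (f := fun x : ℝ => (x:ℂ)) _ (by fun_prop)
    exact (sbW_diff RH _ (by simp; linarith [hx.1])).continuousAt
  obtain ⟨K0, hK0⟩ := isCompact_Icc.exists_bound_of_continuousOn hcont
  have hK00 : 0 ≤ K0 := (norm_nonneg _).trans (hK0 1 (by simp))
  refine ⟨K0 + 1, by linarith, fun Δ hΔ s hs => ?_⟩
  have hΔ0 : 0 < Δ := by linarith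
  have hi : 0 < 1/Δ := by positivity
  have hi1 : 1/Δ ≤ 1 := by rw [div_le_one hΔ0]; exact hΔ
  set c := 1 + 1/Δ with hc
  set f : ℕ → ℂ := fun n => ((ArithmeticFunction.vonMangoldt n : ℝ) : ℂ) with hf
  have hsum : LSeriesSummable f (c:ℂ) := ArithmeticFunction.LSeriesSummable_vonMangoldt (by simp; linarith)
  have hL := ArithmeticFunction.LSeries_vonMangoldt_eq_deriv_riemannZeta_div (s := s) (by linarith)
  have hLc := ArithmeticFunction.LSeries_vonMangoldt_eq_deriv_riemannZeta_div (s := c) (by simp; linarith)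
  have hterm : ∀ n : ℕ, ‖LSeries.term f c n‖ = (LSeries.term f c n).re := by
    intro n
    by_cases hn : n = 0
    · simp [hn]
    · have : LSeries.term f c n = ((ArithmeticFunction.vonMangoldt n / (n:ℝ)^c : ℝ) : ℂ) := by
        rw [LSeries.term_of_ne_zero hn, hf]
        push_cast
        rw [Complex.ofReal_cpow (Nat.cast_nonneg n)]
        simp
      rw [this, Complex.norm_real, Real.norm_eq_abs, ofReal_re, abs_of_nonneg]
      have := ArithmeticFunction.vonMangoldt_nonneg (n := n)
      positivity
  have hnorm : ∑' n, ‖LSeries.term f c n‖ = (LSeries f c).re := by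
    simp_rw [hterm]
    exact (Complex.re_tsum hsum).symm
  have hc1 : (c:ℂ) ≠ 1 := by
    intro h
    have : c = 1 := by exact_mod_cast h
    linarith
  have hbound : (LSeries f c).re ≤ (K0 + 1) * Δ := by
    rw [hLc, neg_div, sbW_eq c hc1 (sb_ne RH c (by simp; linarith))]
    have h1 := hK0 c ⟨by linarith, by linarith⟩
    have h2 := (abs_le.1 (Complex.abs_re_le_norm (sbW c))).1
    have h3 : ((c:ℂ) - 1)⁻¹ = (Δ : ℝ) := by rw [hc]; push_cast; simp
    rw [h3]
    simp
    nlinarith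
  have hn2 : ∀ n : ℕ, ‖LSeries.term f s n‖ ≤ Real.exp (-(Real.log 2) * (s.re - c)) * ‖LSeries.term f c n‖ := by
    intro n
    rcases Nat.lt_or_ge n 2 with h | h
    · interval_cases n
      · simp
      · simp [LSeries.term, hf]
    · rw [LSeries.norm_term_eq, LSeries.norm_term_eq, if_neg (by omega), if_neg (by omega)]
      have hn : (2:ℝ) ≤ n := by exact_mod_cast h
      have hn0 : (0:ℝ) < n := by linarith
      have e : (n:ℝ)^s.re = (n:ℝ)^(s.re - c) * (n:ℝ)^c := by
        rw [← Real.rpow_add hn0]; congr 1; ring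
      have e2 : Real.exp (-(Real.log 2) * (s.re - c)) = ((2:ℝ)^(s.re - c))⁻¹ := by
        rw [Real.rpow_def_of_pos (by norm_num), ← Real.exp_neg]; congr 1; ring
      have h3 : (2:ℝ)^(s.re - c) ≤ (n:ℝ)^(s.re - c) := Real.rpow_le_rpow (by norm_num) hn (by linarith)
      rw [ofReal_re, e, e2, div_mul_eq_div_div, div_eq_mul_inv _ ((n:ℝ)^(s.re - c)), div_eq_mul_inv, div_eq_mul_inv, mul_comm ‖f n‖, mul_assoc]
      gcongr
  have hn := tsum_of_norm_bounded (hsum.norm.hasSum.mul_left _) hn2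
  have e : deriv riemannZeta s / riemannZeta s = - ∑' n, LSeries.term f s n := by
    have : ∑' n, LSeries.term f s n = - deriv riemannZeta s / riemannZeta s := hL
    rw [this]; ring
  rw [e, norm_neg]
  refine hn.trans ?_
  rw [hnorm, mul_comm]
  gcongr


lemma sb_log_le_sqrt (x : ℝ) (hx : 0 < x) : Real.log x ≤ 2 * x ^ (1/2 : ℝ) := by
  have h := Real.log_le_sub_one_of_pos (x := x ^ (1/2:ℝ)) (by positivity)
  rw [Real.log_rpow hx] at h
  linarith

noncomputable def sbf1 (Δ t a : ℝ) (z : ℂ) : ℂ := sbW (a + I * (t - z)) * (sbPhi (Δ * z) - sbG (Δ * z))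
noncomputable def sbf2 (Δ t a : ℝ) (z : ℂ) : ℂ := sbW (a + I * (t + z)) * sbG (Δ * z)

/-- the kernel bounds at a scaled argument -/
lemma sb_kernel_scaled : ∃ C : ℝ, 0 ≤ C ∧ ∀ Δ h : ℝ, 1 ≤ Δ → ∀ z : ℂ, 0 ≤ z.re → |z.im| ≤ h →
    ‖sbG (Δ * z)‖ ≤ C * Real.exp (2 * π * (Δ * h)) * (Δ * z.re + 1) ^ (-2 : ℝ) ∧
    ‖sbPhi (Δ * z) - sbG (Δ * z)‖ ≤ C * Real.exp (2 * π * (Δ * h)) * (Δ * z.re + 1) ^ (-2 : ℝ) := by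
  obtain ⟨C, hC0, hC⟩ := sb_kernel_bound
  refine ⟨2 * C, by linarith, fun Δ h hΔ z hz hh => ?_⟩
  have hΔ0 : 0 < Δ := by linarith
  obtain ⟨h1, h2⟩ := hC (Δ * z) (by simp; positivity)
  have hre : Δ * z.re ≤ ‖(Δ:ℂ) * z‖ := by
    have := Complex.re_le_norm ((Δ:ℂ) * z)
    simpa using this
  have him : |((Δ:ℂ) * z).im| ≤ Δ * h := by
    simp only [mul_im, ofReal_re, ofReal_im, zero_mul, add_zero]
    rw [abs_mul, abs_of_pos hΔ0]; gcongr
  have hp : 0 < Δ * z.re + 1 := by positivity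
  have hb : C * Real.exp (2 * π * |((Δ:ℂ) * z).im|) / (1 + ‖(Δ:ℂ) * z‖)^2 ≤ C * Real.exp (2 * π * (Δ * h)) * (Δ * z.re + 1) ^ (-2 : ℝ) := by
    rw [Real.rpow_neg hp.le, ← div_eq_mul_inv, Real.rpow_two]
    gcongr ?_ * Real.exp (?_) / ?_ ^ 2
    · gcongr
    · linarith
  have hnn := (norm_nonneg _).trans (h1.trans hb)
  constructor
  · linarith [h1.trans hb]
  · refine (norm_sub_le _ _).trans ?_
    linarith [h1.trans hb, h2.trans hb]

lemma sb_Wline (RH : ∀ ρ : ℂ, riemannZeta ρ = 0 → 0 ≤ ρ.re → ρ.re ≤ 1 → ρ.re = 1 / 2) (a : ℝ) (ha : 1/2 < a) (ha1 : a < 1) (t : ℝ) :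
    ∃ C, 0 ≤ C ∧ ∀ s : ℂ, ∀ x : ℝ, 0 ≤ x → a ≤ s.re → s.re ≤ 2 → |s.im| ≤ |t| + x → ‖sbW s‖ ≤ C * (x + 1) ^ (1/2 : ℝ) := by
  obtain ⟨C, hC0, hC⟩ := sb_L3 RH a ha ha1
  refine ⟨C * (2 * (4 + |t|) ^ (1/2:ℝ)), by positivity, fun s x hx h1 h2 h3 => ?_⟩
  have h := (hC s h1).2 h2
  refine h.trans ?_
  rw [mul_assoc]
  apply mul_le_mul_of_nonneg_left _ hC0
  refine (sb_log_le_sqrt _ (by positivity)).trans ?_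
  rw [mul_assoc, ← Real.mul_rpow (by positivity) (by positivity)]
  have hn : ‖s‖ ≤ 2 + |t| + x := by
    refine (Complex.norm_le_abs_re_add_abs_im s).trans ?_
    rw [abs_of_pos (by linarith)]; linarith
  gcongr
  nlinarith [abs_nonneg t]

lemma sb_shift (RH : ∀ ρ : ℂ, riemannZeta ρ = 0 → 0 ≤ ρ.re → ρ.re ≤ 1 → ρ.re = 1 / 2) (a : ℝ) (ha : 1/2 < a) (ha1 : a < 1)
    (Δ t : ℝ) (hΔ : 1 ≤ Δ) (h : ℝ) (h0 : 0 ≤ h) (h1 : a + h ≤ 2) :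
    IntegrableOn (fun x : ℝ => sbf1 Δ t a x) (Set.Ioi 0) ∧ IntegrableOn (fun x : ℝ => sbf2 Δ t a x) (Set.Ioi 0) ∧
    IntegrableOn (fun x : ℝ => sbf1 Δ t a (x + h * I)) (Set.Ioi 0) ∧ IntegrableOn (fun x : ℝ => sbf2 Δ t a (x + (-h : ℝ) * I)) (Set.Ioi 0) ∧
    (∫ x in Set.Ioi (0:ℝ), sbf1 Δ t a x) + (∫ x in Set.Ioi (0:ℝ), sbf2 Δ t a x) - (∫ x in Set.Ioi (0:ℝ), sbf1 Δ t a (x + h * I)) - (∫ x in Set.Ioi (0:ℝ), sbf2 Δ t a (x + (-h : ℝ) * I))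
      = I * ∫ v in (0:ℝ)..h, sbW (a + v + t * I) := by
  have hΔ0 : 0 < Δ := by linarith
  obtain ⟨C, hC0, hC⟩ := sb_kernel_scaled
  obtain ⟨D, hD0, hD⟩ := sb_Wline RH a ha ha1 t
  set B := D * (C * Real.exp (2 * π * (Δ * h)))
  have hB0 : 0 ≤ B := by positivity
  have hcomb : ∀ x : ℝ, 0 ≤ x → (D * (x + 1)^(1/2:ℝ)) * (C * Real.exp (2 * π * (Δ * h)) * (Δ * x + 1) ^ (-2:ℝ)) ≤ B * (x + 1) ^ (-(3/2):ℝ) := by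
    intro x hx
    have e : (Δ * x + 1) ^ (-2:ℝ) ≤ (x + 1)^(-2:ℝ) := by
      apply Real.rpow_le_rpow_of_nonpos (by positivity) (by nlinarith) (by norm_num)
    calc _ ≤ (D * (x + 1)^(1/2:ℝ)) * (C * Real.exp (2 * π * (Δ * h)) * (x + 1) ^ (-2:ℝ)) := by gcongr
      _ = B * ((x + 1)^(1/2:ℝ) * (x + 1) ^ (-2:ℝ)) := by ring
      _ = _ := by rw [← Real.rpow_add (by positivity)]; norm_num
  have hu : Set.uIcc 0 h = Set.Icc 0 h := Set.uIcc_of_le h0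
  have hu' : Set.uIcc 0 (-h) = Set.Icc (-h) 0 := Set.uIcc_of_ge (by linarith)
  have d1 : ∀ z : ℂ, 0 ≤ z.re → z.im ∈ Set.uIcc 0 h → DifferentiableAt ℂ (sbf1 Δ t a) z := by
    intro z hz hz2
    rw [hu] at hz2
    unfold sbf1
    apply DifferentiableAt.mul
    · apply DifferentiableAt.comp (g := sbW) (f := fun z : ℂ => (a:ℂ) + I * (t - z)) z _ (by fun_prop)
      apply sbW_diff RH
      simp; linarith [hz2.1]
    · apply DifferentiableAt.sub
      · apply DifferentiableAt.comp (g := sbPhi) (f := fun z : ℂ => (Δ:ℂ) * z) z (sbPhi_diff _) (by fun_prop)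
      · apply DifferentiableAt.comp (g := sbG) (f := fun z : ℂ => (Δ:ℂ) * z) z _ (by fun_prop)
        apply sbG_diff; simp; nlinarith
  have d2 : ∀ z : ℂ, 0 ≤ z.re → z.im ∈ Set.uIcc 0 (-h) → DifferentiableAt ℂ (sbf2 Δ t a) z := by
    intro z hz hz2
    rw [hu'] at hz2
    unfold sbf2
    apply DifferentiableAt.mul
    · apply DifferentiableAt.comp (g := sbW) (f := fun z : ℂ => (a:ℂ) + I * (t + z)) z _ (by fun_prop)
      apply sbW_diff RH
      simp; linarith [hz2.2]
    · apply DifferentiableAt.comp (g := sbG) (f := fun z : ℂ => (Δ:ℂ) * z) z _ (by fun_prop)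
      apply sbG_diff; simp; nlinarith
  have c1 := sb_contour (sbf1 Δ t a) h B ?_ ?_
  · have c2 := sb_contour (sbf2 Δ t a) (-h) B ?_ ?_
    · obtain ⟨i1, i2, e1⟩ := c1
      obtain ⟨i3, i4, e2⟩ := c2
      refine ⟨i1, i3, i2, i4, ?_⟩
      have hW : ∀ v : ℝ, 0 ≤ v → DifferentiableAt ℂ sbW (a + v + t * I) := fun v hv => sbW_diff RH _ (by simp; linarith)
      have e3 : ∫ v in (0:ℝ)..(-h), sbf2 Δ t a (v * I) = - ∫ v in (0:ℝ)..h, sbf2 Δ t a (-(v * I)) := by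
        have := intervalIntegral.integral_comp_neg (a := 0) (b := h) (fun v : ℝ => sbf2 Δ t a (v * I))
        rw [neg_zero, intervalIntegral.integral_symm 0 (-h)] at this
        rw [eq_neg_iff_add_eq_zero, ← neg_inj, neg_add, ← this]
        simp
      have hg1 : ContinuousOn (fun v : ℝ => sbf1 Δ t a (v * I)) (Set.uIcc 0 h) := by
        intro v hv
        apply ContinuousAt.continuousWithinAt
        apply ContinuousAt.comp (g := sbf1 Δ t a) (f := fun v : ℝ => (v * I : ℂ)) _ (by fun_prop)
        exact (d1 _ (by simp) (by simpa using hv)).continuousAt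
      have hg2 : ContinuousOn (fun v : ℝ => sbf2 Δ t a (-(v * I))) (Set.uIcc 0 h) := by
        intro v hv
        apply ContinuousAt.continuousWithinAt
        apply ContinuousAt.comp (g := sbf2 Δ t a) (f := fun v : ℝ => (-(v * I) : ℂ)) _ (by fun_prop)
        rw [hu] at hv
        exact (d2 _ (by simp) (by rw [hu']; simpa using hv.symm)).continuousAt
      have e4 : ∫ v in (0:ℝ)..h, sbW (a + v + t * I) = (∫ v in (0:ℝ)..h, sbf1 Δ t a (v * I)) - ∫ v in (0:ℝ)..h, sbf2 Δ t a (-(v * I)) := by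
        rw [← intervalIntegral.integral_sub hg1.intervalIntegrable hg2.intervalIntegrable]
        apply intervalIntegral.integral_congr_ae
        filter_upwards with v hv
        rw [Set.uIoc_of_le h0] at hv
        have hj := sb_jump' (Δ * v) (mul_pos hΔ0 hv.1)
        rw [sbf1, sbf2]
        rw [show (a:ℂ) + I * (t - v * I) = a + v + t * I by linear_combination (-v:ℂ) * I_mul_I, show (a:ℂ) + I * (t + -(v * I)) = a + v + t * I by linear_combination (-v:ℂ) * I_mul_I]
        push_cast at hj
        rw [show (Δ:ℂ) * (v * I) = Δ * v * I by ring, show (Δ:ℂ) * -(v * I) = -(Δ * v * I) by ring, ← mul_sub, hj, mul_one]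
      rw [e3] at e2
      rw [e4]
      linear_combination e1 + e2
    · exact d2
    · intro z hz hz2
      rw [hu'] at hz2
      rw [sbf2, norm_mul]
      refine le_trans ?_ (hcomb z.re hz)
      gcongr
      · apply hD _ _ hz
        · simp; linarith [hz2.2]
        · simp; linarith [hz2.1]
        · simp only [add_im, mul_im, I_re, I_im, ofReal_im, add_re, ofReal_re, zero_mul, one_mul, zero_add]
          refine (abs_add_le _ _).trans ?_; rw [abs_of_nonneg hz]
      · exact (hC Δ h hΔ z hz (abs_le.2 ⟨hz2.1, by linarith [hz2.2]⟩)).1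
  · exact d1
  · intro z hz hz2
    rw [hu] at hz2
    rw [sbf1, norm_mul]
    refine le_trans ?_ (hcomb z.re hz)
    gcongr
    · apply hD _ _ hz
      · simp; linarith [hz2.1]
      · simp; linarith [hz2.2]
      · simp only [add_im, sub_im, sub_re, mul_im, I_re, I_im, ofReal_im, add_re, ofReal_re, zero_mul, one_mul, zero_add]
        refine (abs_sub _ _).trans ?_; rw [abs_of_nonneg hz]
    · exact (hC Δ h hΔ z hz (abs_le.2 ⟨by linarith [hz2.1], hz2.2⟩)).2


lemma sb_real_pt (RH : ∀ ρ : ℂ, riemannZeta ρ = 0 → 0 ≤ ρ.re → ρ.re ≤ 1 → ρ.re = 1 / 2) (a : ℝ) (ha : 1/2 < a) (ha1 : a < 1)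
    (Δ t : ℝ) (hΔ : 1 ≤ Δ) (ht : 9 ≤ t) (x : ℝ) (hx : 0 < x) :
    -((1/2 * Real.log t + 14) * sbphi (Δ * x) + 4 * (x + 1) ^ (-(3/2) : ℝ)) ≤ (sbf1 Δ t a x + sbf2 Δ t a x).re := by
  have hΔ0 : 0 < Δ := by linarith
  have hW : ∀ y : ℝ, |y| ≤ t + x → -((1/2 * Real.log t + 14) + (x+1)^(1/2:ℝ)) ≤ (sbW (a + I * y)).re := by
    intro y hy
    have h := sb_pos RH (a + I * y) (by simp; linarith)
    refine le_trans ?_ h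
    have hn : ‖(a:ℂ) + I * y‖ ≤ 1 + t + x := by
      refine (Complex.norm_le_abs_re_add_abs_im _).trans ?_
      simp
      rw [abs_of_pos (by linarith)]; linarith
    have hlog : Real.log (1 + ‖(a:ℂ) + I * y‖) ≤ Real.log t + 1 + Real.log (x + 1) := by
      have h1 : Real.log (1 + ‖(a:ℂ) + I * y‖) ≤ Real.log (t * Real.exp 1 * (x + 1)) := by
        apply Real.log_le_log (by positivity)
        have := Real.add_one_le_exp (1:ℝ)
        have h2 : t * 2 ≤ t * Real.exp 1 := by gcongr; linarith
        nlinarith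
      rwa [Real.log_mul (by positivity) (by positivity), Real.log_mul (by positivity) (by positivity), Real.log_exp] at h1
    have := sb_log_le_sqrt (x + 1) (by linarith)
    linarith
  have hp := sbphi_nonneg (Δ * x)
  have hR := sbRr_mem (Δ * x) (by positivity)
  have e1 : sbf1 Δ t a x = sbW (a + I * ((t - x : ℝ) : ℂ)) * ((sbphi (Δ * x) * (1 - sbRr (Δ * x)) : ℝ) : ℂ) := by
    rw [sbf1, ← ofReal_mul, sbPhi_ofReal, sbG_ofReal]; push_cast; ring
  have e2 : sbf2 Δ t a x = sbW (a + I * ((t + x : ℝ) : ℂ)) * ((sbphi (Δ * x) * sbRr (Δ * x) : ℝ) : ℂ) := by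
    rw [sbf2, ← ofReal_mul, sbG_ofReal]; push_cast; ring
  have w1 := hW (t - x) (by rw [abs_le]; constructor <;> linarith)
  have w2 := hW (t + x) (by rw [abs_of_pos (by linarith)])
  rw [e1, e2, add_re, re_mul_ofReal, re_mul_ofReal]
  have hphi : (x+1)^(1/2:ℝ) * sbphi (Δ * x) ≤ 4 * (x + 1) ^ (-(3/2) : ℝ) := by
    have h1 := sbphi_le (Δ * x) (by positivity)
    have h2 : 2 / (1 + (Δ * x)^2) ≤ 4 * (x + 1)^(-2:ℝ) := by
      rw [Real.rpow_neg (by positivity), Real.rpow_two, ← div_eq_mul_inv, div_le_div_iff₀ (by positivity) (by positivity)]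
      have : x ≤ Δ * x := by nlinarith
      nlinarith [sq_nonneg (x - 1)]
    calc _ ≤ (x+1)^(1/2:ℝ) * (4 * (x + 1)^(-2:ℝ)) := by gcongr; linarith
      _ = 4 * ((x+1)^(1/2:ℝ) * (x + 1)^(-2:ℝ)) := by ring
      _ = _ := by rw [← Real.rpow_add (by positivity)]; norm_num
  set p := sbphi (Δ * x)
  set r := sbRr (Δ * x)
  set M := (1/2 * Real.log t + 14) + (x+1)^(1/2:ℝ) with hM
  have a1 : -M * (p * (1 - r)) ≤ (sbW (a + I * ((t - x : ℝ) : ℂ))).re * (p * (1 - r)) :=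
    mul_le_mul_of_nonneg_right w1 (mul_nonneg hp (by linarith [hR.2]))
  have a2 : -M * (p * r) ≤ (sbW (a + I * ((t + x : ℝ) : ℂ))).re * (p * r) :=
    mul_le_mul_of_nonneg_right w2 (mul_nonneg hp hR.1)
  have a3 : -M * (p * (1 - r)) + -M * (p * r) = -(1/2 * Real.log t + 14) * p - (x+1)^(1/2:ℝ) * p := by rw [hM]; ring
  linarith

lemma sb_main (RH : ∀ ρ : ℂ, riemannZeta ρ = 0 → 0 ≤ ρ.re → ρ.re ≤ 1 → ρ.re = 1 / 2) :
    ∃ C : ℝ, 0 ≤ C ∧ ∀ Δ t a : ℝ, 1 ≤ Δ → 9 ≤ t → 1/2 < a → a < 1 →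
      -(Real.log t / (4 * Δ)) - C * Real.exp (π * Δ) ≤ - ∫ v in (0:ℝ)..(1 + 1/Δ - a), (sbW (a + v + t * I)).im := by
  obtain ⟨C, hC0, hC⟩ := sb_kernel_scaled
  obtain ⟨K, hK0, hK⟩ := sb_tail RH
  set J := ∫ x in Set.Ioi (0:ℝ), (x + 1) ^ (-(3/2) : ℝ) with hJ
  set J2 := ∫ x in Set.Ioi (0:ℝ), (x + 1) ^ (-2 : ℝ) with hJ2
  have hIJ : IntegrableOn (fun x : ℝ => (x + 1) ^ (-(3/2) : ℝ)) (Set.Ioi 0) := integrableOn_add_rpow_Ioi_of_lt (by norm_num) (by norm_num)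
  have hIJ2 : IntegrableOn (fun x : ℝ => (x + 1) ^ (-2 : ℝ)) (Set.Ioi 0) := integrableOn_add_rpow_Ioi_of_lt (by norm_num) (by norm_num)
  have hJ0 : 0 ≤ J := setIntegral_nonneg measurableSet_Ioi fun x hx => by
    have : 0 < x := hx
    positivity
  have hJ20 : 0 ≤ J2 := setIntegral_nonneg measurableSet_Ioi fun x hx => by
    have : 0 < x := hx
    positivity
  refine ⟨7 + 4 * J + 2 * ((K + 1) * C * Real.exp (2 * π) * J2), by positivity, fun Δ t a hΔ ht ha ha1 => ?_⟩
  have hΔ0 : 0 < Δ := by linarith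
  have hi : 0 < 1/Δ := by positivity
  have hi1 : 1/Δ ≤ 1 := by rw [div_le_one hΔ0]; exact hΔ
  set h := 1 + 1/Δ - a with hh
  have hh0 : 0 ≤ h := by linarith
  obtain ⟨i1, i2, i3, i4, e⟩ := sb_shift RH a ha ha1 Δ t hΔ h hh0 (by linarith)
  -- integrand is integrable
  have hWint : IntervalIntegrable (fun v : ℝ => sbW (a + v + t * I)) volume 0 h := by
    apply ContinuousOn.intervalIntegrable
    intro v hv
    rw [Set.uIcc_of_le hh0] at hv
    apply ContinuousAt.continuousWithinAt
    apply ContinuousAt.comp (g := sbW) (f := fun v : ℝ => (a + v + t * I : ℂ)) _ (by fun_prop)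
    exact (sbW_diff RH _ (by simp; linarith [hv.1])).continuousAt
  have him : (∫ v in (0:ℝ)..h, (sbW (a + v + t * I)).im) = (∫ v in (0:ℝ)..h, sbW (a + v + t * I)).im := by
    rw [intervalIntegral.integral_of_le hh0, intervalIntegral.integral_of_le hh0]
    exact integral_im ((intervalIntegrable_iff_integrableOn_Ioc_of_le hh0).1 hWint)
  rw [him]
  have hre := congrArg Complex.re e
  rw [I_mul_re] at hre
  rw [← hre, sub_re, sub_re]
  -- the real line part
  have hreal : -(Real.log t / (4 * Δ)) - 7 - 4 * J ≤ ((∫ x in Set.Ioi (0:ℝ), sbf1 Δ t a x) + (∫ x in Set.Ioi (0:ℝ), sbf2 Δ t a x)).re := by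
    rw [← integral_add i1 i2]
    have : (∫ x in Set.Ioi (0:ℝ), (sbf1 Δ t a x + sbf2 Δ t a x)).re = ∫ x in Set.Ioi (0:ℝ), (sbf1 Δ t a x + sbf2 Δ t a x).re :=
      (integral_re (i1.add i2)).symm
    rw [this]
    obtain ⟨hφi, hφ⟩ := sbphi_int
    have hφs : IntegrableOn (fun x : ℝ => sbphi (Δ * x)) (Set.Ioi 0) := by
      have := (integrableOn_Ioi_comp_mul_left_iff sbphi 0 hΔ0).2 (by simpa using hφi)
      exact this
    have hφv : ∫ x in Set.Ioi (0:ℝ), sbphi (Δ * x) ≤ 1 / (2 * Δ) := by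
      rw [integral_comp_mul_left_Ioi sbphi 0 hΔ0, mul_zero, smul_eq_mul]
      calc _ ≤ Δ⁻¹ * (1/2) := by gcongr
        _ = _ := by field_simp
    have hφ0 : 0 ≤ ∫ x in Set.Ioi (0:ℝ), sbphi (Δ * x) := integral_nonneg fun x => sbphi_nonneg _
    have hmono : ∫ x in Set.Ioi (0:ℝ), -((1/2 * Real.log t + 14) * sbphi (Δ * x) + 4 * (x + 1) ^ (-(3/2) : ℝ)) ≤ ∫ x in Set.Ioi (0:ℝ), (sbf1 Δ t a x + sbf2 Δ t a x).re := by
      apply setIntegral_mono_on ((hφs.const_mul _).add (hIJ.const_mul _)).neg (i1.add i2).re measurableSet_Ioi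
      intro x hx
      exact sb_real_pt RH a ha ha1 Δ t hΔ ht x hx
    refine le_trans ?_ hmono
    rw [integral_neg, integral_add (hφs.const_mul _) (hIJ.const_mul _), integral_const_mul, integral_const_mul]
    have hlog : 0 ≤ Real.log t := Real.log_nonneg (by linarith)
    have h1 : (1/2 * Real.log t + 14) * ∫ x in Set.Ioi (0:ℝ), sbphi (Δ * x) ≤ (1/2 * Real.log t + 14) * (1 / (2 * Δ)) := by gcongr
    have h2 : (1/2 * Real.log t + 14) * (1 / (2 * Δ)) = Real.log t / (4 * Δ) + 7 * (1/Δ) := by field_simp; ring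
    linarith
  -- the top part
  have hexp : Real.exp (2 * π * (Δ * h)) ≤ Real.exp (2 * π) * Real.exp (π * Δ) := by
    rw [← Real.exp_add]
    apply Real.exp_le_exp.2
    have : Δ * h = 1 + Δ * (1 - a) := by rw [hh]; field_simp; ring
    rw [this]
    have h1 : Δ * (1 - a) ≤ Δ * (1/2) := by gcongr; linarith
    have := mul_le_mul_of_nonneg_left h1 Real.pi_pos.le
    linarith
  have hWc : ∀ y : ℝ, ‖sbW (((1 + 1/Δ : ℝ) : ℂ) + I * y)‖ ≤ (K + 1) * Δ := by
    intro y
    set s : ℂ := ((1 + 1/Δ : ℝ) : ℂ) + I * y with hs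
    have hsre : s.re = 1 + 1/Δ := by
      rw [hs]; simp only [add_re, ofReal_re, mul_re, I_re, ofReal_im, I_im]; ring
    have hs1 : s ≠ 1 := by
      intro h; rw [h, one_re] at hsre; linarith
    have h1 := hK Δ hΔ s hsre.ge
    rw [hsre, sub_self, mul_zero, Real.exp_zero, mul_one, sbW_eq s hs1 (sb_ne RH s (by rw [hsre]; linarith))] at h1
    have h2 : ‖(s - 1)⁻¹‖ ≤ Δ := by
      rw [norm_inv]
      apply inv_le_of_inv_le₀ hΔ0
      have := Complex.re_le_norm (s - 1)
      rw [sub_re, hsre, one_re] at this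
      rw [inv_eq_one_div]; linarith
    have h3 := norm_add_le (sbW s - (s-1)⁻¹) ((s-1)⁻¹)
    rw [sub_add_cancel] at h3
    linarith
  have hB : ∀ g : ℝ → ℂ, (∀ x : ℝ, 0 < x → ‖g x‖ ≤ (K + 1) * Δ * (C * Real.exp (2 * π * (Δ * h)) * (Δ * x + 1) ^ (-2:ℝ))) →
      |(∫ x in Set.Ioi (0:ℝ), g x).re| ≤ (K + 1) * C * Real.exp (2 * π) * J2 * Real.exp (π * Δ) := by
    intro g hg
    refine (Complex.abs_re_le_norm _).trans ?_
    have hIntg : IntegrableOn (fun x : ℝ => (Δ * x + 1) ^ (-2:ℝ)) (Set.Ioi 0) := by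
      have := (integrableOn_Ioi_comp_mul_left_iff (fun x : ℝ => (x + 1) ^ (-2:ℝ)) 0 hΔ0).2 (by simpa using hIJ2)
      exact this
    have hval : ∫ x in Set.Ioi (0:ℝ), (Δ * x + 1) ^ (-2:ℝ) = Δ⁻¹ * J2 := by
      have := integral_comp_mul_left_Ioi (fun x : ℝ => (x + 1) ^ (-2:ℝ)) 0 hΔ0
      rw [mul_zero, smul_eq_mul] at this
      exact this
    have hn : ‖∫ x in Set.Ioi (0:ℝ), g x‖ ≤ ∫ x in Set.Ioi (0:ℝ), (K + 1) * Δ * (C * Real.exp (2 * π * (Δ * h)) * (Δ * x + 1) ^ (-2:ℝ)) := by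
      apply norm_integral_le_of_norm_le
      · exact (hIntg.const_mul _).const_mul _
      · rw [ae_restrict_iff' measurableSet_Ioi]
        filter_upwards with x hx
        exact hg x hx
    refine hn.trans ?_
    rw [integral_const_mul, integral_const_mul, hval]
    calc _ = (K + 1) * C * Real.exp (2 * π * (Δ * h)) * J2 := by field_simp
      _ ≤ (K + 1) * C * (Real.exp (2 * π) * Real.exp (π * Δ)) * J2 := by gcongr
      _ = _ := by ring
  have hT1 := hB (fun x : ℝ => sbf1 Δ t a (x + h * I)) (by
    intro x hx
    rw [sbf1, norm_mul]
    have k := (hC Δ h hΔ (x + h * I) (by simpa using hx.le) (by simp [abs_of_nonneg hh0])).2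
    have w := hWc (t - x)
    rw [show ((1 + 1/Δ : ℝ) : ℂ) + I * ((t - x : ℝ) : ℂ) = a + I * (t - (x + h * I)) by
      rw [hh]; push_cast; linear_combination (1 + 1/(Δ:ℂ) - a) * I_mul_I] at w
    have hx2 : ((x:ℂ) + h * I).re = x := by simp
    rw [hx2] at k
    gcongr)
  have hT2 := hB (fun x : ℝ => sbf2 Δ t a (x + (-h : ℝ) * I)) (by
    intro x hx
    rw [sbf2, norm_mul]
    have k := (hC Δ h hΔ (x + (-h : ℝ) * I) (by simpa using hx.le) (by simp [abs_of_nonneg hh0])).1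
    have w := hWc (t + x)
    rw [show ((1 + 1/Δ : ℝ) : ℂ) + I * ((t + x : ℝ) : ℂ) = a + I * (t + (x + (-h : ℝ) * I)) by
      rw [hh]; push_cast; linear_combination (1 + 1/(Δ:ℂ) - a) * I_mul_I] at w
    have hx2 : ((x:ℂ) + (-h : ℝ) * I).re = x := by simp
    rw [hx2] at k
    gcongr)
  have b1 := (abs_le.1 hT1).2
  have b2 := (abs_le.1 hT2).2
  have hE : 1 ≤ Real.exp (π * Δ) := Real.one_le_exp (by positivity)
  have b3 : (7 + 4 * J) * 1 ≤ (7 + 4 * J) * Real.exp (π * Δ) := by gcongr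
  linarith


theorem sb_step (RH : ∀ ρ : ℂ, riemannZeta ρ = 0 → 0 ≤ ρ.re → ρ.re ≤ 1 → ρ.re = 1 / 2) :
    ∃ C : ℝ, 0 ≤ C ∧ ∀ Δ t : ℝ, 1 ≤ Δ → 9 ≤ t →
      IntegrableOn (fun σ : ℝ => (deriv riemannZeta (σ + t * Complex.I) / riemannZeta (σ + t * Complex.I)).im) (Set.Ioi (1/2 : ℝ)) →
      ∫ σ in Set.Ioi (1 / 2 : ℝ),
        (deriv riemannZeta (σ + t * Complex.I) / riemannZeta (σ + t * Complex.I)).im ≤ Real.log t / (4 * Δ) + C * Real.exp (π * Δ) := by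
  obtain ⟨C, hC0, hC⟩ := sb_main RH
  obtain ⟨K, hK0, hK⟩ := sb_tail RH
  have hl2 : 0 < Real.log 2 := Real.log_pos (by norm_num)
  refine ⟨C + 2 + K / Real.log 2, by positivity, ?_⟩
  intro Δ t hΔ ht hIntg
  have hΔ0 : 0 < Δ := by linarith
  set f : ℝ → ℝ := fun σ => (deriv riemannZeta (σ + t * Complex.I) / riemannZeta (σ + t * Complex.I)).im with hf
  set c : ℝ := 1 + 1/Δ with hc
  have hc1 : 1 < c := by rw [hc]; have : 0 < 1/Δ := by positivity
                         linarith
  have hc2 : c ≤ 2 := by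
    rw [hc]; have : 1/Δ ≤ 1 := by rw [div_le_one hΔ0]; exact hΔ
    linarith
  have hE : 1 ≤ Real.exp (π * Δ) := Real.one_le_exp (by positivity)
  have hEΔ : Δ ≤ Real.exp (π * Δ) := by
    have h1 := Real.add_one_le_exp (π * Δ)
    have h2 := Real.pi_gt_three
    nlinarith
  -- tail
  have hT : ∫ σ in Set.Ioi c, f σ ≤ K / Real.log 2 * Real.exp (π * Δ) := by
    have hi : IntegrableOn (fun σ : ℝ => K * Δ * Real.exp (Real.log 2 * c) * Real.exp (-(Real.log 2) * σ)) (Set.Ioi c) :=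
      (integrableOn_exp_mul_Ioi (by linarith) c).const_mul _
    have h1 : ∫ σ in Set.Ioi c, f σ ≤ ∫ σ in Set.Ioi c, K * Δ * Real.exp (Real.log 2 * c) * Real.exp (-(Real.log 2) * σ) := by
      apply setIntegral_mono_on (hIntg.mono_set (Set.Ioi_subset_Ioi (by linarith))) hi measurableSet_Ioi
      intro x hx
      have hx' : c < x := hx
      have := hK Δ hΔ (x + t * I) (by simp; rw [hc] at hx'; simpa using hx'.le)
      refine ((le_abs_self _).trans (Complex.abs_im_le_norm _)).trans (this.trans (le_of_eq ?_))
      rw [mul_assoc _ (Real.exp _) (Real.exp _), ← Real.exp_add]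
      congr 2
      simp [hc]
      ring
    refine h1.trans ?_
    rw [integral_const_mul, integral_exp_mul_Ioi (by linarith)]
    have : K * Δ * Real.exp (Real.log 2 * c) * (-Real.exp (-Real.log 2 * c) / -Real.log 2) = K / Real.log 2 * Δ := by
      rw [neg_div_neg_eq, neg_mul, Real.exp_neg]
      field_simp
    rw [this]
    gcongr
  -- middle
  have hM : ∀ a : ℝ, 1/2 < a → a < 1 → ∫ σ in a..c, f σ ≤ Real.log t / (4 * Δ) + C * Real.exp (π * Δ) + 2 := by
    intro a ha ha1
    have h0 := hC Δ t a hΔ ht ha ha1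
    have hne : ∀ v : ℝ, ((a:ℂ) + v + t * I) ≠ 1 := by
      intro v hv
      have := congrArg Complex.im hv
      simp at this
      linarith
    have e1 : ∫ σ in a..c, f σ = ∫ v in (0:ℝ)..(c - a), f (a + v) := by
      rw [intervalIntegral.integral_comp_add_left]; simp
    have e2 : ∫ v in (0:ℝ)..(c - a), f (a + v) = ∫ v in (0:ℝ)..(c - a), ((sbW (a + v + t * I)).im - (((a:ℂ) + v + t * I - 1)⁻¹).im) := by
      apply intervalIntegral.integral_congr
      intro v hv
      rw [Set.uIcc_of_le (by linarith)] at hv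
      have := sbW_eq (a + v + t * I) (hne v) (sb_ne RH _ (by simp; linarith [hv.1]))
      simp only [hf]
      push_cast
      rw [this, Complex.sub_im]
    have i1 : IntervalIntegrable (fun v : ℝ => (sbW (a + v + t * I)).im) volume 0 (c - a) := by
      apply ContinuousOn.intervalIntegrable
      intro v hv
      rw [Set.uIcc_of_le (by linarith)] at hv
      apply ContinuousAt.continuousWithinAt
      have hw := (sbW_diff RH (a + v + t * I) (by simp; linarith [hv.1])).continuousAt
      have hg : ContinuousAt (fun v : ℝ => (a:ℂ) + v + t * I) v := by fun_prop
      exact Complex.continuous_im.continuousAt.comp (ContinuousAt.comp (f := fun v : ℝ => (a:ℂ) + v + t * I) hw hg)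
    have i2 : IntervalIntegrable (fun v : ℝ => (((a:ℂ) + v + t * I - 1)⁻¹).im) volume 0 (c - a) := by
      apply Continuous.intervalIntegrable
      apply Complex.continuous_im.comp
      apply Continuous.inv₀ (by fun_prop)
      intro v
      exact sub_ne_zero.2 (hne v)
    have b2 : ‖∫ v in (0:ℝ)..(c - a), (((a:ℂ) + v + t * I - 1)⁻¹).im‖ ≤ 1 * |c - a - 0| := by
      apply intervalIntegral.norm_integral_le_of_norm_le_const
      intro v _
      refine (Complex.abs_im_le_norm _).trans ?_
      rw [norm_inv]
      apply inv_le_one_of_one_le₀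
      refine le_trans ?_ (Complex.abs_im_le_norm _)
      simp
      rw [abs_of_nonneg (by linarith)]
      linarith
    rw [e1, e2, intervalIntegral.integral_sub i1 i2]
    rw [Real.norm_eq_abs, one_mul, sub_zero, abs_of_nonneg (show 0 ≤ c - a by linarith)] at b2
    have := (abs_le.1 b2).1
    linarith
  -- limit
  have hFc : ContinuousWithinAt (fun x => ∫ σ in (1/2:ℝ)..x, f σ) (Set.Ioi (1/2)) (1/2) := by
    have hI : IntegrableOn f (Set.uIcc (1/2:ℝ) 1) := by
      rw [Set.uIcc_of_le (by norm_num), integrableOn_Icc_iff_integrableOn_Ioc]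
      exact hIntg.mono_set Set.Ioc_subset_Ioi_self
    have h1 := intervalIntegral.continuousOn_primitive_interval hI (1/2) (by simp)
    rw [Set.uIcc_of_le (by norm_num)] at h1
    apply h1.mono_of_mem_nhdsWithin
    exact mem_of_superset (Ioo_mem_nhdsGT (by norm_num : (1/2:ℝ) < 1)) Set.Ioo_subset_Icc_self
  have hF0 : Tendsto (fun x => ∫ σ in (1/2:ℝ)..x, f σ) (nhdsWithin (1/2) (Set.Ioi (1/2))) (nhds 0) := by
    have := hFc.tendsto
    simpa using this
  have hlow : ∀ᶠ a in nhdsWithin (1/2:ℝ) (Set.Ioi (1/2)),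
      (∫ σ in Set.Ioi (1/2:ℝ), f σ) - (Real.log t / (4 * Δ) + C * Real.exp (π * Δ) + 2 + K / Real.log 2 * Real.exp (π * Δ)) ≤ ∫ σ in (1/2:ℝ)..a, f σ := by
    filter_upwards [Ioo_mem_nhdsGT (by norm_num : (1/2:ℝ) < 1)] with a ha
    have s1 := intervalIntegral.integral_interval_add_Ioi (a := (1/2:ℝ)) (b := a) hIntg (hIntg.mono_set (Set.Ioi_subset_Ioi ha.1.le))
    have s2 := intervalIntegral.integral_interval_add_Ioi (a := a) (b := c) (hIntg.mono_set (Set.Ioi_subset_Ioi ha.1.le)) (hIntg.mono_set (Set.Ioi_subset_Ioi (by linarith : 1/2 ≤ c)))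
    have := hM a ha.1 ha.2
    linarith
  have := ge_of_tendsto hF0 hlow
  nlinarith

theorem sb_nonord (t : ℝ) : ∀ᶠ ε in nhdsWithin (0:ℝ) {(0:ℝ)}ᶜ,
    (∀ ρ : ℂ, riemannZeta ρ = 0 → 0 ≤ ρ.re → ρ.re ≤ 1 → ρ.im ≠ t + ε) ∧
    (∀ ρ : ℂ, riemannZeta ρ = 0 → 0 ≤ ρ.re → ρ.re ≤ 1 → ρ.im ≠ t - ε) := by
  have hK : IsCompact (Set.Icc (0:ℝ) 1 ×ℂ Set.Icc (t-1) (t+1)) := isCompact_Icc.reProdIm isCompact_Icc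
  have hfin := hK.inter_riemannZetaZeros_finite
  have hF := ((hfin.image Complex.im).subset (Set.sdiff_subset (t := {t}))).isClosed.isOpen_compl.mem_nhds (x := t) (by simp)
  have h1 : Tendsto (fun ε : ℝ => t + ε) (nhdsWithin (0:ℝ) {(0:ℝ)}ᶜ) (nhds t) := by
    have : ContinuousAt (fun ε : ℝ => t + ε) 0 := by fun_prop
    have := this.tendsto.mono_left (nhdsWithin_le_nhds (s := {(0:ℝ)}ᶜ))
    simpa using this
  have h2 : Tendsto (fun ε : ℝ => t - ε) (nhdsWithin (0:ℝ) {(0:ℝ)}ᶜ) (nhds t) := by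
    have : ContinuousAt (fun ε : ℝ => t - ε) 0 := by fun_prop
    have := this.tendsto.mono_left (nhdsWithin_le_nhds (s := {(0:ℝ)}ᶜ))
    simpa using this
  have hI : Set.Icc (t-1) (t+1) ∈ nhds t := Icc_mem_nhds (by linarith) (by linarith)
  have key : ∀ u : ℝ, u ≠ t → u ∈ Set.Icc (t-1) (t+1) →
      u ∈ ((Complex.im '' ((Set.Icc (0:ℝ) 1 ×ℂ Set.Icc (t-1) (t+1)) ∩ riemannZetaZeros)) \ {t})ᶜ →
      ∀ ρ : ℂ, riemannZeta ρ = 0 → 0 ≤ ρ.re → ρ.re ≤ 1 → ρ.im ≠ u := by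
    intro u hu hu2 hu3 ρ h0 hr0 hr1 him
    apply hu3
    refine ⟨⟨ρ, ⟨?_, ?_⟩, him⟩, hu⟩
    · rw [Complex.mem_reProdIm]
      exact ⟨⟨hr0, hr1⟩, by rw [him]; exact hu2⟩
    · exact h0
  filter_upwards [h1.eventually hF, h2.eventually hF, h1.eventually hI, h2.eventually hI, self_mem_nhdsWithin] with ε a1 a2 a3 a4 a5
  have a5' : ε ≠ 0 := a5
  exact ⟨key _ (by simpa using a5') a3 a1, key _ (by simpa using a5') a4 a2⟩

theorem S_lower_bound_Delta
    (RH : ∀ ρ : ℂ, riemannZeta ρ = 0 → 0 ≤ ρ.re → ρ.re ≤ 1 → ρ.re = 1 / 2)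
    (S : ℝ → ℝ)
    (hS₁ : ∀ t : ℝ, 0 < t →
      (∀ ρ : ℂ, riemannZeta ρ = 0 → 0 ≤ ρ.re → ρ.re ≤ 1 → ρ.im ≠ t) →
      S t = -(1 / π) * ∫ σ in Set.Ioi (1 / 2 : ℝ),
        (deriv riemannZeta (σ + t * Complex.I) / riemannZeta (σ + t * Complex.I)).im)
    (hS₂ : ∀ t : ℝ, 0 < t →
      (∃ ρ : ℂ, riemannZeta ρ = 0 ∧ 0 ≤ ρ.re ∧ ρ.re ≤ 1 ∧ ρ.im = t) →
      Tendsto (fun ε : ℝ => (S (t + ε) + S (t - ε)) / 2)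
        (nhdsWithin 0 {(0 : ℝ)}ᶜ) (nhds (S t))) :
    ∃ C : ℝ, ∀ Δ t : ℝ, 1 ≤ Δ → 10 ≤ t →
      -(Real.log t / (4 * π * Δ)) - C * Real.exp (π * Δ) ≤ S t := by
  obtain ⟨C, hC0, hC⟩ := sb_step RH
  have main : ∀ Δ t : ℝ, 1 ≤ Δ → 9 ≤ t →
      (∀ ρ : ℂ, riemannZeta ρ = 0 → 0 ≤ ρ.re → ρ.re ≤ 1 → ρ.im ≠ t) →
      -(Real.log t / (4 * π * Δ)) - C / π * Real.exp (π * Δ) ≤ S t := by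
    intro Δ t hΔ ht hno
    have hΔ0 : 0 < Δ := by linarith
    have hlog : 0 ≤ Real.log t := Real.log_nonneg (by linarith)
    rw [hS₁ t (by linarith) hno]
    have hle : ∫ σ in Set.Ioi (1 / 2 : ℝ),
        (deriv riemannZeta (σ + t * Complex.I) / riemannZeta (σ + t * Complex.I)).im ≤ Real.log t / (4 * Δ) + C * Real.exp (π * Δ) := by
      by_cases hIntg : IntegrableOn (fun σ : ℝ => (deriv riemannZeta (σ + t * Complex.I) / riemannZeta (σ + t * Complex.I)).im) (Set.Ioi (1/2 : ℝ))
      · exact hC Δ t hΔ ht hIntg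
      · rw [integral_undef hIntg]; positivity
    have h2 := mul_le_mul_of_nonneg_left hle (show 0 ≤ 1 / π by positivity)
    have h3 : 1 / π * (Real.log t / (4 * Δ) + C * Real.exp (π * Δ)) = Real.log t / (4 * π * Δ) + C / π * Real.exp (π * Δ) := by
      field_simp
    linarith
  refine ⟨C / π, ?_⟩
  intro Δ t hΔ ht
  have hΔ0 : 0 < Δ := by linarith
  by_cases hord : ∃ ρ : ℂ, riemannZeta ρ = 0 ∧ 0 ≤ ρ.re ∧ ρ.re ≤ 1 ∧ ρ.im = t
  · have hlim := hS₂ t (by linarith) hord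
    have hlow : Tendsto (fun ε : ℝ => ((-(Real.log (t + ε) / (4 * π * Δ)) - C / π * Real.exp (π * Δ)) + (-(Real.log (t - ε) / (4 * π * Δ)) - C / π * Real.exp (π * Δ))) / 2)
        (nhdsWithin 0 {(0 : ℝ)}ᶜ) (nhds (-(Real.log t / (4 * π * Δ)) - C / π * Real.exp (π * Δ))) := by
      have hc : ContinuousAt (fun ε : ℝ => ((-(Real.log (t + ε) / (4 * π * Δ)) - C / π * Real.exp (π * Δ)) + (-(Real.log (t - ε) / (4 * π * Δ)) - C / π * Real.exp (π * Δ))) / 2) 0 := by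
        have p1 : t + 0 ≠ 0 := by linarith
        have p2 : t - 0 ≠ 0 := by linarith
        have q1 : ContinuousAt (fun ε : ℝ => Real.log (t + ε)) 0 := ContinuousAt.log (by fun_prop) p1
        have q2 : ContinuousAt (fun ε : ℝ => Real.log (t - ε)) 0 := ContinuousAt.log (by fun_prop) p2
        exact ((((q1.div_const _).neg).sub_const _).add (((q2.div_const _).neg).sub_const _)).div_const _
      have := hc.tendsto.mono_left (nhdsWithin_le_nhds (s := {(0:ℝ)}ᶜ))
      simpa using this
    refine le_of_tendsto_of_tendsto hlow hlim ?_
    have hsm : ∀ᶠ ε in nhdsWithin (0:ℝ) {(0:ℝ)}ᶜ, ε ∈ Set.Icc (-1:ℝ) 1 :=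
      nhdsWithin_le_nhds (Icc_mem_nhds (by norm_num) (by norm_num))
    filter_upwards [sb_nonord t, hsm] with ε h1 h2
    have m1 := main Δ (t + ε) hΔ (by linarith [h2.1]) h1.1
    have m2 := main Δ (t - ε) hΔ (by linarith [h2.2]) h1.2
    linarith
  · push Not at hord
    exact main Δ t hΔ (by linarith) hord
end

section
/- Let Δ ≥ 1 and t ≥ 10, and let R^+(z) = (1/2)·{H^+(Δ(t+z)) + H^+(Δ(t-z))} with H^+ Beurling's majorant of the sign function. Then ∫_{-∞}^{∞} {R^+(u) - χ_{[-t,t]}(u)}·Re (Γ_ℝ'/Γ_ℝ)(1/2 + iu) du = (log t)/(2Δ) + O(1/Δ + 1), with an absolute implied constant. -/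
open Complex Real Filter MeasureTheory

lemma sg_summable (x : ℝ) : Summable (fun m : ℤ => 1 / (x + m) ^ 2) := by
  have := (EisensteinSeries.linear_right_summable (x:ℂ) 1 (k := 2) (by norm_num))
  have h := this.norm
  refine h.congr fun m => ?_
  rw [norm_inv, norm_zpow]
  have : ((1:ℤ):ℂ) * x + m = ((x + m : ℝ) : ℂ) := by push_cast; ring
  rw [this, Complex.norm_real]
  simp [one_div]

lemma sg_upper (z : ℂ) (hz : 0 < z.im) :
    ∑' n : ℤ, 1 / (z + n) ^ 2 = (π / Complex.sin (π * z)) ^ 2 := by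
  have h := iteratedDerivWithin_cot_pi_mul_eq_mul_tsum_div_pow (k := 1) le_rfl (z := z) hz
  have hs : Complex.sin (π * z) ≠ 0 := by
    apply sin_pi_mul_ne_zero
    exact UpperHalfPlane.coe_mem_integerComplement ⟨z, hz⟩
  have hd : HasDerivAt (fun x : ℂ => π * Complex.cot (π * x)) (-(π / Complex.sin (π * z)) ^ 2) z := by
    have h1 : HasDerivAt (fun x : ℂ => (π : ℂ) * x) π z := by
      simpa using (hasDerivAt_id z).const_mul (π : ℂ)
    have h2 := ((h1.ccos.div h1.csin hs).const_mul (π:ℂ))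
    refine h2.congr_deriv ?_
    have := Complex.sin_sq_add_cos_sq (π * z)
    field_simp
    linear_combination (-1:ℂ) * this
  rw [iteratedDerivWithin_one, hd.hasDerivWithinAt.derivWithin] at h
  · simpa using h.symm
  · exact UpperHalfPlane.isOpen_upperHalfPlaneSet.uniqueDiffWithinAt hz

lemma sg_hasSum (x : ℝ) (hx : ∀ m : ℤ, x ≠ m) :
    HasSum (fun m : ℤ => 1 / (x + m) ^ 2) ((π / Real.sin (π * x)) ^ 2) := by
  have hsum := sg_summable x
  have hne : ∀ m : ℤ, x + m ≠ 0 := fun m h => hx (-m) (by push_cast; linarith)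
  have hsin : Complex.sin (π * x) ≠ 0 := by
    apply sin_pi_mul_ne_zero
    rintro ⟨m, hm⟩
    exact hx m (by exact_mod_cast hm.symm)
  have t1 : Tendsto (fun ε : ℝ => ∑' n : ℤ, 1 / ((x + ε * I : ℂ) + n) ^ 2) (nhdsWithin 0 (Set.Ioi 0))
      (nhds (∑' n : ℤ, 1 / ((x : ℂ) + n) ^ 2)) := by
    refine tendsto_tsum_of_dominated_convergence hsum ?_ ?_
    · intro n
      apply tendsto_nhdsWithin_of_tendsto_nhds
      have : ContinuousAt (fun ε : ℝ => 1 / ((x + ε * I : ℂ) + n) ^ 2) 0 := by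
        have : ((x + (0:ℝ) * I : ℂ) + n) ^ 2 ≠ 0 := by
          have := hne n
          simp
          exact_mod_cast this
        fun_prop (disch := assumption)
      have h := this.tendsto
      simpa using h
    · filter_upwards with ε n
      rw [norm_div, norm_one, norm_pow]
      have h1 : |x + n| ≤ ‖(x + ε * I : ℂ) + n‖ := by
        have := Complex.abs_re_le_norm ((x + ε * I : ℂ) + n)
        simpa using this
      have h2 : 0 < |x + n| := abs_pos.mpr (hne n)
      rw [← sq_abs (x + n)]
      gcongr
  have t2 : Tendsto (fun ε : ℝ => (π / Complex.sin (π * (x + ε * I))) ^ 2) (nhdsWithin 0 (Set.Ioi 0))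
      (nhds ((π / Complex.sin (π * x)) ^ 2)) := by
    apply tendsto_nhdsWithin_of_tendsto_nhds
    have : ContinuousAt (fun ε : ℝ => (π / Complex.sin (π * (x + ε * I))) ^ 2) 0 := by
      have : Complex.sin (π * (x + (0:ℝ) * I)) ≠ 0 := by simpa using hsin
      fun_prop (disch := assumption)
    simpa using this.tendsto
  have t3 := tendsto_nhds_unique (t2.congr' ?_) t1
  · have : ((∑' m : ℤ, 1 / (x + m) ^ 2 : ℝ) : ℂ) = (((π / Real.sin (π * x)) ^ 2 : ℝ) : ℂ) := by
      push_cast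
      exact t3.symm
    rw [← Complex.ofReal_injective this]
    exact hsum.hasSum
  · filter_upwards [self_mem_nhdsWithin] with ε hε
    refine (sg_upper _ ?_).symm
    simpa using hε

/-- the sinc squared kernel -/
noncomputable def sgK (x : ℝ) : ℝ := (Real.sin (π * x) / (π * x)) ^ 2

lemma sgK_nonneg (x : ℝ) : 0 ≤ sgK x := sq_nonneg _

lemma sgK_le (x : ℝ) : sgK x ≤ 2 / (1 + x ^ 2) := by
  have h1 : sgK x ≤ 1 := by
    unfold sgK
    rw [sq_le_one_iff_abs_le_one, abs_div]
    exact div_le_one_of_le₀ Real.abs_sin_le_abs (abs_nonneg _)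
  have h2 : sgK x * x ^ 2 ≤ 1 := by
    unfold sgK
    rcases eq_or_ne x 0 with rfl | hx
    · simp
    have : (Real.sin (π * x) / (π * x)) ^ 2 * x ^ 2 = Real.sin (π * x) ^ 2 / π ^ 2 := by
      field_simp
    rw [this]
    apply div_le_one_of_le₀ _ (by positivity)
    have := Real.sin_sq_le_one (π * x)
    nlinarith [Real.pi_gt_three]
  rw [le_div_iff₀ (by positivity)]
  linarith

lemma sgK_measurable : Measurable sgK := by
  unfold sgK; fun_prop

lemma sgK_integrable : Integrable sgK := by
  refine Integrable.mono' (integrable_inv_one_add_sq.const_mul 2) sgK_measurable.aestronglyMeasurable ?_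
  filter_upwards with x
  rw [Real.norm_of_nonneg (sgK_nonneg x)]
  simpa [div_eq_mul_inv] using sgK_le x

lemma sg_ae : ∀ᵐ x : ℝ, ∀ m : ℤ, x ≠ m := by
  have : (Set.range ((↑) : ℤ → ℝ)).Countable := Set.countable_range _
  filter_upwards [this.ae_notMem volume] with x hx m h
  exact hx ⟨m, h.symm⟩

lemma sgK_integral : ∫ x, sgK x = 1 := by
  have h1 := sgK_integrable.hasSum_intervalIntegral_comp_add_int
  have hi : ∀ n : ℤ, Integrable (fun x => sgK (x + n)) (volume.restrict (Set.Ioc 0 1)) := fun n =>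
    (sgK_integrable.comp_add_right (n:ℝ)).integrableOn
  have h2 := hasSum_integral_of_summable_integral_norm hi (by
    have := h1.summable
    refine this.congr fun n => ?_
    rw [intervalIntegral.integral_of_le zero_le_one]
    refine integral_congr_ae ?_
    filter_upwards with x
    rw [Real.norm_of_nonneg (sgK_nonneg _)])
  simp_rw [intervalIntegral.integral_of_le zero_le_one] at h1
  rw [h1.unique h2]
  have : ∀ᵐ x : ℝ ∂(volume.restrict (Set.Ioc 0 1)), ∑' n : ℤ, sgK (x + n) = 1 := by
    filter_upwards [ae_restrict_of_ae sg_ae] with x hx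
    have hs := (sg_hasSum x hx).mul_left ((Real.sin (π * x) / π) ^ 2)
    have hsin : Real.sin (π * x) ≠ 0 := by
      intro h
      rw [Real.sin_eq_zero_iff] at h
      obtain ⟨n, hn⟩ := h
      apply hx n
      have := Real.pi_ne_zero
      field_simp at hn
      linarith
    have : (Real.sin (π * x) / π) ^ 2 * (π / Real.sin (π * x)) ^ 2 = 1 := by
      have := Real.pi_ne_zero
      field_simp
    rw [this] at hs
    rw [← hs.tsum_eq]
    congr 1
    ext n
    unfold sgK
    have : Real.sin (π * (x + n)) ^ 2 = Real.sin (π * x) ^ 2 := by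
      rw [mul_add, mul_comm π (n:ℝ), Real.sin_add_int_mul_pi, mul_pow, ← zpow_natCast, ← zpow_mul, mul_comm n, zpow_mul]
      simp
    rw [div_pow, this, mul_pow, div_pow, div_mul_div_comm, mul_one]
  rw [integral_congr_ae this]
  simp

/-- `∑_{n ≥ 1} 1/(x+n)^2` -/
noncomputable def sgT (x : ℝ) : ℝ := ∑' n : ℕ, 1 / (x + (n + 1)) ^ 2

lemma sgT_hasSum (x : ℝ) : HasSum (fun n : ℕ => 1 / (x + (n + 1)) ^ 2) (sgT x) := by
  apply Summable.hasSum
  have := (sg_summable x).comp_injective (i := fun n : ℕ => ((n:ℤ) + 1)) (fun a b h => by simpa using h)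
  refine this.congr fun n => ?_
  simp

lemma sgT_neg_hasSum (x : ℝ) : HasSum (fun n : ℕ => 1 / (x - (n + 1)) ^ 2) (sgT (-x)) := by
  convert sgT_hasSum (-x) using 2 with n
  rw [← neg_sq]
  ring

lemma sg_tele (y : ℝ) (hy : 0 < y) : HasSum (fun n : ℕ => 1 / (y + n) - 1 / (y + (n + 1))) (1 / y) := by
  rw [hasSum_iff_tendsto_nat_of_nonneg]
  · have : ∀ n : ℕ, ∑ i ∈ Finset.range n, (1 / (y + i) - 1 / (y + (i + 1))) = 1 / y - 1 / (y + n) := by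
      intro n
      have := Finset.sum_range_sub' (fun i : ℕ => 1 / (y + i)) n
      simpa using this
    simp_rw [this]
    have h : Tendsto (fun n : ℕ => 1 / (y + n)) atTop (nhds 0) := by
      simp_rw [one_div]
      exact tendsto_inv_atTop_zero.comp (tendsto_atTop_add_const_left _ _ tendsto_natCast_atTop_atTop)
    simpa using tendsto_const_nhds.sub h
  · intro n
    have : 0 < y + n := by positivity
    rw [sub_nonneg]
    gcongr
    linarith

lemma sgT_le (y : ℝ) (hy : 0 < y) : sgT y ≤ 1 / y := by
  refine hasSum_le (fun n => ?_) (sgT_hasSum y) (sg_tele y hy)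
  have : 0 < y + n := by positivity
  have h2 : 0 < y + (n + 1) := by positivity
  rw [div_sub_div _ _ this.ne' h2.ne', div_le_div_iff₀ (by positivity) (by positivity)]
  nlinarith

lemma sgT_ge (y : ℝ) (hy : 0 < y) : 1 / (y + 1) ≤ sgT y := by
  refine hasSum_le (fun n => ?_) (sg_tele (y + 1) (by linarith)) (sgT_hasSum y)
  have : 0 < y + 1 + n := by positivity
  have h2 : 0 < y + 1 + (n + 1) := by positivity
  have h3 : y + (n + 1) = y + 1 + n := by ring
  rw [h3, div_sub_div _ _ this.ne' h2.ne', div_le_div_iff₀ (by positivity) (by positivity)]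
  nlinarith

lemma sg_all (x : ℝ) (hx : ∀ m : ℤ, x ≠ m) :
    (Real.sin (π * x) / π) ^ 2 * (sgT (-x) + sgT x + 1 / x ^ 2) = 1 := by
  have h1 : HasSum (fun m : ℤ => 1 / (x + m) ^ 2) (sgT x + 1 / x ^ 2 + sgT (-x)) := by
    have := HasSum.of_add_one_of_neg_add_one (f := fun m : ℤ => 1 / (x + m) ^ 2) (m := sgT x) (m' := sgT (-x))
      (by simpa using sgT_hasSum x) (by
        have := sgT_neg_hasSum x
        convert this using 2 with n
        push_cast
        ring)
    simpa using this
  have h2 := h1.unique (sg_hasSum x hx)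
  have hsin : Real.sin (π * x) ≠ 0 := by
    intro h
    rw [Real.sin_eq_zero_iff] at h
    obtain ⟨n, hn⟩ := h
    apply hx n
    have := Real.pi_ne_zero
    field_simp at hn
    linarith
  have : sgT (-x) + sgT x + 1 / x ^ 2 = (π / Real.sin (π * x)) ^ 2 := by rw [← h2]; ring
  rw [this]
  have := Real.pi_ne_zero
  field_simp

lemma sg_sgn (x : ℝ) :
    ∑' m : ℤ, (Int.sign m : ℂ) / ((x:ℂ) - (m : ℂ)) ^ 2 = ((sgT (-x) - sgT x : ℝ) : ℂ) := by
  have h1 : HasSum (fun m : ℤ => (Int.sign m : ℝ) / (x - m) ^ 2) (sgT (-x) - sgT x) := by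
    have := HasSum.of_add_one_of_neg_add_one (f := fun m : ℤ => (Int.sign m : ℝ) / (x - m) ^ 2)
      (m := sgT (-x)) (m' := - sgT x)
      (by
        have := sgT_neg_hasSum x
        convert this using 2 with n
        have : Int.sign ((n:ℤ) + 1) = 1 := Int.sign_eq_one_of_pos (by positivity)
        rw [this]
        simp)
      (by
        have := (sgT_hasSum x).neg
        refine Eq.mp (congrArg (fun F => HasSum F (-sgT x)) (funext fun n => ?_)) this
        have : Int.sign (-((n:ℤ) + 1)) = -1 := Int.sign_eq_neg_one_of_neg (by linarith)
        rw [this]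
        push_cast
        ring)
    simpa [sub_eq_add_neg] using this
  rw [← h1.tsum_eq, Complex.ofReal_tsum]
  congr 1
  ext m
  push_cast
  rfl

/-- the difference `H⁺(x) - sgn x` -/
noncomputable def sgG (Hp : ℂ → ℂ) (x : ℝ) : ℝ := (Hp x).re - Real.sign x

/-- the defining formula of Beurling's majorant off the integers -/
def SgHyp (Hp : ℂ → ℂ) : Prop := ∀ z : ℂ, (∀ m : ℤ, z ≠ (m : ℂ)) →
      Hp z = (Complex.sin (π * z) / π) ^ 2 *
          ((∑' m : ℤ, (Int.sign m : ℂ) / (z - (m : ℂ)) ^ 2) + 2 / z)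
        + (Complex.sin (π * z) / (π * z)) ^ 2

lemma sgH_eq (Hp : ℂ → ℂ) (hHp : SgHyp Hp) (x : ℝ) (hx : ∀ m : ℤ, x ≠ m) : (Hp x).re =
    (Real.sin (π * x) / π) ^ 2 * (sgT (-x) - sgT x + 2 / x + 1 / x ^ 2) := by
  have hx0 : x ≠ 0 := by simpa using hx 0
  rw [hHp x (fun m h => hx m (by exact_mod_cast h)), sg_sgn x]
  have : (Complex.sin (π * x) / π) ^ 2 * (((sgT (-x) - sgT x : ℝ) : ℂ) + 2 / (x:ℂ)) + (Complex.sin (π * x) / (π * x)) ^ 2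
    = (((Real.sin (π * x) / π) ^ 2 * (sgT (-x) - sgT x + 2 / x + 1 / x ^ 2) : ℝ) : ℂ) := by
    push_cast
    have : (x:ℂ) ≠ 0 := by exact_mod_cast hx0
    have : (π:ℂ) ≠ 0 := by exact_mod_cast Real.pi_ne_zero
    field_simp
  rw [this, Complex.ofReal_re]

lemma sgG_pos (Hp : ℂ → ℂ) (hHp : SgHyp Hp) (y : ℝ) (hy : 0 < y) (hx : ∀ m : ℤ, y ≠ m) :
    sgG Hp y = (Real.sin (π * y) / π) ^ 2 * (2 / y - 2 * sgT y) := by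
  have h1 := sg_all y hx
  rw [sgG, sgH_eq Hp hHp y hx, Real.sign_of_pos hy]
  linear_combination h1

lemma sgG_neg (Hp : ℂ → ℂ) (hHp : SgHyp Hp) (y : ℝ) (hy : 0 < y) (hx : ∀ m : ℤ, y ≠ m) :
    sgG Hp (-y) = (Real.sin (π * y) / π) ^ 2 * (2 * sgT y + 2 / y ^ 2 - 2 / y) := by
  have h1 := sg_all y hx
  have hx' : ∀ m : ℤ, -y ≠ m := fun m h => hx (-m) (by push_cast; linarith)
  rw [sgG, sgH_eq Hp hHp (-y) hx', Real.sign_of_neg (by linarith)]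
  have : Real.sin (π * -y) = - Real.sin (π * y) := by rw [mul_neg, Real.sin_neg]
  rw [this, neg_neg]
  linear_combination (-1:ℝ) * h1

lemma sgK_eq (y : ℝ) : sgK y = (Real.sin (π * y) / π) ^ 2 * (1 / y ^ 2) := by
  rw [sgK, div_pow, mul_pow, div_pow, div_mul_div_comm, mul_one]

lemma sgG_bound_pos (Hp : ℂ → ℂ) (hHp : SgHyp Hp) (y : ℝ) (hy : 0 < y) (hx : ∀ m : ℤ, y ≠ m) :
    |sgG Hp y| ≤ 2 * sgK y ∧ |sgG Hp (-y)| ≤ 2 * sgK y ∧ sgG Hp y + sgG Hp (-y) = 2 * sgK y := by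
  rw [sgG_pos Hp hHp y hy hx, sgG_neg Hp hHp y hy hx, sgK_eq]
  have h1 := sgT_le y hy
  have h2 := sgT_ge y hy
  have h3 : 1 / y - 1 / (y + 1) ≤ 1 / y ^ 2 := by
    rw [div_sub_div _ _ (by positivity) (by positivity), div_le_div_iff₀ (by positivity) (by positivity)]
    nlinarith
  have e1 : 2 / y = 2 * (1 / y) := by ring
  have e2 : 2 / y ^ 2 = 2 * (1 / y ^ 2) := by ring
  rw [e1, e2, abs_mul, abs_mul, abs_of_nonneg (sq_nonneg (Real.sin (π * y) / π)),
    mul_left_comm 2]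
  refine ⟨?_, ?_, by ring⟩
  · gcongr
    rw [abs_le]; constructor <;> linarith
  · gcongr
    rw [abs_le]; constructor <;> linarith

lemma sgK_even (y : ℝ) : sgK (-y) = sgK y := by
  simp [sgK, neg_div_neg_eq]

lemma sgG_bound (Hp : ℂ → ℂ) (hHp : SgHyp Hp) (x : ℝ) (hx : ∀ m : ℤ, x ≠ m) :
    |sgG Hp x| ≤ 2 * sgK x ∧ sgG Hp x + sgG Hp (-x) = 2 * sgK x := by
  have hx0 : x ≠ 0 := by simpa using hx 0
  rcases lt_or_gt_of_ne hx0 with h | h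
  · have := sgG_bound_pos Hp hHp (-x) (by linarith) (fun m h => hx (-m) (by push_cast; linarith))
    rw [neg_neg, sgK_even] at this
    exact ⟨this.2.1, by linarith [this.2.2]⟩
  · have := sgG_bound_pos Hp hHp x h hx
    exact ⟨this.1, this.2.2⟩

lemma sgG_le (Hp : ℂ → ℂ) (hHp : SgHyp Hp) : ∀ᵐ x : ℝ, |sgG Hp x| ≤ 4 / (1 + x ^ 2) := by
  filter_upwards [sg_ae] with x hx
  have := (sgG_bound Hp hHp x hx).1
  have h := sgK_le x
  calc _ ≤ _ := this
    _ ≤ 2 * (2 / (1 + x ^ 2)) := by gcongr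
    _ = _ := by ring

lemma sgG_meas (Hp : ℂ → ℂ) (hd : Differentiable ℂ Hp) : Measurable (sgG Hp) := by
  have h1 : Measurable (fun x : ℝ => (Hp x).re) :=
    (Complex.continuous_re.comp (hd.continuous.comp Complex.continuous_ofReal)).measurable
  have h2 : Measurable Real.sign := by
    unfold Real.sign
    refine Measurable.ite measurableSet_Iio measurable_const ?_
    exact Measurable.ite measurableSet_Ioi measurable_const measurable_const
  exact h1.sub h2

lemma sgG_integrable (Hp : ℂ → ℂ) (hHp : SgHyp Hp) (hd : Differentiable ℂ Hp) : Integrable (sgG Hp) := by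
  refine Integrable.mono' (integrable_inv_one_add_sq.const_mul 4) (sgG_meas Hp hd).aestronglyMeasurable ?_
  filter_upwards [sgG_le Hp hHp] with x hx
  simpa [div_eq_mul_inv] using hx

lemma sgG_integral (Hp : ℂ → ℂ) (hHp : SgHyp Hp) (hd : Differentiable ℂ Hp) : ∫ x, sgG Hp x = 1 := by
  have hi := sgG_integrable Hp hHp hd
  have h1 : ∫ x, (sgG Hp x + sgG Hp (-x)) = ∫ x, 2 * sgK x := by
    refine integral_congr_ae ?_
    filter_upwards [sg_ae] with x hx
    exact (sgG_bound Hp hHp x hx).2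
  rw [integral_add hi hi.comp_neg, integral_neg_eq_self (fun x => sgG Hp x), integral_const_mul, sgK_integral] at h1
  linarith


lemma sg_deriv_tendsto (f : ℕ → ℂ → ℂ) (g : ℂ → ℂ) (c : ℂ) (R M : ℝ) (hR : 0 < R)
    (hf : ∀ᶠ n in atTop, DifferentiableOn ℂ (f n) (Metric.closedBall c R))
    (hg : DifferentiableOn ℂ g (Metric.closedBall c R))
    (hlim : ∀ z ∈ Metric.sphere c R, Tendsto (fun n => f n z) atTop (nhds (g z)))
    (hM : ∀ᶠ n in atTop, ∀ z ∈ Metric.sphere c R, ‖f n z‖ ≤ M) :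
    Tendsto (fun n => deriv (f n) c) atTop (nhds (deriv g c)) := by
  have key : ∀ F : ℂ → ℂ, DifferentiableOn ℂ F (Metric.closedBall c R) →
      deriv F c = (2 * π * I : ℂ)⁻¹ • ∮ z in C(c, R), (z - c) ^ (-2 : ℤ) • F z := by
    intro F hF
    have := hF.deriv_eq_smul_circleIntegral hR
    have h0 : (2 * π * I : ℂ) ≠ 0 := Complex.two_pi_I_ne_zero
    have e : ∀ z : ℂ, (z - c) ^ (-2 : ℤ) = 1 / (z - c) ^ 2 := by
      intro z
      rw [zpow_neg, one_div]
      norm_cast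
    simp_rw [e]
    rw [this, smul_smul, inv_mul_cancel₀ h0, one_smul]
  rw [key g hg]
  have h1 : Tendsto (fun n => (2 * π * I : ℂ)⁻¹ • ∮ z in C(c, R), (z - c) ^ (-2 : ℤ) • f n z) atTop
      (nhds ((2 * π * I : ℂ)⁻¹ • ∮ z in C(c, R), (z - c) ^ (-2 : ℤ) • g z)) := by
    apply Tendsto.const_smul
    unfold circleIntegral
    refine intervalIntegral.tendsto_integral_filter_of_dominated_convergence
      (fun _ => R * ((R ^ 2)⁻¹ * M)) ?_ ?_ ?_ ?_
    · filter_upwards [hf] with n hn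
      have : ContinuousOn (f n) (Metric.sphere c R) := hn.continuousOn.mono Metric.sphere_subset_closedBall
      have h2 : Continuous (fun θ => f n (circleMap c R θ)) :=
        this.comp_continuous (continuous_circleMap c R) (fun θ => circleMap_mem_sphere c hR.le θ)
      have h3 : Continuous (fun θ => (circleMap c R θ - c) ^ (-2 : ℤ)) := by
        refine Continuous.zpow₀ ((continuous_circleMap c R).sub continuous_const) _ (fun θ => Or.inl ?_)
        exact sub_ne_zero.mpr (circleMap_ne_center hR.ne')
      have h4 : Continuous (fun θ => deriv (circleMap c R) θ) := by
        simp only [deriv_circleMap]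
        exact (continuous_circleMap 0 R).mul continuous_const
      exact (h4.smul (h3.smul h2)).aestronglyMeasurable
    · filter_upwards [hM] with n hn
      filter_upwards with θ _
      rw [norm_smul, norm_smul, norm_zpow]
      have a1 : ‖deriv (circleMap c R) θ‖ = R := by simp [abs_of_pos hR]
      have a2 : ‖circleMap c R θ - c‖ = R := by simp [circleMap, abs_of_pos hR]
      have a3 : R ^ (-2 : ℤ) = (R ^ 2)⁻¹ := by rw [zpow_neg]; norm_cast
      rw [a1, a2, a3]
      gcongr
      exact hn _ (circleMap_mem_sphere c hR.le θ)
    · exact intervalIntegrable_const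
    · filter_upwards with θ _
      exact ((hlim _ (circleMap_mem_sphere c hR.le θ)).const_smul _).const_smul _
  refine h1.congr' ?_
  filter_upwards [hf] with n hn
  exact (key _ hn).symm

lemma sg_ne (z : ℂ) (hz : 0 < z.re) (j : ℕ) : z + j ≠ 0 := by
  intro h
  have := congrArg Complex.re h
  simp at this
  have : (0:ℝ) ≤ j := by positivity
  linarith

lemma sg_gammaSeq_bound (z : ℂ) (hz : 0 < z.re) (n : ℕ) (hn : n ≠ 0) :
    ‖Complex.GammaSeq z n‖ ≤ Real.Gamma z.re := by
  have h1 : Real.BohrMollerup.logGammaSeq z.re n ≤ Real.log (Real.Gamma z.re) := by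
    have := Real.BohrMollerup.ge_logGammaSeq (f := Real.log ∘ Real.Gamma) Real.convexOn_log_Gamma
      (fun {y} hy => by
        rw [Function.comp_apply, Real.Gamma_add_one hy.ne', Real.log_mul hy.ne' (Real.Gamma_pos_of_pos hy).ne', Function.comp_apply, add_comm]) hz hn
    simpa using this
  have hn0 : (0:ℝ) < n := by positivity
  have hG : Real.exp (Real.BohrMollerup.logGammaSeq z.re n) = Real.GammaSeq z.re n := by
    unfold Real.BohrMollerup.logGammaSeq Real.GammaSeq
    rw [Real.exp_sub, Real.exp_add, Real.exp_log (by positivity), Real.exp_sum,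
      Real.rpow_def_of_pos hn0, mul_comm z.re]
    congr 1
    refine Finset.prod_congr rfl fun j _ => Real.exp_log (by positivity)
  have h2 : Real.GammaSeq z.re n ≤ Real.Gamma z.re := by
    rw [← hG, ← Real.exp_log (Real.Gamma_pos_of_pos hz)]
    exact Real.exp_le_exp.mpr h1
  refine le_trans ?_ h2
  unfold Complex.GammaSeq Real.GammaSeq
  rw [norm_div, norm_mul, norm_prod, Complex.norm_natCast, Complex.norm_natCast_cpow_of_pos (Nat.pos_of_ne_zero hn)]
  gcongr with j _
  have := Complex.re_le_norm (z + j)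
  simpa using this

lemma sg_gammaSeq_hasDeriv (z : ℂ) (hz : 0 < z.re) (n : ℕ) (hn : n ≠ 0) :
    DifferentiableAt ℂ (fun z => Complex.GammaSeq z n) z ∧
    logDeriv (fun z => Complex.GammaSeq z n) z = Real.log n - ∑ j ∈ Finset.range (n + 1), 1 / (z + j) := by
  have hn0 : (n : ℂ) ≠ 0 := by exact_mod_cast hn
  have hp : ∏ j ∈ Finset.range (n + 1), (z + j) ≠ 0 := Finset.prod_ne_zero_iff.mpr fun j _ => sg_ne z hz j
  have d1 : HasDerivAt (fun z : ℂ => (n : ℂ) ^ z) ((n : ℂ) ^ z * Complex.log n) z := by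
    simpa using (hasDerivAt_id z).const_cpow (c := (n:ℂ)) (Or.inl hn0)
  have d2 : DifferentiableAt ℂ (fun z : ℂ => ∏ j ∈ Finset.range (n + 1), (z + j)) z := by fun_prop
  have d3 : DifferentiableAt ℂ (fun z : ℂ => (n : ℂ) ^ z * (n.factorial : ℂ)) z := d1.differentiableAt.mul_const _
  have hnz : (n : ℂ) ^ z ≠ 0 := by simp [Complex.cpow_eq_zero_iff, hn0]
  have hfac : (n.factorial : ℂ) ≠ 0 := by exact_mod_cast n.factorial_ne_zero
  refine ⟨d3.div d2 hp, ?_⟩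
  unfold Complex.GammaSeq
  rw [logDeriv_div (f := fun z : ℂ => (n : ℂ) ^ z * (n.factorial : ℂ)) z (mul_ne_zero hnz hfac) hp d3 d2, logDeriv_mul_const _ _ hfac,
    logDeriv_prod (fun j _ => sg_ne z hz j) (fun j _ => by fun_prop), logDeriv_apply, d1.deriv,
    mul_div_cancel_left₀ _ hnz, Complex.natCast_log]
  congr 1
  refine Finset.sum_congr rfl fun j _ => ?_
  rw [logDeriv_apply]
  simp

lemma sg_digamma_tendsto (y : ℝ) :
    Tendsto (fun n : ℕ => Real.log n - ∑ j ∈ Finset.range (n + 1), (1 / ((1 / 4 + y * I : ℂ) + j)).re) atTop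
      (nhds (logDeriv Complex.Gamma (1 / 4 + y * I)).re) := by
  set c : ℂ := 1 / 4 + y * I with hc
  have hcre : c.re = 1 / 4 := by simp [hc]
  have hball : ∀ z ∈ Metric.closedBall c (1 / 8), 1 / 8 ≤ z.re ∧ z.re ≤ 3 / 8 := by
    intro z hz
    rw [Metric.mem_closedBall, dist_eq_norm] at hz
    have := (Complex.abs_re_le_norm (z - c)).trans hz
    rw [Complex.sub_re, hcre, abs_le] at this
    constructor <;> linarith [this.1, this.2]
  obtain ⟨M, hM⟩ : ∃ M, ∀ x ∈ Set.Icc (1 / 8 : ℝ) (3 / 8), Real.Gamma x ≤ M := by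
    have : ContinuousOn Real.Gamma (Set.Icc (1 / 8 : ℝ) (3 / 8)) := by
      intro x hx
      refine (Real.differentiableAt_Gamma fun m => ?_).continuousAt.continuousWithinAt
      have : (0:ℝ) ≤ m := by positivity
      have := hx.1
      intro h
      linarith
    obtain ⟨M, hM⟩ := (isCompact_Icc.image_of_continuousOn this).bddAbove
    exact ⟨M, fun x hx => hM ⟨x, hx, rfl⟩⟩
  have hd := sg_deriv_tendsto (fun n z => Complex.GammaSeq z n) Complex.Gamma c (1 / 8) M (by norm_num)
    (by
      filter_upwards [eventually_ne_atTop 0] with n hn z hz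
      exact (sg_gammaSeq_hasDeriv z (by linarith [(hball z hz).1]) n hn).1.differentiableWithinAt)
    (by
      intro z hz
      refine (Complex.differentiableAt_Gamma z fun m h => ?_).differentiableWithinAt
      have h1 := congrArg Complex.re h
      have : (0:ℝ) ≤ m := by positivity
      simp at h1
      linarith [(hball z hz).1])
    (fun z _ => Complex.GammaSeq_tendsto_Gamma z)
    (by
      filter_upwards [eventually_ne_atTop 0] with n hn z hz
      have := hball z (Metric.sphere_subset_closedBall hz)
      exact (sg_gammaSeq_bound z (by linarith) n hn).trans (hM _ this))
  have hG : Complex.Gamma c ≠ 0 := Complex.Gamma_ne_zero_of_re_pos (by rw [hcre]; norm_num)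
  have h2 := hd.div (Complex.GammaSeq_tendsto_Gamma c) hG
  have h3 := (Complex.continuous_re.tendsto _).comp h2
  refine h3.congr' ?_
  filter_upwards [eventually_ne_atTop 0] with n hn
  have := (sg_gammaSeq_hasDeriv c (by rw [hcre]; norm_num) n hn).2
  rw [logDeriv_apply] at this
  simp only [Function.comp_apply, Pi.div_apply]
  rw [this, Complex.sub_re, Complex.ofReal_re, Complex.re_sum]

/-- `½ log (a² + y²)` -/
noncomputable def sgL (y a : ℝ) : ℝ := Real.log (a ^ 2 + y ^ 2) / 2

lemma sg_step (y a : ℝ) (ha : 0 < a) :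
    |a / (a ^ 2 + y ^ 2) - (sgL y (a + 1) - sgL y a)| ≤ 2 / a ^ 2 := by
  have hD : 0 < a ^ 2 + y ^ 2 := by positivity
  have hE : 0 < (a + 1) ^ 2 + y ^ 2 := by positivity
  have e : sgL y (a + 1) - sgL y a = Real.log (((a + 1) ^ 2 + y ^ 2) / (a ^ 2 + y ^ 2)) / 2 := by
    rw [Real.log_div hE.ne' hD.ne', sgL, sgL]; ring
  have u1 := Real.log_le_sub_one_of_pos (div_pos hE hD)
  have u2 := Real.one_sub_inv_le_log_of_pos (div_pos hE hD)
  rw [inv_div] at u2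
  rw [e, abs_le]
  have v1 : ((a + 1) ^ 2 + y ^ 2) / (a ^ 2 + y ^ 2) - 1 = 2 * (a / (a ^ 2 + y ^ 2)) + 1 / (a ^ 2 + y ^ 2) := by
    field_simp; ring
  have v2 : 1 / (a ^ 2 + y ^ 2) ≤ 1 / a ^ 2 := by
    gcongr; nlinarith [sq_nonneg y]
  have v3 : a / (a ^ 2 + y ^ 2) - (1 - (a ^ 2 + y ^ 2) / ((a + 1) ^ 2 + y ^ 2)) / 2 ≤ 2 * (1 / (a ^ 2 + y ^ 2)) := by
    have : a / (a ^ 2 + y ^ 2) - (1 - (a ^ 2 + y ^ 2) / ((a + 1) ^ 2 + y ^ 2)) / 2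
      = (a * (2 * a + 1) - (a ^ 2 + y ^ 2) / 2) / (((a + 1) ^ 2 + y ^ 2)) * (1 / (a ^ 2 + y ^ 2)) := by
      field_simp; ring
    rw [this]
    gcongr
    rw [div_le_iff₀ hE]
    nlinarith [sq_nonneg y]
  have e2 : 2 / a ^ 2 = 2 * (1 / a ^ 2) := by ring
  have : 0 < 1 / a ^ 2 := by positivity
  rw [e2]
  constructor <;> linarith

lemma sg_digamma_bound : ∃ C : ℝ, ∀ y : ℝ,
    |(logDeriv Complex.Gamma (1 / 4 + y * I)).re - sgL y (1 / 4)| ≤ C := by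
  have hs : Summable (fun j : ℕ => 2 / ((1 / 4 : ℝ) + j) ^ 2) := by
    have := ((sg_summable (1 / 4)).comp_injective (i := fun n : ℕ => (n:ℤ)) (fun a b h => by simpa using h)).mul_left 2
    refine this.congr fun n => ?_
    simp [div_eq_mul_inv]
  refine ⟨(∑' j : ℕ, 2 / ((1 / 4 : ℝ) + j) ^ 2) + 2, fun y => ?_⟩
  have ht := (sg_digamma_tendsto y)
  have ht2 := (ht.sub_const (sgL y (1 / 4))).abs
  refine le_of_tendsto ht2 ?_
  filter_upwards [eventually_ge_atTop 2, tendsto_natCast_atTop_atTop.eventually_ge_atTop |y|] with n hn hny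
  have hre : ∀ j : ℕ, (1 / ((1 / 4 + y * I : ℂ) + j)).re = (1 / 4 + j) / ((1 / 4 + j) ^ 2 + y ^ 2) := by
    intro j
    have h1 : ((1 / 4 + y * I : ℂ) + j) = ⟨1 / 4 + j, y⟩ := by
      apply Complex.ext <;> simp
    rw [h1, one_div, Complex.inv_re, Complex.normSq_apply]
    simp only
    congr 1
    ring
  simp_rw [hre]
  have htel : ∑ j ∈ Finset.range (n + 1), (sgL y ((1 / 4 + j) + 1) - sgL y (1 / 4 + j))
      = sgL y (1 / 4 + (n + 1)) - sgL y (1 / 4) := by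
    have := Finset.sum_range_sub (fun j : ℕ => sgL y (1 / 4 + j)) (n + 1)
    simp only [Nat.cast_add, Nat.cast_one, Nat.cast_zero, add_zero] at this
    rw [← this]
    refine Finset.sum_congr rfl fun j _ => ?_
    rw [add_assoc]
  have herr : |∑ j ∈ Finset.range (n + 1), ((1 / 4 + j) / ((1 / 4 + j) ^ 2 + y ^ 2)
      - (sgL y ((1 / 4 + j) + 1) - sgL y (1 / 4 + j)))| ≤ ∑' j : ℕ, 2 / ((1 / 4 : ℝ) + j) ^ 2 := by
    refine (Finset.abs_sum_le_sum_abs _ _).trans ?_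
    have hp : ∀ j : ℕ, (0:ℝ) < 1 / 4 + (j : ℝ) := fun j => by positivity
    refine (Finset.sum_le_sum fun (j : ℕ) _ => sg_step y (1 / 4 + (j : ℝ)) (hp j)).trans ?_
    exact hs.sum_le_tsum _ (fun j _ => by positivity)
  rw [Finset.sum_sub_distrib, htel] at herr
  have hn' : (2:ℝ) ≤ n := by exact_mod_cast hn
  have hn0 : (0:ℝ) < n := by linarith
  have hlog : |Real.log n - sgL y (1 / 4 + (n + 1))| ≤ 2 := by
    have e : Real.log n = Real.log ((n:ℝ) ^ 2) / 2 := by rw [Real.log_pow]; push_cast; ring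
    have hP : 0 < (1 / 4 + ((n:ℝ) + 1)) ^ 2 + y ^ 2 := by positivity
    have hy2 : y ^ 2 ≤ (n:ℝ) ^ 2 := by
      rw [← sq_abs]
      exact pow_le_pow_left₀ (abs_nonneg y) hny 2
    have l1 : Real.log ((n:ℝ) ^ 2) ≤ Real.log ((1 / 4 + ((n:ℝ) + 1)) ^ 2 + y ^ 2) := by
      apply Real.log_le_log (pow_pos hn0 2)
      nlinarith [sq_nonneg y]
    have l2 : Real.log ((1 / 4 + ((n:ℝ) + 1)) ^ 2 + y ^ 2) ≤ Real.log (5 * (n:ℝ) ^ 2) := by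
      apply Real.log_le_log hP
      nlinarith
    rw [Real.log_mul (by norm_num) (pow_pos hn0 2).ne'] at l2
    have l3 : Real.log 5 ≤ 5 - 1 := Real.log_le_sub_one_of_pos (by norm_num)
    rw [e, sgL, abs_le]
    constructor <;> linarith
  rw [abs_le] at *
  constructor <;> linarith [herr.1, herr.2, hlog.1, hlog.2]

/-- `Re (Γℝ'/Γℝ)(1/2 + iu)` -/
noncomputable def sgF (u : ℝ) : ℝ := (logDeriv Complex.Gammaℝ (1 / 2 + u * Complex.I)).re

lemma sgF_eq (u : ℝ) : sgF u = - Real.log π / 2 + (logDeriv Complex.Gamma (1 / 4 + (u / 2 : ℝ) * I)).re / 2 := by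
  set s : ℂ := 1 / 2 + u * I with hs
  have hs2 : s / 2 = 1 / 4 + (u / 2 : ℝ) * I := by rw [hs]; push_cast; ring
  have hpi : (π : ℂ) ≠ 0 := by exact_mod_cast Real.pi_ne_zero
  have d0 : HasDerivAt (fun s : ℂ => -s / 2) (-1 / 2) s := by
    simpa using ((hasDerivAt_id s).neg).div_const 2
  have d1 : HasDerivAt (fun s : ℂ => (π : ℂ) ^ (-s / 2)) ((π : ℂ) ^ (-s / 2) * Complex.log π * (-1 / 2)) s :=
    d0.const_cpow (Or.inl hpi)
  have hre : 0 < (s / 2).re := by rw [hs2]; simp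
  have hd : DifferentiableAt ℂ Complex.Gamma (s / 2) := by
    refine Complex.differentiableAt_Gamma _ fun m h => ?_
    have h1 := congrArg Complex.re h
    have : (0:ℝ) ≤ m := by positivity
    rw [h1] at hre
    simp at hre
    linarith
  have d2 : HasDerivAt (fun s : ℂ => Complex.Gamma (s / 2)) (deriv Complex.Gamma (s / 2) * (1 / 2)) s := by
    have := (hasDerivAt_id s).div_const 2
    exact HasDerivAt.comp (h₂ := Complex.Gamma) s hd.hasDerivAt this
  have hp : (π : ℂ) ^ (-s / 2) ≠ 0 := by simp [Complex.cpow_eq_zero_iff, hpi]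
  have hG : Complex.Gamma (s / 2) ≠ 0 := Complex.Gamma_ne_zero_of_re_pos hre
  have : logDeriv Complex.Gammaℝ s = ((-Real.log π / 2 : ℝ) : ℂ) + logDeriv Complex.Gamma (s / 2) / (2 : ℝ) := by
    have e : Complex.Gammaℝ = fun s : ℂ => (π : ℂ) ^ (-s / 2) * Complex.Gamma (s / 2) := by
      ext s; rw [Complex.Gammaℝ_def]
    rw [e, logDeriv_mul (f := fun s : ℂ => (π : ℂ) ^ (-s / 2)) (g := fun s : ℂ => Complex.Gamma (s / 2)) s hp hG
      d1.differentiableAt d2.differentiableAt]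
    rw [logDeriv_apply, logDeriv_apply, logDeriv_apply, d1.deriv, d2.deriv, ← Complex.ofReal_log Real.pi_pos.le]
    push_cast
    field_simp
  rw [sgF, this, hs2, Complex.add_re, Complex.ofReal_re, Complex.div_ofReal_re]

lemma sgF_bound : ∃ C : ℝ, ∀ u : ℝ, |sgF u - Real.log (1 + |u|) / 2| ≤ C := by
  obtain ⟨C, hC⟩ := sg_digamma_bound
  refine ⟨Real.log π / 2 + C / 2 + 10, fun u => ?_⟩
  have h1 := hC (u / 2)
  have h2 : |sgL (u / 2) (1 / 4) - Real.log (1 + |u|)| ≤ 16 := by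
    have e : Real.log (1 + |u|) = Real.log ((1 + |u|) ^ 2) / 2 := by rw [Real.log_pow]; push_cast; ring
    have hu := sq_abs u
    have h0 := abs_nonneg u
    have l1 : Real.log ((1 / 4) ^ 2 + (u / 2) ^ 2) ≤ Real.log ((1 + |u|) ^ 2) := by
      apply Real.log_le_log (by positivity)
      nlinarith
    have l2 : Real.log ((1 + |u|) ^ 2) ≤ Real.log (32 * ((1 / 4) ^ 2 + (u / 2) ^ 2)) := by
      apply Real.log_le_log (by positivity)
      nlinarith [sq_nonneg (|u| - 1)]
    rw [Real.log_mul (by norm_num) (by positivity)] at l2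
    have l3 : Real.log 32 ≤ 32 - 1 := Real.log_le_sub_one_of_pos (by norm_num)
    rw [e, sgL, abs_le]
    constructor <;> linarith
  have h3 : 0 ≤ Real.log π := Real.log_nonneg (by linarith [Real.pi_gt_three])
  rw [sgF_eq]
  rw [abs_le] at *
  constructor <;> linarith [h1.1, h1.2, h2.1, h2.2]

lemma sgF_meas : Measurable sgF := by
  have h1 : Measurable (fun s : ℂ => deriv Complex.Gammaℝ s * (Complex.Gammaℝ s)⁻¹) :=
    (measurable_deriv _).mul Complex.differentiable_Gammaℝ_inv.continuous.measurable
  have h2 : Measurable (fun u : ℝ => (1 / 2 + u * Complex.I : ℂ)) := by fun_prop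
  exact Complex.measurable_re.comp (h1.comp h2)

/-- the dominating weight -/
noncomputable def sgW (C v : ℝ) : ℝ := 4 / (1 + v ^ 2) * (C + 1 + Real.log (1 + |v|))

lemma sgW_integrable (C : ℝ) : Integrable (sgW C) := by
  have h1 : Integrable (fun v : ℝ => 4 / (1 + v ^ 2) * (C + 1)) := by
    have := (integrable_inv_one_add_sq.const_mul 4).mul_const (C + 1)
    simpa [div_eq_mul_inv] using this
  have h2 : Integrable (fun v : ℝ => 4 / (1 + v ^ 2) * Real.log (1 + |v|)) := by
    have hi : Integrable (fun v : ℝ => (1 + ‖v‖) ^ (-(3 / 2 : ℝ))) :=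
      integrable_one_add_norm (by simp; norm_num)
    refine Integrable.mono' (hi.const_mul 16) ?_ ?_
    · have : Measurable (fun v : ℝ => 4 / (1 + v ^ 2) * Real.log (1 + |v|)) := by fun_prop
      exact this.aestronglyMeasurable
    · filter_upwards with v
      have hv := abs_nonneg v
      have hlog : 0 ≤ Real.log (1 + |v|) := Real.log_nonneg (by linarith)
      rw [Real.norm_of_nonneg (by positivity), Real.norm_eq_abs]
      have a1 : Real.log (1 + |v|) ≤ (1 + |v|) ^ (1 / 2 : ℝ) / (1 / 2) :=
        Real.log_le_rpow_div (by linarith) (by norm_num)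
      have a2 : 4 / (1 + v ^ 2) ≤ 8 * (1 + |v|) ^ (-2 : ℝ) := by
        rw [Real.rpow_neg (by linarith), Real.rpow_two, ← div_eq_mul_inv,
          div_le_div_iff₀ (by positivity) (by positivity)]
        nlinarith [sq_abs v, sq_nonneg (|v| - 1)]
      calc 4 / (1 + v ^ 2) * Real.log (1 + |v|)
          ≤ (8 * (1 + |v|) ^ (-2 : ℝ)) * ((1 + |v|) ^ (1 / 2 : ℝ) / (1 / 2)) := by gcongr
        _ = 16 * ((1 + |v|) ^ (-2 : ℝ) * (1 + |v|) ^ (1 / 2 : ℝ)) := by ring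
        _ = 16 * (1 + |v|) ^ (-(3 / 2 : ℝ)) := by
          rw [← Real.rpow_add (by linarith)]; norm_num
  have : sgW C = fun v => 4 / (1 + v ^ 2) * (C + 1) + 4 / (1 + v ^ 2) * Real.log (1 + |v|) := by
    ext v; rw [sgW]; ring
  rw [this]
  exact h1.add h2

lemma sg_fbound (f : ℝ → ℝ) (C : ℝ) (hf : ∀ u, |f u - Real.log (1 + |u|) / 2| ≤ C)
    (Δ t v : ℝ) (hΔ : 1 ≤ Δ) (ht : 10 ≤ t) :
    |f (v / Δ - t) - Real.log t / 2| ≤ C + 1 + Real.log (1 + |v|) := by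
  have h := hf (v / Δ - t)
  have hw : |v / Δ| ≤ |v| := by
    rw [abs_div, abs_of_pos (by linarith : 0 < Δ)]
    exact div_le_self (abs_nonneg v) hΔ
  have hv := abs_nonneg v
  set w := v / Δ
  have h1 : |w - t| ≤ |v| + t := by
    have := abs_sub w t
    rw [abs_of_pos (by linarith : 0 < t)] at this
    linarith
  have h2 : t ≤ |v| + |w - t| := by
    have := abs_sub_abs_le_abs_sub t w
    rw [abs_sub_comm, abs_of_pos (by linarith : 0 < t)] at this
    linarith
  have h0 := abs_nonneg (w - t)
  have l1 : Real.log (1 + |w - t|) ≤ Real.log (1 + |v|) + Real.log t + 1 := by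
    have : Real.log (1 + |w - t|) ≤ Real.log (2 * ((1 + |v|) * t)) := by
      apply Real.log_le_log (by positivity)
      nlinarith
    rw [Real.log_mul (by norm_num) (by positivity), Real.log_mul (by positivity) (by linarith)] at this
    have l3 : Real.log 2 ≤ 2 - 1 := Real.log_le_sub_one_of_pos (by norm_num)
    linarith
  have l2 : Real.log t ≤ Real.log (1 + |v|) + Real.log (1 + |w - t|) := by
    rw [← Real.log_mul (by positivity) (by positivity)]
    apply Real.log_le_log (by linarith)
    nlinarith
  have hlog : 0 ≤ Real.log (1 + |v|) := Real.log_nonneg (by linarith)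
  rw [abs_le] at *
  constructor <;> linarith [h.1, h.2]

lemma sg_main (Hp : ℂ → ℂ) (hHp : SgHyp Hp) (hd : Differentiable ℂ Hp) (f : ℝ → ℝ) (hm : Measurable f)
    (C : ℝ) (hf : ∀ u, |f u - Real.log (1 + |u|) / 2| ≤ C) (Δ t : ℝ) (hΔ : 1 ≤ Δ) (ht : 10 ≤ t) :
    Integrable (fun u => sgG Hp (Δ * (t + u)) * f u) ∧
    |(∫ u, sgG Hp (Δ * (t + u)) * f u) - Real.log t / (2 * Δ)| ≤ (∫ v, sgW C v) / Δ := by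
  have hΔ0 : 0 < Δ := by linarith
  have hgi := sgG_integrable Hp hHp hd
  have hle : ∀ᵐ v : ℝ, ‖sgG Hp v * (f (v / Δ - t) - Real.log t / 2)‖ ≤ sgW C v := by
    filter_upwards [sgG_le Hp hHp] with v hv
    rw [norm_mul, Real.norm_eq_abs, Real.norm_eq_abs, sgW]
    exact mul_le_mul hv (sg_fbound f C hf Δ t v hΔ ht) (abs_nonneg _) (by positivity)
  have hi : Integrable (fun v => sgG Hp v * (f (v / Δ - t) - Real.log t / 2)) := by
    refine Integrable.mono' (sgW_integrable C) ?_ hle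
    have := sgG_meas Hp hd
    have : Measurable (fun v => sgG Hp v * (f (v / Δ - t) - Real.log t / 2)) := by fun_prop
    exact this.aestronglyMeasurable
  have hb := norm_integral_le_of_norm_le (sgW_integrable C) hle
  set h : ℝ → ℝ := fun v => sgG Hp v * f (v / Δ - t) with hh
  have hsplit : h = fun v => sgG Hp v * (f (v / Δ - t) - Real.log t / 2) + sgG Hp v * (Real.log t / 2) := by
    ext v; rw [hh]; ring
  have hhi : Integrable h := by
    rw [hsplit]; exact hi.add (hgi.mul_const _)
  have hhval : ∫ v, h v = (∫ v, sgG Hp v * (f (v / Δ - t) - Real.log t / 2)) + Real.log t / 2 := by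
    rw [hsplit, integral_add hi (hgi.mul_const _), integral_mul_const, sgG_integral Hp hHp hd, one_mul]
  have hcomp : (fun u => sgG Hp (Δ * (t + u)) * f u) = fun u => h (Δ * (t + u)) := by
    ext u
    simp only [hh]
    congr 2
    field_simp
    ring
  rw [hcomp]
  constructor
  · exact (hhi.comp_mul_left' hΔ0.ne').comp_add_left t
  · rw [integral_add_left_eq_self (fun u => h (Δ * u)) t, Measure.integral_comp_mul_left h Δ, smul_eq_mul,
      abs_of_pos (inv_pos.mpr hΔ0), hhval]
    have : Δ⁻¹ * ((∫ v, sgG Hp v * (f (v / Δ - t) - Real.log t / 2)) + Real.log t / 2) - Real.log t / (2 * Δ)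
      = (∫ v, sgG Hp v * (f (v / Δ - t) - Real.log t / 2)) / Δ := by
      generalize (∫ v, sgG Hp v * (f (v / Δ - t) - Real.log t / 2)) = J
      field_simp; ring
    rw [this, abs_div, abs_of_pos hΔ0]
    gcongr
    exact hb

lemma sg_chi (Hp : ℂ → ℂ) (Δ t u : ℝ) (hΔ : 0 < Δ) (ht : 0 < t) :
    ((Hp ((Δ * (t + u) : ℝ) : ℂ) + Hp ((Δ * (t - u) : ℝ) : ℂ)) / 2).re
            - (if |u| < t then (1 : ℝ) else if |u| = t then 1 / 2 else 0)
      = (sgG Hp (Δ * (t + u)) + sgG Hp (Δ * (t + -u))) / 2 := by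
  have e : ∀ x : ℝ, Real.sign (Δ * x) = Real.sign x := by
    intro x
    rcases lt_trichotomy x 0 with h | rfl | h
    · rw [Real.sign_of_neg h, Real.sign_of_neg (mul_neg_of_pos_of_neg hΔ h)]
    · simp
    · rw [Real.sign_of_pos h, Real.sign_of_pos (mul_pos hΔ h)]
  have hs : (if |u| < t then (1 : ℝ) else if |u| = t then 1 / 2 else 0)
      = (Real.sign (t + u) + Real.sign (t - u)) / 2 := by
    split_ifs with h1 h2
    · rw [abs_lt] at h1
      rw [Real.sign_of_pos (by linarith [h1.1]), Real.sign_of_pos (by linarith [h1.2])]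
      norm_num
    · rcases (abs_eq ht.le).mp h2 with rfl | rfl
      · rw [Real.sign_of_pos (by linarith), sub_self, Real.sign_zero]; norm_num
      · rw [add_neg_cancel, Real.sign_zero, Real.sign_of_pos (by linarith)]; norm_num
    · have h3 : t < |u| := lt_of_le_of_ne (not_lt.mp h1) (Ne.symm h2)
      rcases lt_abs.mp h3 with h | h
      · rw [Real.sign_of_pos (by linarith), Real.sign_of_neg (by linarith)]; norm_num
      · rw [Real.sign_of_neg (by linarith), Real.sign_of_pos (by linarith)]; norm_num
  rw [hs, ← sub_eq_add_neg, sgG, sgG, e, e]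
  have : ((Hp ((Δ * (t + u) : ℝ) : ℂ) + Hp ((Δ * (t - u) : ℝ) : ℂ)) / 2).re =
    ((Hp ((Δ * (t + u) : ℝ) : ℂ)).re + (Hp ((Δ * (t - u) : ℝ) : ℂ)).re) / 2 := by
    rw [← Complex.add_re]
    exact Complex.div_ofReal_re _ 2
  rw [this]
  ring

/-- for `Δ ≥ 1` and `t ≥ 10`, with `R⁺(z) = (1/2){H⁺(Δ(t+z)) + H⁺(Δ(t-z))}`
built from Beurling's majorant `H⁺` of the sign function,
`∫ {R⁺(u) - χ_{[-t,t]}(u)} Re (Γℝ'/Γℝ)(1/2 + iu) du = (log t)/(2Δ) + O(1/Δ + 1)`,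
with an absolute implied constant. -/
theorem selberg_gamma_integral
    (Hp : ℂ → ℂ)
    (hHp_entire : Differentiable ℂ Hp)
    (hHp : ∀ z : ℂ, (∀ m : ℤ, z ≠ (m : ℂ)) →
      Hp z = (Complex.sin (π * z) / π) ^ 2 *
          ((∑' m : ℤ, (Int.sign m : ℂ) / (z - (m : ℂ)) ^ 2) + 2 / z)
        + (Complex.sin (π * z) / (π * z)) ^ 2) :
    ∃ C : ℝ, ∀ Δ t : ℝ, 1 ≤ Δ → 10 ≤ t →
      |(∫ u : ℝ, (((Hp ((Δ * (t + u) : ℝ) : ℂ) + Hp ((Δ * (t - u) : ℝ) : ℂ)) / 2).re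
            - (if |u| < t then (1 : ℝ) else if |u| = t then 1 / 2 else 0)) *
          (logDeriv Complex.Gammaℝ (1 / 2 + u * Complex.I)).re)
        - Real.log t / (2 * Δ)| ≤ C * (1 / Δ + 1) := by
  obtain ⟨C, hC⟩ := sgF_bound
  refine ⟨∫ v, sgW C v, fun Δ t hΔ ht => ?_⟩
  have hΔ0 : 0 < Δ := by linarith
  obtain ⟨i1, b1⟩ := sg_main Hp hHp hHp_entire sgF sgF_meas C hC Δ t hΔ ht
  obtain ⟨i2, b2⟩ := sg_main Hp hHp hHp_entire (fun u => sgF (-u)) (sgF_meas.comp measurable_neg) C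
    (fun u => by simpa using hC (-u)) Δ t hΔ ht
  have i2' : Integrable (fun u => sgG Hp (Δ * (t + -u)) * sgF u) := by
    simpa using i2.comp_neg
  have e2 : ∫ u, sgG Hp (Δ * (t + u)) * sgF (-u) = ∫ u, sgG Hp (Δ * (t + -u)) * sgF u := by
    rw [← integral_neg_eq_self (fun u => sgG Hp (Δ * (t + u)) * sgF (-u))]
    simp
  rw [e2] at b2
  have e : (∫ u : ℝ, (((Hp ((Δ * (t + u) : ℝ) : ℂ) + Hp ((Δ * (t - u) : ℝ) : ℂ)) / 2).re
            - (if |u| < t then (1 : ℝ) else if |u| = t then 1 / 2 else 0)) *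
          (logDeriv Complex.Gammaℝ (1 / 2 + u * Complex.I)).re)
      = ((∫ u, sgG Hp (Δ * (t + u)) * sgF u) + ∫ u, sgG Hp (Δ * (t + -u)) * sgF u) / 2 := by
    rw [← integral_add i1 i2', ← integral_div]
    congr 1
    ext u
    rw [sg_chi Hp Δ t u hΔ0 (by linarith), sgF]
    ring
  have hW : 0 ≤ (∫ v, sgW C v) / Δ := (abs_nonneg _).trans b1
  have hW' : 0 ≤ ∫ v, sgW C v := by
    have := mul_nonneg hW hΔ0.le
    rwa [div_mul_cancel₀ _ hΔ0.ne'] at this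
  rw [e, mul_add, mul_one_div, mul_one]
  rw [abs_le] at *
  constructor <;> linarith [b1.1, b1.2, b2.1, b2.2]
end
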